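/- Fix n_0 ≥ 1 and a Boolean function f of n_0 variables with tree size complexity L(f) ≥ 3, identified for n ≥ n_0 with its extension to n variables, and let I_f be the set of irreducible trees computing f that are not minimal trees of f. Then μ_n(E^*(I_f)) = o(n^{−L(f)}) as n → ∞, i.e. n^{L(f)}·μ_n(E^*(I_f)) → 0. -/

import Mathlib

/-- An and/or tree skeleton: leaves carry a variable index and a polarity
(`true` = positive literal, `false` = negated literal); internal nodes carry
a connective (`true` = AND, `false` = OR) and a list of children. -/
inductive AT (n : ℕ) : Type
  | leaf : Fin n → Bool → AT n
  | node : Bool → List (AT n) → AT n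

namespace AT

/-- The connective at the root, if the root is an internal node. -/
def rootConn {n : ℕ} : AT n → Option Bool
  | .leaf _ _ => none
  | .node c _ => some c

/-- Whether a tree is a single leaf. -/
def isLeafB {n : ℕ} : AT n → Bool
  | .leaf _ _ => true
  | .node _ _ => false

/-- The children of the root. -/
def rootChildren {n : ℕ} : AT n → List (AT n)
  | .leaf _ _ => []
  | .node _ ts => ts

/-- Well-formedness: an associative tree is a plane tree in which each internal
node has at least two children, no internal node has the same connective as its
parent (stratification), and leaves carry literals. -/
inductive WF {n : ℕ} : AT n → Prop
  | leaf (i : Fin n) (b : Bool) : WF (.leaf i b)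
  | node (c : Bool) (ts : List (AT n)) :
      2 ≤ ts.length → (∀ t ∈ ts, WF t) → (∀ t ∈ ts, rootConn t ≠ some c) →
      WF (.node c ts)

mutual
/-- The size of a tree: its total number of nodes. -/
def size {n : ℕ} : AT n → ℕ
  | .leaf _ _ => 1
  | .node _ ts => 1 + sizeList ts
def sizeList {n : ℕ} : List (AT n) → ℕ
  | [] => 0
  | t :: ts => size t + sizeList ts
end

mutual
/-- The Boolean function computed by a tree. -/
def eval {n : ℕ} : AT n → (Fin n → Bool) → Bool
  | .leaf i b, x => if b then x i else ! x i
  | .node c ts, x => evalList c ts x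
def evalList {n : ℕ} : Bool → List (AT n) → (Fin n → Bool) → Bool
  | c, [], _ => c
  | c, t :: ts, x => if c then eval t x && evalList c ts x
                     else eval t x || evalList c ts x
end

end AT

open AT

/-- Number of associative trees of size `m` in a family `𝒯`. -/
noncomputable def countIn (n : ℕ) (𝒯 : Set (AT n)) (m : ℕ) : ℕ :=
  Nat.card {t : AT n // t ∈ 𝒯 ∧ WF t ∧ size t = m}

/-- `A n m` is the number of associative trees of size `m` on `n` variables. -/
noncomputable def A (n m : ℕ) : ℕ := countIn n Set.univ m

/-- `Pmn n m f` is the proportion, among associative trees of size `m` on `n`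
variables, of those computing the Boolean function `f`. -/
noncomputable def Pmn (n m : ℕ) (f : (Fin n → Bool) → Bool) : ℝ :=
  (countIn n {t | eval t = f} m : ℝ) / (A n m : ℝ)

/-- Ratio of trees of size `m` in the family `𝒯` among all trees of size `m`. -/
noncomputable def ratio (n : ℕ) (𝒯 : Set (AT n)) (m : ℕ) : ℝ :=
  (countIn n 𝒯 m : ℝ) / (A n m : ℝ)

/-- `HasLimRatio n 𝒯 μ` : the limiting ratio of the family `𝒯` exists and is `μ`. -/
def HasLimRatio (n : ℕ) (𝒯 : Set (AT n)) (μ : ℝ) : Prop :=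
  Filter.Tendsto (ratio n 𝒯) Filter.atTop (nhds μ)

/-- Extension of a Boolean function of `n₀` variables to `n ≥ n₀` variables. -/
def extend {n₀ n : ℕ} (h : n₀ ≤ n) (f : (Fin n₀ → Bool) → Bool) :
    (Fin n → Bool) → Bool :=
  fun x => f (fun j => x (Fin.castLE h j))

open Classical in
/-- The tree size complexity of a Boolean function. -/
noncomputable def Lcomp (n : ℕ) (f : (Fin n → Bool) → Bool) : ℕ :=
  if f = (fun _ => true) ∨ f = (fun _ => false) then 0
  else if ∃ i : Fin n, f = (fun x => x i) ∨ f = (fun x => ! x i) then 2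
  else sInf {m | ∃ t : AT n, WF t ∧ size t = m ∧ eval t = f}

/-- `TautExp t t'` : `t'` is obtained from `t` by one tautology expansion, i.e. by
attaching a new well-formed tree `e` (whose root, if internal, carries the label
opposite to that of the node `ν` it is attached to) as an additional subtree of an
internal node `ν` of `t`, where `e` computes the constant function `True` if `ν` is
labelled `∧` and the constant function `False` if `ν` is labelled `∨`. -/
inductive TautExp {n : ℕ} : AT n → AT n → Prop
  | here (c : Bool) (ts₁ ts₂ : List (AT n)) (e : AT n) :
      WF e → rootConn e ≠ some c → eval e = (fun _ => c) →
      TautExp (.node c (ts₁ ++ ts₂)) (.node c (ts₁ ++ e :: ts₂))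
  | child (c : Bool) (ts₁ ts₂ : List (AT n)) (t t' : AT n) :
      TautExp t t' →
      TautExp (.node c (ts₁ ++ t :: ts₂)) (.node c (ts₁ ++ t' :: ts₂))

/-- `Ek 𝒯 k` = `E^k(𝒯)` : the trees obtained by `k` successive tautology expansions
of a tree of `𝒯`, with `E^0(𝒯) = 𝒯`.  `E^*(𝒯) = ⋃ k, Ek 𝒯 k`. -/
def Ek {n : ℕ} (F : Set (AT n)) : ℕ → Set (AT n)
  | 0 => F
  | k + 1 => {t' | ∃ t ∈ Ek F k, TautExp t t'}

/-- The set `M_f` of minimal trees of a Boolean function `f`: well-formed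
associative trees computing `f` of minimal size among all such trees. -/
def Mset (n : ℕ) (f : (Fin n → Bool) → Bool) : Set (AT n) :=
  {t | WF t ∧ eval t = f ∧ ∀ t' : AT n, WF t' → eval t' = f → size t ≤ size t'}

/-- The set `I_f` of irreducible trees computing `f` that are not minimal trees of
`f`: well-formed trees computing `f` which cannot be obtained by a tautology
expansion of a strictly smaller well-formed tree computing `f`. -/
def Ifam (n : ℕ) (f : (Fin n → Bool) → Bool) : Set (AT n) :=
  {t | WF t ∧ eval t = f ∧
    (¬ ∃ t₀ : AT n, WF t₀ ∧ eval t₀ = f ∧ size t₀ < size t ∧ TautExp t₀ t) ∧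
    t ∉ Mset n f}

namespace S19
open AT
open scoped ENNReal

/-- Induction principle for trees. -/
theorem induct {n : ℕ} {P : AT n → Prop} (h1 : ∀ i b, P (.leaf i b))
    (h2 : ∀ c l, (∀ t ∈ l, P t) → P (.node c l)) : ∀ t, P t := by
  intro t
  exact AT.rec (motive_1 := P) (motive_2 := fun l => ∀ t ∈ l, P t) h1 h2
    (by simp) (by intro a l ha hl t ht; rcases List.mem_cons.1 ht with rfl | h
                  · exact ha
                  · exact hl t h) t

theorem sizeList_eq {n : ℕ} (l : List (AT n)) : sizeList l = (l.map size).sum := by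
  induction l with
  | nil => simp [sizeList]
  | cons t l ih => simp [sizeList, ih]

theorem sizeList_append {n : ℕ} (l r : List (AT n)) :
    sizeList (l ++ r) = sizeList l + sizeList r := by
  simp [sizeList_eq]

theorem size_le_of_mem {n : ℕ} {l : List (AT n)} {t : AT n} (h : t ∈ l) :
    size t ≤ sizeList l := by
  rw [sizeList_eq]
  exact List.single_le_sum (by simp) _ (List.mem_map_of_mem h)

theorem size_pos {n : ℕ} (t : AT n) : 0 < size t := by
  cases t <;> simp [size]

theorem evalList_eq_iff {n : ℕ} (c : Bool) (l : List (AT n)) (x : Fin n → Bool) :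
    evalList c l x = c ↔ ∀ t ∈ l, eval t x = c := by
  induction l with
  | nil => simp [evalList]
  | cons t l ih =>
    cases c <;> simp [evalList, ih]

theorem eval_node_iff {n : ℕ} (c : Bool) (l : List (AT n)) (x : Fin n → Bool) :
    eval (.node c l) x = c ↔ ∀ t ∈ l, eval t x = c := by
  rw [eval, evalList_eq_iff]

theorem eval_node_not_iff {n : ℕ} (c : Bool) (l : List (AT n)) (x : Fin n → Bool) :
    eval (.node c l) x = !c ↔ ∃ t ∈ l, eval t x = !c := by
  have := eval_node_iff c l x
  constructor
  · intro h
    by_contra hh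
    push Not at hh
    have : eval (.node c l) x = c := this.2 (fun t ht => by
      have := hh t ht
      revert this; cases eval t x <;> cases c <;> simp)
    rw [this] at h
    simp at h
  · rintro ⟨t, ht, h⟩
    by_contra hh
    have h3 : eval (.node c l) x = c := by
      revert hh; cases eval (.node c l) x <;> cases c <;> simp
    have := this.1 h3 t ht
    rw [this] at h
    simp at h

/-- Two nodes whose lists have pointwise the same values evaluate the same. -/
theorem eval_node_congr {n m : ℕ} (c : Bool) (l : List (AT n)) (l' : List (AT m))
    (x : Fin n → Bool) (x' : Fin m → Bool)
    (h : (∀ t ∈ l, eval t x = c) ↔ (∀ t ∈ l', eval t x' = c)) :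
    eval (.node c l) x = eval (.node c l') x' := by
  have h1 := eval_node_iff c l x
  have h2 := eval_node_iff c l' x'
  have : eval (.node c l) x = c ↔ eval (.node c l') x' = c := by rw [h1, h2, h]
  revert this
  cases eval (.node c l) x <;> cases eval (.node c l') x' <;> cases c <;> simp

theorem wf_node_iff {n : ℕ} (c : Bool) (l : List (AT n)) :
    WF (.node c l) ↔ 2 ≤ l.length ∧ ∀ t ∈ l, WF t ∧ rootConn t ≠ some c := by
  constructor
  · intro h
    cases h with
    | node _ _ h1 h2 h3 => exact ⟨h1, fun t ht => ⟨h2 t ht, h3 t ht⟩⟩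
  · rintro ⟨h1, h2⟩
    exact WF.node c l h1 (fun t ht => (h2 t ht).1) (fun t ht => (h2 t ht).2)

/-- `t` may be a child of a node labelled `c`. -/
def Ok {n : ℕ} (c : Bool) (t : AT n) : Prop := WF t ∧ rootConn t ≠ some c

theorem wf_node_iff' {n : ℕ} (c : Bool) (l : List (AT n)) :
    WF (.node c l) ↔ 2 ≤ l.length ∧ ∀ t ∈ l, Ok c t := wf_node_iff c l

theorem ok_leaf {n : ℕ} (c : Bool) (i : Fin n) (b : Bool) : Ok c (.leaf i b) :=
  ⟨WF.leaf i b, by simp [rootConn]⟩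

theorem ok_node_iff {n : ℕ} (c d : Bool) (l : List (AT n)) :
    Ok c (.node d l) ↔ d = !c ∧ 2 ≤ l.length ∧ ∀ t ∈ l, Ok d t := by
  rw [Ok, wf_node_iff']
  simp only [rootConn, ne_eq, Option.some.injEq]
  constructor
  · rintro ⟨h, h2⟩; exact ⟨by revert h2; cases c <;> cases d <;> simp, h⟩
  · rintro ⟨rfl, h⟩; exact ⟨h, by simp⟩

/-- decomposition of the type of trees -/
def treeEquiv (n : ℕ) : (Fin n × Bool) ⊕ (Bool × List (AT n)) ≃ AT n where
  toFun := Sum.elim (fun p => .leaf p.1 p.2) (fun p => .node p.1 p.2)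
  invFun := fun t => match t with
    | .leaf i b => Sum.inl (i, b)
    | .node c l => Sum.inr (c, l)
  left_inv := by rintro (⟨i, b⟩ | ⟨c, l⟩) <;> rfl
  right_inv := by rintro (⟨i, b⟩ | ⟨c, l⟩) <;> rfl

def listEquiv (α : Type*) : Unit ⊕ (α × List α) ≃ List α where
  toFun := Sum.elim (fun _ => []) (fun p => p.1 :: p.2)
  invFun := fun l => match l with
    | [] => Sum.inl ()
    | a :: l => Sum.inr (a, l)
  left_inv := by rintro (_ | ⟨c, l⟩) <;> rfl
  right_inv := by rintro (_ | ⟨c, l⟩) <;> rfl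

theorem tsum_sum_type {α β : Type*} (f : α ⊕ β → ℝ≥0∞) :
    ∑' x, f x = ∑' a, f (Sum.inl a) + ∑' b, f (Sum.inr b) := by
  have h1 : HasSum (fun a => f (Sum.inl a)) (∑' a, f (Sum.inl a)) := ENNReal.summable.hasSum
  have h2 : HasSum (fun a => f (Sum.inr a)) (∑' a, f (Sum.inr a)) := ENNReal.summable.hasSum
  exact (HasSum.sum h1 h2).tsum_eq

theorem tsum_tree {n : ℕ} (f : AT n → ℝ≥0∞) :
    ∑' t, f t = ∑ p : Fin n × Bool, f (.leaf p.1 p.2) +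
      (∑' l, f (.node true l) + ∑' l, f (.node false l)) := by
  rw [← (treeEquiv n).tsum_eq, tsum_sum_type, tsum_fintype]
  congr 1
  rw [ENNReal.tsum_prod', tsum_fintype]
  simp [treeEquiv]

theorem tsum_list {α : Type*} (f : List α → ℝ≥0∞) :
    ∑' l, f l = f [] + ∑' a, ∑' l, f (a :: l) := by
  rw [← (listEquiv α).tsum_eq, tsum_sum_type, tsum_fintype, ENNReal.tsum_prod']
  simp [listEquiv]

/-- product weight of a list -/
noncomputable def pw {α : Type*} (g : α → ℝ≥0∞) (l : List α) : ℝ≥0∞ := (l.map g).prod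

@[simp] theorem pw_nil {α : Type*} (g : α → ℝ≥0∞) : pw g [] = 1 := by simp [pw]
@[simp] theorem pw_cons {α : Type*} (g : α → ℝ≥0∞) (a : α) (l : List α) :
    pw g (a :: l) = g a * pw g l := by simp [pw]
@[simp] theorem pw_append {α : Type*} (g : α → ℝ≥0∞) (l r : List α) :
    pw g (l ++ r) = pw g l * pw g r := by simp [pw]

theorem tsum_pw_len {α : Type*} (g : α → ℝ≥0∞) (k : ℕ) :
    ∑' l : List α, (if l.length = k then pw g l else 0) = (∑' a, g a) ^ k := by
  induction k with
  | zero => rw [tsum_list]; simp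
  | succ k ih =>
    rw [tsum_list]
    have : ∀ a, ∑' l : List α, (if (a :: l).length = k + 1 then pw g (a :: l) else 0)
        = g a * (∑' a, g a) ^ k := by
      intro a
      rw [← ih, ← ENNReal.tsum_mul_left]
      congr 1; ext l
      simp
    simp only [this, ENNReal.tsum_mul_right]
    simp [pow_succ']

theorem tsum_pw_len_ge {α : Type*} (g : α → ℝ≥0∞) (k : ℕ) :
    ∑' l : List α, (if k ≤ l.length then pw g l else 0)
      = (∑' a, g a) ^ k * ∑' j : ℕ, (∑' a, g a) ^ j := by
  have : ∀ l : List α, (if k ≤ l.length then pw g l else 0)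
      = ∑' j : ℕ, if l.length = k + j then pw g l else 0 := by
    intro l
    by_cases h : k ≤ l.length
    · rw [tsum_eq_single (l.length - k)]
      · simp [h]
      · intro j hj
        rw [if_neg]; omega
    · rw [if_neg h, eq_comm, ENNReal.tsum_eq_zero]
      intro j; rw [if_neg]; omega
  simp_rw [this]
  rw [ENNReal.tsum_comm, ← ENNReal.tsum_mul_left]
  congr 1; ext j
  rw [tsum_pw_len, pow_add]

theorem tsum_pw {α : Type*} (g : α → ℝ≥0∞) :
    ∑' l : List α, pw g l = (1 - ∑' a, g a)⁻¹ := by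
  have := tsum_pw_len_ge g 0
  simpa [ENNReal.tsum_geometric] using this

/-- lists with a marked element -/
theorem tsum_pw_mark {α : Type*} (f : List α → ℝ≥0∞)
    (h : List α → α → List α → ℝ≥0∞)
    (hf : ∀ l, f l ≠ 0 → ∃ l1 a l2, l = l1 ++ a :: l2 ∧ f l ≤ h l1 a l2) :
    ∑' l, f l ≤ ∑' l1, ∑' a, ∑' l2, h l1 a l2 := by
  classical
  have h1 : ∀ l, f l ≤ ∑' p : List α × α × List α, if l = p.1 ++ p.2.1 :: p.2.2 then
      h p.1 p.2.1 p.2.2 else 0 := by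
    intro l
    by_cases h0 : f l = 0
    · simp [h0]
    · obtain ⟨l1, a, l2, hl, hle⟩ := hf l h0
      refine le_trans ?_ (ENNReal.le_tsum (l1, a, l2))
      simpa [hl] using hl ▸ hle
  calc ∑' l, f l ≤ ∑' l, ∑' p : List α × α × List α, (if l = p.1 ++ p.2.1 :: p.2.2 then
      h p.1 p.2.1 p.2.2 else 0) := ENNReal.tsum_le_tsum h1
    _ = ∑' p : List α × α × List α, h p.1 p.2.1 p.2.2 := by
      rw [ENNReal.tsum_comm]
      congr 1; ext p
      exact tsum_ite_eq (p.1 ++ p.2.1 :: p.2.2) (fun _ => h p.1 p.2.1 p.2.2)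
    _ = _ := by
      rw [ENNReal.tsum_prod']
      congr 1; ext l1
      rw [ENNReal.tsum_prod']

/-- bounding a sum over trees by bounding truncated sums -/
theorem tsum_le_of_trunc {n : ℕ} (f : AT n → ℝ≥0∞) (b : ℝ≥0∞)
    (h : ∀ N, ∑' t, (if size t ≤ N then f t else 0) ≤ b) : ∑' t, f t ≤ b := by
  classical
  rw [ENNReal.tsum_eq_iSup_sum]
  refine iSup_le (fun s => ?_)
  refine le_trans ?_ (h (s.sup size))
  refine le_trans ?_ (ENNReal.sum_le_tsum s)
  refine Finset.sum_le_sum (fun t ht => ?_)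
  rw [if_pos (Finset.le_sup ht)]

end S19

namespace S19
open AT
open scoped ENNReal
open Classical in
/-- number of trees of size `m` satisfying `Q`, as an extended nonnegative real -/
noncomputable def cnt {n : ℕ} (Q : AT n → Prop) (m : ℕ) : ℝ≥0∞ :=
  ∑' t : AT n, if Q t ∧ size t = m then 1 else 0

open Classical in
/-- number of nonempty lists of total size `m` of admissible children of a `c`-node -/
noncomputable def lcnt (n : ℕ) (c : Bool) (m : ℕ) : ℝ≥0∞ :=
  ∑' l : List (AT n), if l ≠ [] ∧ (∀ t ∈ l, Ok c t) ∧ sizeList l = m then 1 else 0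

open Classical in
/-- same, with at least two elements -/
noncomputable def lcnt2 (n : ℕ) (c : Bool) (m : ℕ) : ℝ≥0∞ :=
  ∑' l : List (AT n), if 2 ≤ l.length ∧ (∀ t ∈ l, Ok c t) ∧ sizeList l = m then 1 else 0

theorem sum_antidiag_ite (s k m : ℕ) :
    ∑ p ∈ Finset.HasAntidiagonal.antidiagonal m, ((if s = p.1 then (1 : ℝ≥0∞) else 0) * (if k = p.2 then 1 else 0))
      = if s + k = m then 1 else 0 := by
  by_cases h : s + k = m
  · rw [if_pos h, Finset.sum_eq_single (s, k)]
    · simp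
    · rintro ⟨i, j⟩ _ hne
      by_cases h1 : s = i
      · by_cases h2 : k = j
        · simp [h1, h2] at hne
        · simp [h2]
      · simp [h1]
    · intro hn; exact absurd (Finset.HasAntidiagonal.mem_antidiagonal.2 h) hn
  · rw [if_neg h]
    apply Finset.sum_eq_zero
    rintro ⟨i, j⟩ hij
    rw [Finset.HasAntidiagonal.mem_antidiagonal] at hij
    simp only at hij ⊢
    by_cases h1 : s = i
    · by_cases h2 : k = j
      · omega
      · simp [h2]
    · simp [h1]

theorem conv_aux (n : ℕ) (c : Bool) (m : ℕ) :
    ∑' (a : AT n), ∑' (l : List (AT n)), (open Classical in 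
        if l ≠ [] ∧ (∀ t ∈ a :: l, Ok c t) ∧ sizeList (a :: l) = m then (1 : ℝ≥0∞) else 0) =
      ∑ p ∈ Finset.HasAntidiagonal.antidiagonal m, cnt (n := n) (Ok c) p.1 * lcnt n c p.2 := by
  classical
  have : ∀ (a : AT n) (l : List (AT n)),
        (if l ≠ [] ∧ (∀ t ∈ a :: l, Ok c t) ∧ sizeList (a :: l) = m then (1 : ℝ≥0∞) else 0)
        = ∑ p ∈ Finset.HasAntidiagonal.antidiagonal m, (if Ok c a ∧ size a = p.1 then (1 : ℝ≥0∞) else 0) *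
          (if l ≠ [] ∧ (∀ t ∈ l, Ok c t) ∧ sizeList l = p.2 then 1 else 0) := by
      intro a l
      by_cases h0 : l = []
      · simp [h0]
      by_cases h1 : Ok c a
      · by_cases h2 : ∀ t ∈ l, Ok c t
        · have := sum_antidiag_ite (size a) (sizeList l) m
          simp only [h0, ne_eq, not_false_eq_true, h1, true_and, List.mem_cons, forall_eq_or_imp, sizeList] at this ⊢
          simp only [eq_true h2, true_and]
          rw [this]
        · have h3 : ¬ (∀ t ∈ a :: l, Ok c t) := fun h => h2 (fun t ht => h t (by simp [ht]))
          rw [if_neg (fun h => h3 h.2.1)]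
          simp [h2]
      · simp [h1]
  simp_rw [this]
  simp_rw [Summable.tsum_finsetSum (fun _ _ => ENNReal.summable)]
  refine Finset.sum_congr rfl (fun p _ => ?_)
  simp_rw [ENNReal.tsum_mul_left, ENNReal.tsum_mul_right]
  rfl

theorem lcnt_rec (n : ℕ) (c : Bool) (m : ℕ) :
    lcnt n c m = cnt (n := n) (Ok c) m +
      ∑ p ∈ Finset.HasAntidiagonal.antidiagonal m, cnt (n := n) (Ok c) p.1 * lcnt n c p.2 := by
  classical
  rw [← conv_aux, lcnt, tsum_list, cnt, ← ENNReal.tsum_add]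
  simp only [ne_eq, not_true_eq_false, false_and, if_false, zero_add]
  congr 1; ext a
  rw [tsum_list, tsum_list (f := fun l => if l ≠ [] ∧ _ ∧ _ then (1 : ℝ≥0∞) else 0)]
  simp [sizeList]

theorem lcnt2_rec (n : ℕ) (c : Bool) (m : ℕ) :
    lcnt2 n c m = 
      ∑ p ∈ Finset.HasAntidiagonal.antidiagonal m, cnt (n := n) (Ok c) p.1 * lcnt n c p.2 := by
  classical
  rw [← conv_aux, lcnt2, tsum_list]
  simp only [List.length_nil, nonpos_iff_eq_zero, OfNat.ofNat_ne_zero, false_and, if_false, zero_add]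
  congr 1; ext a; congr 1; ext l
  have : 2 ≤ (a :: l).length ↔ l ≠ [] := by cases l <;> simp
  simp only [this]

theorem cnt_zero (n : ℕ) (Q : AT n → Prop) : cnt Q 0 = 0 := by
  classical
  rw [cnt, ENNReal.tsum_eq_zero]
  intro t
  rw [if_neg]; rintro ⟨_, h⟩; have := size_pos t; omega

theorem cnt_succ (n : ℕ) (c : Bool) (m : ℕ) :
    cnt (n := n) (Ok c) (m + 1) = (if m = 0 then (2 * n : ℝ≥0∞) else 0) + lcnt2 n (!c) m := by
  classical
  rw [cnt, tsum_tree]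
  congr 1
  · by_cases h : m = 0
    · simp [h, ok_leaf, size, mul_comm]
    · simp [h, size, eq_comm]
  · cases c <;> simp [ok_node_iff, size, lcnt2, add_comm, and_assoc] 

theorem cnt_props (n : ℕ) (m : ℕ) :
    (∀ c, cnt (n := n) (Ok c) m ≠ ⊤ ∧ lcnt n c m ≠ ⊤) ∧
     (cnt (n := n) (Ok true) m = cnt (n := n) (Ok false) m ∧ lcnt n true m = lcnt n false m) := by
  induction m using Nat.strong_induction_on with
  | _ m ih =>
    have h1 : (∀ c, cnt (n := n) (Ok c) m ≠ ⊤) ∧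
        cnt (n := n) (Ok true) m = cnt (n := n) (Ok false) m := by
      cases m with
      | zero => simp [cnt_zero]
      | succ m =>
        refine ⟨fun c => ?_, ?_⟩
        · rw [cnt_succ, lcnt2_rec]
          refine ENNReal.add_ne_top.2 ⟨?_, ?_⟩
          · split_ifs <;> simp [ENNReal.mul_eq_top]
          · refine ENNReal.sum_ne_top.2 (fun p hp => ?_)
            rw [Finset.HasAntidiagonal.mem_antidiagonal] at hp
            exact ENNReal.mul_ne_top ((ih p.1 (by omega)).1 _).1 ((ih p.2 (by omega)).1 _).2
        · rw [cnt_succ, cnt_succ, lcnt2_rec, lcnt2_rec]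
          congr 1
          refine Finset.sum_congr rfl (fun p hp => ?_)
          rw [Finset.HasAntidiagonal.mem_antidiagonal] at hp
          simp only [Bool.not_true, Bool.not_false]
          rw [(ih p.1 (by omega)).2.1, (ih p.2 (by omega)).2.2]
    have h3 : ∀ p ∈ Finset.HasAntidiagonal.antidiagonal m, (p.1 = 0 ∨ p.2 < m) := by
      intro p hp
      rw [Finset.HasAntidiagonal.mem_antidiagonal] at hp; omega
    have h4 : ∀ p ∈ Finset.HasAntidiagonal.antidiagonal m, (p.1 = m ∨ p.1 < m) := by
      intro p hp
      rw [Finset.HasAntidiagonal.mem_antidiagonal] at hp; omega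
    have h5 : ∀ p ∈ Finset.HasAntidiagonal.antidiagonal m, (∀ c, cnt (n := n) (Ok c) p.1 ≠ ⊤) ∧
        cnt (n := n) (Ok true) p.1 = cnt (n := n) (Ok false) p.1 := by
      intro p hp
      rcases h4 p hp with h | h
      · rw [h]; exact h1
      · exact ⟨fun c => ((ih _ h).1 c).1, (ih _ h).2.1⟩
    refine ⟨fun c => ⟨h1.1 c, ?_⟩, h1.2, ?_⟩
    · rw [lcnt_rec]
      refine ENNReal.add_ne_top.2 ⟨h1.1 c, ENNReal.sum_ne_top.2 (fun p hp => ?_)⟩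
      rcases h3 p hp with h | h
      · simp [h, cnt_zero]
      · exact ENNReal.mul_ne_top ((h5 p hp).1 c) ((ih _ h).1 c).2
    · rw [lcnt_rec, lcnt_rec, h1.2]
      congr 1
      refine Finset.sum_congr rfl (fun p hp => ?_)
      rcases h3 p hp with h | h
      · simp [h, cnt_zero]
      · rw [(h5 p hp).2, (ih _ h).2.2]

/-- the (real) number of admissible trees of size `m` -/
noncomputable def av (n m : ℕ) : ℝ := (cnt (n := n) (Ok true) m).toReal
/-- the number of nonempty admissible lists -/
noncomputable def lv (n m : ℕ) : ℝ := (lcnt n true m).toReal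

theorem cnt_ok (n : ℕ) (c : Bool) (m : ℕ) : cnt (n := n) (Ok c) m = ENNReal.ofReal (av n m) := by
  rw [av, ENNReal.ofReal_toReal ((cnt_props n m).1 true).1]
  cases c
  · rw [(cnt_props n m).2.1]
  · rfl

theorem lcnt_ok (n : ℕ) (c : Bool) (m : ℕ) : lcnt n c m = ENNReal.ofReal (lv n m) := by
  rw [lv, ENNReal.ofReal_toReal ((cnt_props n m).1 true).2]
  cases c
  · rw [(cnt_props n m).2.2]
  · rfl

theorem av_nonneg (n m : ℕ) : 0 ≤ av n m := ENNReal.toReal_nonneg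
theorem lv_nonneg (n m : ℕ) : 0 ≤ lv n m := ENNReal.toReal_nonneg

theorem av_zero (n : ℕ) : av n 0 = 0 := by simp [av, cnt_zero]

theorem conv_real (n m : ℕ) (c : Bool) : 
    ∑ p ∈ Finset.HasAntidiagonal.antidiagonal m, cnt (n := n) (Ok c) p.1 * lcnt n c p.2 = 
    ENNReal.ofReal (∑ p ∈ Finset.HasAntidiagonal.antidiagonal m, av n p.1 * lv n p.2) := by
  rw [ENNReal.ofReal_sum_of_nonneg (fun p _ => mul_nonneg (av_nonneg _ _) (lv_nonneg _ _))]
  refine Finset.sum_congr rfl (fun p _ => ?_)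
  rw [cnt_ok, lcnt_ok, ENNReal.ofReal_mul (av_nonneg _ _)]

theorem lv_rec (n m : ℕ) : lv n m = av n m +
    ∑ p ∈ Finset.HasAntidiagonal.antidiagonal m, av n p.1 * lv n p.2 := by
  have hs : 0 ≤ ∑ p ∈ Finset.HasAntidiagonal.antidiagonal m, av n p.1 * lv n p.2 :=
    Finset.sum_nonneg (fun p _ => mul_nonneg (av_nonneg _ _) (lv_nonneg _ _))
  rw [lv, lcnt_rec, conv_real, cnt_ok, ← ENNReal.ofReal_add (av_nonneg _ _) hs,
    ENNReal.toReal_ofReal (add_nonneg (av_nonneg _ _) hs)]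

theorem av_succ (n m : ℕ) : av n (m + 1) = (if m = 0 then (2 * n : ℝ) else 0) +
    ∑ p ∈ Finset.HasAntidiagonal.antidiagonal m, av n p.1 * lv n p.2 := by
  have hs : 0 ≤ ∑ p ∈ Finset.HasAntidiagonal.antidiagonal m, av n p.1 * lv n p.2 :=
    Finset.sum_nonneg (fun p _ => mul_nonneg (av_nonneg _ _) (lv_nonneg _ _))
  rw [av, cnt_succ, lcnt2_rec, conv_real]
  rw [ENNReal.toReal_add _ ENNReal.ofReal_ne_top, ENNReal.toReal_ofReal hs]
  · congr 1; split_ifs <;> simp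
  · split_ifs <;> simp [ENNReal.mul_eq_top]

theorem lv_ge (n m : ℕ) : av n m ≤ lv n m := by
  rw [lv_rec]
  have hs : 0 ≤ ∑ p ∈ Finset.HasAntidiagonal.antidiagonal m, av n p.1 * lv n p.2 :=
    Finset.sum_nonneg (fun p _ => mul_nonneg (av_nonneg _ _) (lv_nonneg _ _))
  linarith

theorem av_one (n : ℕ) : av n 1 = 2 * n := by
  have := av_succ n 0
  simpa [av_zero] using this

theorem lv_zero (n : ℕ) : lv n 0 = 0 := by
  have := lv_rec n 0
  simpa [av_zero] using this

theorem lv_eq_av (n m : ℕ) (h : 2 ≤ m) : lv n m = av n m + av n (m+1) := by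
  rw [lv_rec, av_succ, if_neg (by omega), zero_add]

/-- growth -/
theorem av_growth (n m : ℕ) (hm : 2 ≤ m) : 2 * n * av n m ≤ av n (m + 1) := by
  have h1 : av n 1 * lv n (m-1) ≤ av n (m+1) := by
    rw [av_succ n m, if_neg (by omega), zero_add]
    exact Finset.single_le_sum (f := fun p : ℕ × ℕ => av n p.1 * lv n p.2) (fun p _ => mul_nonneg (av_nonneg _ _) (lv_nonneg _ _))
      (Finset.HasAntidiagonal.mem_antidiagonal.2 (show (1, m-1).1 + (1, m-1).2 = m by simp; omega))
  have h2 : av n m ≤ lv n (m-1) := by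
    obtain ⟨k, rfl⟩ : ∃ k, m = k + 1 := ⟨m - 1, by omega⟩
    rw [av_succ, lv_rec, if_neg (by omega)]
    simp [av_nonneg]
  rw [av_one] at h1
  refine le_trans ?_ h1
  gcongr

end S19

namespace S19
open AT Filter
open scoped ENNReal PowerSeries

noncomputable def psA (n : ℕ) : ℝ⟦X⟧ := PowerSeries.mk (av n)
noncomputable def psM (n : ℕ) : ℝ⟦X⟧ := PowerSeries.mk (lv n)

theorem psM_eq (n : ℕ) : psM n = psA n + psA n * psM n := by
  ext m
  simp only [psM, psA, map_add, PowerSeries.coeff_mk, PowerSeries.coeff_mul]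
  exact lv_rec n m

theorem psA_eq (n : ℕ) : psA n = PowerSeries.X * (2 * (n : ℝ⟦X⟧) + psA n * psM n) := by
  ext m
  cases m with
  | zero => simp [psA, av_zero]
  | succ m =>
    have this : (2 * (n:ℝ⟦X⟧)) = PowerSeries.C (2 * (n:ℝ)) := by
      rw [map_mul, map_ofNat, map_natCast]
    rw [this, PowerSeries.coeff_succ_X_mul, map_add, PowerSeries.coeff_mul]
    simp only [psM, psA, PowerSeries.coeff_mk]
    rw [av_succ]
    congr 1
    rw [PowerSeries.coeff_C]

noncomputable def psS (n : ℕ) : ℝ⟦X⟧ :=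
  1 + PowerSeries.C (2 * (n:ℝ)) * PowerSeries.X - 2 * (1 + PowerSeries.X) * psA n

theorem psS_sq (n : ℕ) : psS n * psS n =
    1 - PowerSeries.C (4 * (n:ℝ)) * PowerSeries.X +
      PowerSeries.C (4 * (n:ℝ)^2 - 8 * n) * PowerSeries.X ^ 2 := by
  have h1 := psM_eq n
  have h2 := psA_eq n
  have h3 : (1 + PowerSeries.X) * psA n ^ 2 - (1 + 2 * (n : ℝ⟦X⟧) * PowerSeries.X) * psA n +
      2 * (n : ℝ⟦X⟧) * PowerSeries.X = 0 := by
    linear_combination (PowerSeries.X * psA n) * (-h1) + (-(1 : ℝ⟦X⟧) + psA n) * h2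
  simp only [psS, map_mul, map_sub, map_pow]
  have e1 : (PowerSeries.C (n:ℝ)) = (n : ℝ⟦X⟧) := by simp
  have e2 : (PowerSeries.C (2:ℝ)) = (2 : ℝ⟦X⟧) := map_ofNat _ 2
  have e3 : (PowerSeries.C (4:ℝ)) = (4 : ℝ⟦X⟧) := map_ofNat _ 4
  have e4 : (PowerSeries.C (8:ℝ)) = (8 : ℝ⟦X⟧) := map_ofNat _ 8
  rw [e1, e2, e3, e4]
  linear_combination 4 * (1 + PowerSeries.X) * h3

theorem psS_ode (n : ℕ) : 
    (1 - PowerSeries.C (4 * (n:ℝ)) * PowerSeries.X +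
      PowerSeries.C (4 * (n:ℝ)^2 - 8 * n) * PowerSeries.X ^ 2) * (2 * PowerSeries.derivative ℝ (psS n))
    = (- PowerSeries.C (4 * (n:ℝ)) + 2 * PowerSeries.C (4 * (n:ℝ)^2 - 8 * n) * PowerSeries.X) * psS n := by
  have h := congrArg (PowerSeries.derivative ℝ) (psS_sq n)
  rw [Derivation.leibniz] at h
  have hd : PowerSeries.derivative ℝ (1 - PowerSeries.C (4 * (n:ℝ)) * PowerSeries.X +
      PowerSeries.C (4 * (n:ℝ)^2 - 8 * n) * PowerSeries.X ^ 2) = - PowerSeries.C (4 * (n:ℝ)) + 2 * PowerSeries.C (4 * (n:ℝ)^2 - 8 * n) * PowerSeries.X := by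
    simp only [map_add, map_sub, Derivation.leibniz, PowerSeries.derivative_C, Derivation.leibniz_pow, PowerSeries.derivative_X, Derivation.map_one_eq_zero, smul_eq_mul]
    simp
    ring
  rw [hd] at h
  rw [← h, ← psS_sq]
  simp only [smul_eq_mul]
  ring

noncomputable def sv (n m : ℕ) : ℝ := PowerSeries.coeff m (psS n)

theorem sv_rec (n m : ℕ) : (m + 3 : ℝ) * sv n (m+3) = (4 * n * (m+2) - 2 * n) * sv n (m+2)
    - (4 * (n:ℝ)^2 - 8 * n) * m * sv n (m+1) := by
  have h := congrArg (PowerSeries.coeff (m+2)) (psS_ode n)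
  have l1 : ∀ (a b : ℝ) (F : ℝ⟦X⟧), PowerSeries.coeff (m+2) ((1 - PowerSeries.C a * PowerSeries.X + PowerSeries.C b * PowerSeries.X ^ 2) * (2 * F))
     = 2 * (PowerSeries.coeff (m+2) F - a * PowerSeries.coeff (m+1) F + b * PowerSeries.coeff m F) := by
    intro a b F
    have : (1 - PowerSeries.C a * PowerSeries.X + PowerSeries.C b * PowerSeries.X ^ 2) * (2 * F)
      = PowerSeries.C 2 * (F - PowerSeries.C a * (PowerSeries.X * F) + PowerSeries.C b * (PowerSeries.X ^ 2 * F)) := by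
      have e2 : (PowerSeries.C (2:ℝ)) = (2 : ℝ⟦X⟧) := map_ofNat _ 2
      rw [e2]; ring
    rw [this, PowerSeries.coeff_C_mul, map_add, map_sub, PowerSeries.coeff_C_mul, PowerSeries.coeff_C_mul,
      PowerSeries.coeff_X_pow_mul, show m + 2 = (m+1) + 1 from rfl, PowerSeries.coeff_succ_X_mul]
  have l2 : ∀ (a b : ℝ) (F : ℝ⟦X⟧), PowerSeries.coeff (m+2) ((-PowerSeries.C a + 2 * PowerSeries.C b * PowerSeries.X) * F)
     = -a * PowerSeries.coeff (m+2) F + 2 * b * PowerSeries.coeff (m+1) F := by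
    intro a b F
    have : (-PowerSeries.C a + 2 * PowerSeries.C b * PowerSeries.X) * F = PowerSeries.C (-a) * F + PowerSeries.C (2 * b) * (PowerSeries.X * F) := by
      simp only [map_mul, map_neg]
      have e2 : (PowerSeries.C (2:ℝ)) = (2 : ℝ⟦X⟧) := map_ofNat _ 2
      rw [e2]; ring
    rw [this, map_add, PowerSeries.coeff_C_mul, PowerSeries.coeff_C_mul,
      show m + 2 = (m+1) + 1 from rfl, PowerSeries.coeff_succ_X_mul]
  rw [l1, l2] at h
  simp only [PowerSeries.coeff_derivative] at h
  simp only [sv]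
  push_cast at h
  have : (m + 2 + 1 : ℕ) = m + 3 := rfl
  linarith

theorem sv_eq (n m : ℕ) : sv n (m+2) = -2 * (av n (m+2) + av n (m+1)) := by
  have : psS n = 1 + PowerSeries.C (2 * (n:ℝ)) * (PowerSeries.X ^ 1 * 1) - PowerSeries.C 2 * (psA n + PowerSeries.X * psA n) := by
    have e2 : (PowerSeries.C (2:ℝ)) = (2 : ℝ⟦X⟧) := map_ofNat _ 2
    rw [psS, e2]; ring
  rw [sv, this]
  simp only [map_add, map_sub, PowerSeries.coeff_C_mul, PowerSeries.coeff_one]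
  rw [show m + 2 = (m+1) + 1 from rfl, PowerSeries.coeff_succ_X_mul, PowerSeries.coeff_X_pow_mul, PowerSeries.coeff_one]
  simp [psA]

theorem bv_rec (n m : ℕ) (hm : 1 ≤ m) : (m + 3 : ℝ) * (av n (m+3) + av n (m+2)) =
    (4 * n * (m+2) - 2 * n) * (av n (m+2) + av n (m+1))
    - (4 * (n:ℝ)^2 - 8 * n) * m * (av n (m+1) + av n m) := by
  obtain ⟨k, rfl⟩ : ∃ k, m = k + 1 := ⟨m - 1, by omega⟩
  have h := sv_rec n (k+1)
  have h1 := sv_eq n (k+2)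
  have h2 := sv_eq n (k+1)
  have h3 := sv_eq n (k)
  rw [show k + 1 + 3 = k + 2 + 2 from rfl, show k+1+2 = k+1+2 from rfl, show k+1+1 = k+2 from rfl, h1, h2, h3] at h
  rw [show k + 1 + 3 = k + 2 + 2 from rfl]
  rw [show k + 1 + 2 = k + 2 + 1 from rfl] at *
  rw [show k + 2 = k + 1 + 1 from rfl] at *
  linarith

/-- contraction lemma -/
theorem contract (e δ : ℕ → ℝ) (κ : ℝ) (hk0 : 0 ≤ κ) (hk : κ < 1) (he : ∀ m, 0 ≤ e m)
    (hδ : Tendsto δ atTop (nhds 0)) (h : ∀ᶠ m in atTop, e (m+1) ≤ κ * e m + δ m) :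
    Tendsto e atTop (nhds 0) := by
  rw [Metric.tendsto_atTop]
  intro ε hε
  have h1 : ∀ᶠ m in atTop, δ m < ε / 2 * (1 - κ) := by
    exact hδ.eventually_lt_const (by nlinarith)
  obtain ⟨M, hM⟩ := eventually_atTop.1 (h.and h1)
  have h2 : ∀ k, e (M + k) - ε / 2 ≤ κ ^ k * (e M) := by
    intro k
    induction k with
    | zero => simp; linarith
    | succ k ih =>
      have := hM (M + k) (by omega)
      rw [← add_assoc, pow_succ]
      nlinarith [this.1, this.2]
  have h3 : Tendsto (fun k => κ ^ k * e M) atTop (nhds 0) := by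
    simpa using (tendsto_pow_atTop_nhds_zero_of_lt_one hk0 hk).mul_const (e M)
  obtain ⟨N, hN⟩ := eventually_atTop.1 (h3.eventually_lt_const (show (0:ℝ) < ε / 2 by linarith))
  refine ⟨M + N, fun m hm => ?_⟩
  obtain ⟨k, rfl⟩ := Nat.exists_eq_add_of_le (show M ≤ m by omega)
  have := h2 k
  have := hN k (by omega)
  rw [Real.dist_eq, sub_zero, abs_of_nonneg (he _)]
  linarith

theorem av_pos (n m : ℕ) (hn : 1 ≤ n) (hm : 3 ≤ m) : 0 < av n m := by
  induction m, hm using Nat.le_induction with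
  | base =>
    have h1 : av n 1 * lv n 1 ≤ av n 3 := by
      rw [av_succ n 2, if_neg (by omega), zero_add]
      exact Finset.single_le_sum (f := fun p : ℕ × ℕ => av n p.1 * lv n p.2) (fun p _ => mul_nonneg (av_nonneg _ _) (lv_nonneg _ _))
        (Finset.HasAntidiagonal.mem_antidiagonal.2 (show (1, 1).1 + (1, 1).2 = 2 by simp))
    have h2 := lv_ge n 1
    rw [av_one] at h1 h2
    have : (1:ℝ) ≤ n := by exact_mod_cast hn
    nlinarith
  | succ m hm ih =>
    have := av_growth n m (by omega)
    have h1 : (1:ℝ) ≤ n := by exact_mod_cast hn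
    have : 0 < 2 * n * av n m := by positivity
    linarith

/-- the inverse radius of convergence -/
noncomputable def lam (n : ℕ) : ℝ := 2 * n + 2 * Real.sqrt (2 * n)

theorem av_ratio (n : ℕ) (hn : 1 ≤ n) : Tendsto (fun m => av n (m+1) / av n m) atTop (nhds (lam n)) := by
  have hn1 : (1:ℝ) ≤ n := by exact_mod_cast hn
  set q := Real.sqrt (2 * n) with hq
  have hq2 : q ^ 2 = 2 * n := Real.sq_sqrt (by positivity)
  have hq0 : 0 < q := Real.sqrt_pos.2 (by positivity)
  have hq1 : 1 < q := by nlinarith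
  set B : ℕ → ℝ := fun m => av n (m+1) + av n m with hB
  set r : ℕ → ℝ := fun m => B (m+1) / B m with hr
  have hBpos : ∀ m, 3 ≤ m → 0 < B m := fun m hm => add_pos (av_pos n _ hn (by omega)) (av_pos n _ hn hm)
  have hBg : ∀ m, 3 ≤ m → 2 * n * B m ≤ B (m+1) := by
    intro m hm
    have h1 := av_growth n m (by omega)
    have h2 := av_growth n (m+1) (by omega)
    simp only [hB]; linarith
  have hr2 : ∀ m, 3 ≤ m → 2 * n ≤ r m := by
    intro m hm
    rw [hr, le_div_iff₀ (hBpos m hm)]; exact hBg m hm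
  have hlam : lam n = 2 * n + 2 * q := rfl
  set lm : ℝ := 2 * n - 2 * q with hlm
  -- step for r
  have hrec : ∀ m, 3 ≤ m → r (m+1) - lam n = lm * (r m - lam n) / r m + 
      (-(6 * n) + (4 * (n:ℝ)^2 - 8 * n) * 3 / r m) / (m + 3) := by
    intro m hm
    have h := bv_rec n m (by omega)
    have p1 := hBpos m hm
    have p2 := hBpos (m+1) (by omega)
    have hh : (m + 3 : ℝ) * B (m+2) = (4 * n * (m+2) - 2 * n) * B (m+1) - (4 * (n:ℝ)^2 - 8 * n) * m * B m := h
    have hD : (4 * (n:ℝ)^2 - 8 * n) = lm * lam n := by rw [hlam, hlm]; nlinarith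
    have hsum : lm + lam n = 4 * n := by rw [hlam, hlm]; ring
    have hB2 : B (m+2) = ((4 * n * (m+2) - 2 * n) * B (m+1) - (4 * (n:ℝ)^2 - 8 * n) * m * B m) / (m+3) := by
      rw [eq_div_iff (by positivity)]; linarith
    have : r (m+1) = ((4 * n * (m+2) - 2 * n) * B (m+1) - (4 * (n:ℝ)^2 - 8 * n) * m * B m) / (m+3) / B (m+1) := by
      rw [← hB2]
    rw [this]
    simp only [hr]
    rw [hD]
    have h4 : (n:ℝ) = (lm + lam n) / 4 := by linarith
    rw [h4]
    field_simp
    ring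
  have hκ : |lm| / (2 * n) < 1 := by
    rw [div_lt_one (by positivity), abs_lt]
    constructor <;> rw [hlm] <;> nlinarith
  have hrt : Tendsto (fun m => |r m - lam n|) atTop (nhds 0) := by
    refine contract _ (fun m : ℕ => (6 * n + |4 * (n:ℝ)^2 - 8 * n| * 3 / (2 * n)) / (m + 3)) (|lm| / (2 * n)) (by positivity) hκ (fun _ => abs_nonneg _) ?_ ?_
    · refine Tendsto.div_atTop tendsto_const_nhds ?_
      exact tendsto_atTop_add_const_right _ _ tendsto_natCast_atTop_atTop
    · filter_upwards [eventually_ge_atTop 3] with m hm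
      rw [hrec m hm]
      have hrm := hr2 m hm
      have hrp : 0 < r m := by linarith
      refine (abs_add_le _ _).trans (add_le_add ?_ ?_)
      · rw [abs_div, abs_mul, abs_of_pos hrp, mul_div_right_comm]
        gcongr
      · rw [abs_div, abs_of_pos (show (0:ℝ) < m + 3 by positivity)]
        gcongr
        refine (abs_add_le _ _).trans (add_le_add ?_ ?_)
        · rw [abs_neg, abs_of_nonneg (by positivity)]
        · rw [abs_div, abs_mul, abs_of_pos hrp, abs_of_pos (show (0:ℝ) < 3 by norm_num)]
          gcongr
  -- step for x
  set x : ℕ → ℝ := fun m => av n (m+1) / av n m with hx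
  have hxge : ∀ m, 3 ≤ m → 2 ≤ x m := by
    intro m hm
    have h1 := av_growth n m (by omega)
    have h2 := av_pos n m hn hm
    rw [hx, le_div_iff₀ h2]
    nlinarith
  have hxrec : ∀ m, 3 ≤ m → x (m+1) - lam n = (r m - lam n) * (1 + 1 / x m) + (lam n - x m) / x m := by
    intro m hm
    have p1 := av_pos n m hn hm
    have p2 := av_pos n (m+1) hn (by omega)
    simp only [hx, hr, hB]
    field_simp
    ring
  have hxt : Tendsto (fun m => |x m - lam n|) atTop (nhds 0) := by
    refine contract _ (fun m : ℕ => |r m - lam n| * (3/2)) (1/2) (by norm_num) (by norm_num) (fun _ => abs_nonneg _) ?_ ?_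
    · simpa using hrt.mul_const (3/2)
    · filter_upwards [eventually_ge_atTop 3] with m hm
      rw [hxrec m hm]
      have hxm := hxge m hm
      have hinv : 1 / x m ≤ 1 / 2 := by gcongr
      have hinv0 : 0 ≤ 1 / x m := by positivity
      have e1 : |(r m - lam n) * (1 + 1 / x m)| ≤ |r m - lam n| * (3/2) := by
        rw [abs_mul, abs_of_nonneg (show 0 ≤ 1 + 1 / x m by positivity)]
        gcongr; linarith
      have e2 : |(lam n - x m) / x m| ≤ 1/2 * |x m - lam n| := by
        rw [abs_div, abs_sub_comm, abs_of_pos (show 0 < x m by linarith), div_eq_mul_one_div, mul_comm]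
        gcongr
      have := abs_add_le ((r m - lam n) * (1 + 1 / x m)) ((lam n - x m) / x m)
      linarith
  have := (tendsto_zero_iff_abs_tendsto_zero _).2 hxt
  have h5 := this.add_const (lam n)
  simpa using h5

end S19

namespace S19
open AT Filter
open scoped ENNReal

open Classical in
/-- weight restricted to the trees admissible below a `c`-node -/
noncomputable def okw {n : ℕ} (c : Bool) (w : AT n → ℝ≥0∞) (t : AT n) : ℝ≥0∞ :=
  if Ok c t then w t else 0

open Classical in
theorem pw_okw {n : ℕ} (c : Bool) (w : AT n → ℝ≥0∞) (l : List (AT n)) :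
    pw (okw c w) l = if ∀ t ∈ l, Ok c t then pw w l else 0 := by
  induction l with
  | nil => simp
  | cons a l ih =>
    rw [pw_cons, ih]
    by_cases h1 : Ok c a
    · by_cases h2 : ∀ t ∈ l, Ok c t
      · rw [if_pos h2, if_pos, okw, if_pos h1, pw_cons]
        simpa [h1] using h2
      · rw [if_neg h2, if_neg, mul_zero]
        intro h; exact h2 (fun t ht => h t (by simp [ht]))
    · have h2 : ¬ ∀ t ∈ a :: l, Ok c t := fun h => h1 (h a (by simp))
      rw [okw, if_neg h1, if_neg h2, zero_mul]

theorem okw_mono {n : ℕ} (c : Bool) {v w : AT n → ℝ≥0∞} (h : ∀ t, Ok c t → v t ≤ w t) (t : AT n) :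
    okw c v t ≤ okw c w t := by
  unfold okw; split_ifs with h1
  · exact h t h1
  · exact le_rfl

open Classical in
theorem tsum_okw {n : ℕ} (c : Bool) (w : AT n → ℝ≥0∞) :
    ∑' t, okw c w t = ∑ p : Fin n × Bool, w (.leaf p.1 p.2) +
      ∑' l, if 2 ≤ l.length then (if ∀ t ∈ l, Ok (!c) t then w (.node (!c) l) else 0) else 0 := by
  rw [tsum_tree]
  congr 1
  · simp [okw, ok_leaf]
  · cases c <;> simp [okw, ok_node_iff, ite_and]

theorem pw_mul {α : Type*} (g h : α → ℝ≥0∞) (l : List α) :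
    pw (fun a => g a * h a) l = pw g l * pw h l := by
  induction l with
  | nil => simp
  | cons a l ih => simp only [pw_cons, ih]; ring

theorem pw_mono {α : Type*} {g h : α → ℝ≥0∞} {l : List α} (hh : ∀ a ∈ l, g a ≤ h a) :
    pw g l ≤ pw h l := by
  induction l with
  | nil => simp
  | cons a l ih =>
    simp only [pw_cons]
    exact mul_le_mul' (hh a (by simp)) (ih (fun b hb => hh b (by simp [hb])))

theorem pw_pow_size {n : ℕ} (z : ℝ≥0∞) (l : List (AT n)) :
    pw (fun t => z ^ size t) l = z ^ sizeList l := by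
  induction l with
  | nil => simp [sizeList]
  | cons a l ih => simp [sizeList, ih, pow_add]

/-- general recursive bound -/
theorem tsum_okw_le {n : ℕ} (c : Bool) (w v : AT n → ℝ≥0∞) (α β : ℝ≥0∞)
    (h1 : ∀ i b, w (.leaf i b) ≤ α)
    (h2 : ∀ l, 2 ≤ l.length → (∀ t ∈ l, Ok (!c) t) → w (.node (!c) l) ≤ β * pw v l) :
    ∑' t, okw c w t ≤ 2 * n * α + β * ((∑' t, okw (!c) v t) ^ 2 * (1 - ∑' t, okw (!c) v t)⁻¹) := by
  classical
  rw [tsum_okw]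
  refine add_le_add ?_ ?_
  · calc ∑ p : Fin n × Bool, w (.leaf p.1 p.2) ≤ ∑ p : Fin n × Bool, α :=
        Finset.sum_le_sum (fun p _ => h1 _ _)
      _ = _ := by simp; ring
  · rw [← ENNReal.tsum_geometric, ← tsum_pw_len_ge, ← ENNReal.tsum_mul_left]
    refine ENNReal.tsum_le_tsum (fun l => ?_)
    rw [pw_okw]
    split_ifs with h3 h4
    · exact h2 l h3 h4
    all_goals simp

noncomputable def qq (n : ℕ) : ℝ := Real.sqrt (2 * n)
noncomputable def rho (n : ℕ) : ℝ := 1 / lam n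
noncomputable def uu (n : ℕ) : ℝ := qq n / (1 + qq n)

theorem qq_sq (n : ℕ) : qq n ^ 2 = 2 * n := Real.sq_sqrt (by positivity)
theorem qq_nonneg (n : ℕ) : 0 ≤ qq n := Real.sqrt_nonneg _
theorem qq_gt (n : ℕ) (hn : 1 ≤ n) : 1 < qq n := by
  have := qq_sq n; have := qq_nonneg n
  have : (1:ℝ) ≤ n := by exact_mod_cast hn
  nlinarith
theorem lam_eq (n : ℕ) : lam n = qq n * (qq n + 2) := by
  have := qq_sq n
  have h : lam n = 2 * n + 2 * qq n := rfl
  rw [h]; nlinarith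
theorem lam_pos (n : ℕ) (hn : 1 ≤ n) : 0 < lam n := by
  have := qq_gt n hn; rw [lam_eq]; nlinarith
theorem rho_pos (n : ℕ) (hn : 1 ≤ n) : 0 < rho n := by
  have := lam_pos n hn; unfold rho; positivity
theorem rho_lam (n : ℕ) (hn : 1 ≤ n) : rho n * lam n = 1 := by
  have := lam_pos n hn; unfold rho; field_simp
theorem rho_le (n : ℕ) (hn : 1 ≤ n) : rho n * (2 * n) ≤ 1 := by
  have h1 := rho_lam n hn
  have h2 := rho_pos n hn
  have h : lam n = 2 * n + 2 * qq n := rfl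
  have := qq_nonneg n
  nlinarith
theorem uu_pos (n : ℕ) (hn : 1 ≤ n) : 0 < uu n := by
  have := qq_gt n hn; unfold uu; positivity
theorem uu_lt (n : ℕ) (hn : 1 ≤ n) : uu n < 1 := by
  have := qq_gt n hn; unfold uu; rw [div_lt_one (by linarith)]; linarith
theorem one_sub_uu (n : ℕ) (hn : 1 ≤ n) : 1 - uu n = 1 / (1 + qq n) := by
  have := qq_gt n hn; unfold uu; field_simp; ring
theorem uu_eq (n : ℕ) (hn : 1 ≤ n) : 2 * n * rho n + rho n * (uu n ^ 2 * (1 - uu n)⁻¹) = uu n := by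
  have h1 := qq_gt n hn
  rw [one_sub_uu n hn, rho, lam_eq, uu, ← qq_sq]
  field_simp
  ring

theorem ofReal_one_sub_inv (S : ℝ≥0∞) (u : ℝ) (h0 : 0 ≤ u) (hu : u < 1) (hS : S ≤ ENNReal.ofReal u) :
    (1 - S)⁻¹ ≤ ENNReal.ofReal (1 - u)⁻¹ := by
  rw [ENNReal.ofReal_inv_of_pos (by linarith), ENNReal.inv_le_inv, ENNReal.ofReal_sub _ h0,
    ENNReal.ofReal_one]
  exact tsub_le_tsub_left hS 1

/-- total weight at the critical point -/
noncomputable def UU (n : ℕ) (c : Bool) : ℝ≥0∞ := ∑' t : AT n, okw c (fun t => ENNReal.ofReal (rho n) ^ size t) t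

theorem UU_le (n : ℕ) (hn : 1 ≤ n) (c : Bool) : UU n c ≤ ENNReal.ofReal (uu n) := by
  classical
  set z := ENNReal.ofReal (rho n)
  have key : ∀ N : ℕ, ∀ c, ∑' t : AT n, okw c (fun t => if size t ≤ N then z ^ size t else 0) t ≤ ENNReal.ofReal (uu n) := by
    intro N
    induction N with
    | zero =>
      intro c
      have : ∀ t : AT n, okw c (fun t => if size t ≤ 0 then z ^ size t else 0) t = 0 := by
        intro t
        have := size_pos t
        unfold okw; simp [Nat.pos_iff_ne_zero.1 this]
      simp only [this, tsum_zero, zero_le]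
    | succ N ih =>
      intro c
      refine (tsum_okw_le c _ (fun t => if size t ≤ N then z ^ size t else 0) z z ?_ ?_).trans ?_
      · intro i b; simp [size]
      · intro l _ _
        split_ifs with h
        · have h2 : pw (fun t => if size t ≤ N then z ^ size t else 0) l = pw (fun t => z ^ size t) l := by
            apply le_antisymm <;> refine pw_mono (fun a ha => ?_)
            · split_ifs <;> simp
            · rw [if_pos]
              have := size_le_of_mem ha
              simp [size] at h; omega
          rw [h2, pw_pow_size, size, pow_add, pow_one]
        · simp
      · have h1 := ih (!c)
        calc _ ≤ 2 * n * z + z * (ENNReal.ofReal (uu n) ^ 2 * ENNReal.ofReal (1 - uu n)⁻¹) := by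
              gcongr
              exact ofReal_one_sub_inv _ _ (uu_pos n hn).le (uu_lt n hn) h1
          _ = ENNReal.ofReal (2 * n * rho n + rho n * (uu n ^ 2 * (1 - uu n)⁻¹)) := by
              have h0 := (rho_pos n hn).le
              have h2 := (uu_pos n hn).le
              have h3 := uu_lt n hn
              have h4 : 0 ≤ (1 - uu n)⁻¹ := inv_nonneg.2 (by linarith)
              rw [ENNReal.ofReal_add (by positivity) (by positivity), ENNReal.ofReal_mul (by positivity), ENNReal.ofReal_mul (by positivity), ENNReal.ofReal_mul (by positivity),ENNReal.ofReal_mul (by positivity),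
                ENNReal.ofReal_pow h2]
              simp [z]
          _ = _ := by rw [uu_eq n hn]
  refine tsum_le_of_trunc _ _ (fun N => ?_)
  refine le_trans (ENNReal.tsum_le_tsum (fun t => ?_)) (key N c)
  unfold okw
  split_ifs with h1 h2 <;> simp [h1, z]

theorem tsum_okw_node {n : ℕ} (c : Bool) (z : ℝ≥0∞) (f : List (AT n) → ℝ≥0∞) (w : AT n → ℝ≥0∞)
    (h1 : ∀ i b, w (.leaf i b) = z)
    (h2 : ∀ l, w (.node (!c) l) = f l * z ^ (1 + sizeList l)) :
    ∑' t, okw c w t = 2 * n * z + z * ∑' l, if 2 ≤ l.length then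
      f l * pw (okw (!c) (fun t => z ^ size t)) l else 0 := by
  classical
  rw [tsum_okw, ← ENNReal.tsum_mul_left]
  congr 1
  · simp [h1]; ring
  · congr 1; ext l
    rw [pw_okw, pw_pow_size, h2]
    split_ifs
    · ring
    all_goals simp

theorem UU_rec (n : ℕ) (c : Bool) : UU n c = 2 * n * ENNReal.ofReal (rho n) +
    ENNReal.ofReal (rho n) * (UU n (!c) ^ 2 * (1 - UU n (!c))⁻¹) := by
  rw [UU, tsum_okw_node c (ENNReal.ofReal (rho n)) (fun _ => 1)]
  · simp only [one_mul]
    rw [tsum_pw_len_ge, ENNReal.tsum_geometric, ← UU]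
  · intro i b; simp [size]
  · intro l; simp [size]

theorem UU_cnt (n : ℕ) (c : Bool) (z : ℝ≥0∞) : ∑' t : AT n, okw c (fun t => z ^ size t) t =
    ∑' m, cnt (n := n) (Ok c) m * z ^ m := by
  classical
  have : ∀ t : AT n, okw c (fun t => z ^ size t) t = ∑' m, (if Ok c t ∧ size t = m then 1 else 0) * z ^ m := by
    intro t
    rw [tsum_eq_single (size t)]
    · unfold okw; simp
    · intro m hm; rw [if_neg, zero_mul]; rintro ⟨_, h⟩; exact hm h.symm
  simp_rw [this]
  rw [ENNReal.tsum_comm]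
  congr 1; ext m
  rw [ENNReal.tsum_mul_right, cnt]

theorem UU_eq (n : ℕ) (hn : 1 ≤ n) (c : Bool) : UU n c = ENNReal.ofReal (uu n) := by
  have hsym : UU n (!c) = UU n c := by
    rw [UU, UU, UU_cnt, UU_cnt]
    simp [cnt_ok]
  have hle := UU_le n hn c
  have hrec := UU_rec n c
  rw [hsym] at hrec
  set U := UU n c with hU
  have hfin : U ≠ ⊤ := ne_top_of_le_ne_top ENNReal.ofReal_ne_top hle
  have hv : ∃ v : ℝ, 0 ≤ v ∧ U = ENNReal.ofReal v := ⟨U.toReal, ENNReal.toReal_nonneg, (ENNReal.ofReal_toReal hfin).symm⟩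
  obtain ⟨v, hv0, hv⟩ := hv
  rw [hv] at hle hrec ⊢
  have hvu : v ≤ uu n := (ENNReal.ofReal_le_ofReal_iff (uu_pos n hn).le).1 hle
  have hu1 := uu_lt n hn
  have h0 := (rho_pos n hn).le
  have h4 : 0 < 1 - v := by linarith
  rw [← ENNReal.ofReal_one, ← ENNReal.ofReal_sub _ hv0, ← ENNReal.ofReal_inv_of_pos h4, ← ENNReal.ofReal_pow hv0,
    ← ENNReal.ofReal_mul (by positivity), ← ENNReal.ofReal_mul (by positivity)] at hrec
  have e : (2 * n * ENNReal.ofReal (rho n) : ℝ≥0∞) = ENNReal.ofReal (2 * n * rho n) := by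
    rw [ENNReal.ofReal_mul (by positivity), ENNReal.ofReal_mul (by positivity)]; simp
  rw [e, ← ENNReal.ofReal_add (by positivity) (by positivity), ENNReal.ofReal_eq_ofReal_iff hv0 (by positivity)] at hrec
  congr 1
  have hq := qq_gt n hn
  rw [rho, lam_eq, ← qq_sq] at hrec
  have h5 : (v * (1 + qq n) - qq n) ^ 2 = 0 := by
    field_simp at hrec
    nlinarith
  have h6 := pow_eq_zero_iff (two_ne_zero) |>.1 h5
  rw [uu, eq_div_iff (by positivity)]
  linarith

theorem one_sub_UU (n : ℕ) (hn : 1 ≤ n) (c : Bool) : (1 - UU n c)⁻¹ = ENNReal.ofReal (1 + qq n) := by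
  have h1 := one_sub_uu n hn
  have h2 := qq_gt n hn
  rw [UU_eq n hn, ← ENNReal.ofReal_one, ← ENNReal.ofReal_sub _ (uu_pos n hn).le, h1, ← ENNReal.ofReal_inv_of_pos (by positivity)]
  congr 1; simp

/-- sum over all steps -/
theorem step_sum (n : ℕ) (hn : 1 ≤ n) (c : Bool) :
    ∑' p : List (AT n) × List (AT n), (ENNReal.ofReal (rho n) * 
      (pw (okw c (fun t => ENNReal.ofReal (rho n) ^ size t)) p.1 * pw (okw c (fun t => ENNReal.ofReal (rho n) ^ size t)) p.2))
     = 1 + ENNReal.ofReal (rho n) := by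
  rw [ENNReal.tsum_mul_left, ENNReal.tsum_prod']
  simp_rw [ENNReal.tsum_mul_left, ENNReal.tsum_mul_right, tsum_pw]
  rw [← UU, one_sub_UU n hn, ← ENNReal.ofReal_mul (by linarith [qq_gt n hn]), ← ENNReal.ofReal_mul (rho_pos n hn).le, ← ENNReal.ofReal_one,
   ← ENNReal.ofReal_add (by norm_num) (rho_pos n hn).le]
  congr 1
  have h2 := qq_gt n hn
  rw [rho, lam_eq]
  field_simp
  ring

/-- the mean size is infinite at the critical point -/
theorem mean_top (n : ℕ) (hn : 1 ≤ n) (c : Bool) :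
    ∑' t : AT n, okw c (fun t => size t * ENNReal.ofReal (rho n) ^ size t) t = ⊤ := by
  classical
  set z := ENNReal.ofReal (rho n) with hz
  have hsym : ∀ c : Bool, ∑' t : AT n, okw c (fun t => size t * z ^ size t) t = ∑' m : ℕ, ENNReal.ofReal (av n m) * (m * z ^ m) := by
    intro c
    have : ∀ t : AT n, okw c (fun t => size t * z ^ size t) t = ∑' m : ℕ, (if Ok c t ∧ size t = m then 1 else 0) * (m * z ^ m) := by
      intro t
      rw [tsum_eq_single (size t)]
      · unfold okw; simp
      · intro m hm; rw [if_neg, zero_mul]; rintro ⟨_, h⟩; exact hm h.symm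
    simp_rw [this]
    rw [ENNReal.tsum_comm]
    congr 1; ext m
    rw [ENNReal.tsum_mul_right, ← cnt, cnt_ok]
  set D := ∑' m : ℕ, ENNReal.ofReal (av n m) * (m * z ^ m) with hD
  rw [hsym]
  set g : AT n → ℝ≥0∞ := okw (!c) (fun t => z ^ size t) with hg
  have hgU : ∑' t, g t = UU n (!c) := rfl
  have hgD : ∑' t, (size t : ℝ≥0∞) * g t = D := by
    rw [← hsym (!c)]
    congr 1; ext t; simp only [hg, okw]; split_ifs <;> simp
  set P := ENNReal.ofReal (1 + qq n) with hP
  have hPsum : ∑' l, pw g l = P := by rw [tsum_pw, hgU, one_sub_UU n hn]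
  set T := ∑' l : List (AT n), (sizeList l : ℝ≥0∞) * pw g l with hT
  have hcons : ∀ (h : List (AT n) → ℝ≥0∞), ∑' (a : AT n), ∑' (l : List (AT n)), (sizeList (a :: l) : ℝ≥0∞) * (pw g (a :: l) * h l) 
      = D * ∑' l, pw g l * h l + UU n (!c) * ∑' l : List (AT n), (sizeList l : ℝ≥0∞) * (pw g l * h l) := by
    intro h
    have : ∀ (a : AT n) (l : List (AT n)), (sizeList (a :: l) : ℝ≥0∞) * (pw g (a :: l) * h l) = (size a * g a) * (pw g l * h l) + g a * (sizeList l * (pw g l * h l)) := by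
      intro a l; simp only [sizeList, pw_cons]; push_cast; ring
    simp_rw [this, ENNReal.tsum_add, ENNReal.tsum_mul_left, ENNReal.tsum_mul_right]
    rw [hgD, hgU]
  have hTrec : T = D * P + UU n (!c) * T := by
    conv_lhs => rw [hT, tsum_list]
    have := hcons (fun _ => 1)
    simp only [mul_one] at this
    rw [this, hPsum, ← hT]
    simp [sizeList]
  have hTge : D * P * P ≤ T := by
    have : ∀ N, D * P * ∑ j ∈ Finset.range N, UU n (!c) ^ j ≤ T := by
      intro N
      induction N with
      | zero => simp
      | succ N ih =>
        rw [hTrec, Finset.sum_range_succ', pow_zero, mul_add, mul_one, add_comm]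
        have e : D * P * ∑ j ∈ Finset.range N, UU n (!c) ^ (j + 1) = UU n (!c) * (D * P * ∑ j ∈ Finset.range N, UU n (!c) ^ j) := by
          simp_rw [pow_succ', ← Finset.mul_sum]; ring
        rw [e]
        gcongr
    have h2 : P = ∑' j, UU n (!c) ^ j := by rw [ENNReal.tsum_geometric, one_sub_UU n hn]
    have h3 : D * P * P = D * P * ∑' j, UU n (!c) ^ j := by rw [← h2]
    rw [h3, ENNReal.tsum_eq_iSup_nat, ENNReal.mul_iSup]
    exact iSup_le this
  have hDrec : UU n c + z * (D * (ENNReal.ofReal (qq n)) + UU n (!c) * T) ≤ D := by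
    have e1 : D = ∑' t : AT n, okw c (fun t => size t * z ^ size t) t := (hsym c).symm
    refine le_of_le_of_eq ?_ e1.symm
    rw [tsum_okw_node c z (fun l => (1 + sizeList l : ℝ≥0∞)), UU, tsum_okw_node c z (fun _ => 1)]
    · rw [add_assoc, ← mul_add]
      gcongr
      have hsplit : ∀ l : List (AT n), (if 2 ≤ l.length then (1 + (sizeList l : ℝ≥0∞)) * pw g l else 0) = 
          (if 2 ≤ l.length then 1 * pw g l else 0) + (if 2 ≤ l.length then (sizeList l : ℝ≥0∞) * pw g l else 0) := by
        intro l; split_ifs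
        · ring
        · simp
      rw [← hg]
      simp_rw [hsplit, ENNReal.tsum_add]
      gcongr
      rw [tsum_list]
      have h3 : ∀ (a : AT n) (l : List (AT n)), (if 2 ≤ (a :: l).length then (sizeList (a :: l) : ℝ≥0∞) * pw g (a :: l) else 0) = 
        (sizeList (a :: l) : ℝ≥0∞) * (pw g (a :: l) * (if l = [] then 0 else 1)) := by
        intro a l; cases l <;> simp
      rw [tsum_congr (fun a => tsum_congr (fun l => h3 a l))]
      rw [hcons]
      simp only [sizeList, Nat.cast_zero, zero_mul, ite_self, zero_add]
      refine add_le_add ?_ ?_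
      · gcongr
        have h4 : P = 1 + ∑' l, pw g l * (if l = [] then 0 else 1) := by
          rw [← hPsum, tsum_list, tsum_list (f := fun l => pw g l * _)]; simp
        have h5 : P = 1 + ENNReal.ofReal (qq n) := by
          rw [hP, ENNReal.ofReal_add (by norm_num) (qq_nonneg n), ENNReal.ofReal_one]
        rw [h5] at h4
        exact (ENNReal.add_right_inj ENNReal.one_ne_top).1 h4 |>.le
      · rw [hT]
        refine mul_le_mul_right ?_ _
        refine ENNReal.tsum_le_tsum (fun l => ?_)
        cases l <;> simp [sizeList]
    · intro i b; simp [size, hz]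
    · intro l; simp [size, hz]
    · intro i b; simp [size, hz]
    · intro l; simp [size, hz]
  by_contra hfin
  have h1 : z * (D * (ENNReal.ofReal (qq n)) + UU n (!c) * (D * P * P)) = D := by
    have hq := qq_gt n hn
    have : z * (D * (ENNReal.ofReal (qq n)) + UU n (!c) * (D * P * P)) = D * (z * (ENNReal.ofReal (qq n) + UU n (!c) * (P * P))) := by ring
    rw [this, UU_eq n hn, hz, hP, ← ENNReal.ofReal_mul (by positivity), ← ENNReal.ofReal_mul (uu_pos n hn).le, ← ENNReal.ofReal_add (by positivity) (mul_nonneg (uu_pos n hn).le (by positivity)),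
      ← ENNReal.ofReal_mul (rho_pos n hn).le]
    have : rho n * (qq n + uu n * ((1 + qq n) * (1 + qq n))) = 1 := by
      rw [rho, lam_eq, uu]; field_simp; ring
    rw [this]; simp
  have h2 : UU n c + D ≤ D := by
    calc UU n c + D = UU n c + z * (D * (ENNReal.ofReal (qq n)) + UU n (!c) * (D * P * P)) := by rw [h1]
      _ ≤ UU n c + z * (D * (ENNReal.ofReal (qq n)) + UU n (!c) * T) := by gcongr
      _ ≤ D := hDrec
  have h3 : UU n c = 0 := by
    have : UU n c + D ≤ 0 + D := by simpa using h2
    have := (ENNReal.add_le_add_iff_right hfin).1 this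
    simpa using this
  rw [UU_eq n hn] at h3
  have := uu_pos n hn
  simp at h3; linarith

end S19

namespace S19
open AT Filter
open scoped ENNReal

theorem cnt_mono {n : ℕ} {Q Q' : AT n → Prop} (h : ∀ t, Q t → Q' t) (m : ℕ) : cnt Q m ≤ cnt Q' m := by
  classical
  refine ENNReal.tsum_le_tsum (fun t => ?_)
  split_ifs with h1 h2
  · exact le_rfl
  · exact absurd ⟨h t h1.1, h1.2⟩ h2
  · simp
  · simp

/-- number of trees of size `m` satisfying `Q` admissible below `c` -/
noncomputable def rc {n : ℕ} (c : Bool) (Q : AT n → Prop) (m : ℕ) : ℝ :=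
  (cnt (fun t => Q t ∧ Ok c t) m).toReal

theorem cnt_fin {n : ℕ} (c : Bool) (Q : AT n → Prop) (m : ℕ) :
    cnt (fun t => Q t ∧ Ok c t) m ≠ ⊤ :=
  ne_top_of_le_ne_top ((cnt_props n m).1 c).1 (cnt_mono (fun _ h => h.2) m)

theorem rc_nonneg {n : ℕ} (c : Bool) (Q : AT n → Prop) (m : ℕ) : 0 ≤ rc c Q m := ENNReal.toReal_nonneg

theorem rc_add {n : ℕ} (c : Bool) (Q : AT n → Prop) (m : ℕ) :
    rc c Q m + rc c (fun t => ¬ Q t) m = av n m := by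
  classical
  rw [rc, rc, ← ENNReal.toReal_add (cnt_fin c _ m) (cnt_fin c _ m)]
  have : cnt (fun t : AT n => Q t ∧ Ok c t) m + cnt (fun t => ¬ Q t ∧ Ok c t) m = cnt (n := n) (Ok c) m := by
    rw [cnt, cnt, cnt, ← ENNReal.tsum_add]
    congr 1; ext t
    by_cases h1 : Q t <;> simp [h1]
  rw [this, cnt_ok, ENNReal.toReal_ofReal (av_nonneg n m)]

/-- the weight of a step -/
def stw {n : ℕ} (σ : List (AT n) × List (AT n)) : ℕ := 1 + sizeList σ.1 + sizeList σ.2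

theorem split_unique {n : ℕ} {l r l' r' : List (AT n)} {s s' : AT n}
    (h : l ++ s :: r = l' ++ s' :: r') (hs : sizeList l' + sizeList r' < size s) :
    l = l' ∧ s = s' ∧ r = r' := by
  rcases List.append_eq_append_iff.1 h with ⟨a, h1, h2⟩ | ⟨a, h1, h2⟩
  · cases a with
    | nil => simp at h1 h2; exact ⟨h1.symm, h2.1, h2.2⟩
    | cons b a =>
      exfalso
      simp at h2
      have : s ∈ l' := by rw [h1, h2.1]; simp
      have := size_le_of_mem this
      omega
  · cases a with
    | nil => simp at h1 h2; exact ⟨h1, h2.1.symm, h2.2.symm⟩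
    | cons b a =>
      exfalso
      simp at h2
      have : s ∈ r' := by rw [h2.2]; simp
      have := size_le_of_mem this
      omega

theorem step_count {n : ℕ} (c : Bool) (Q : AT n → Prop) (F : Finset (List (AT n) × List (AT n)))
    (hF : ∀ σ ∈ F, σ ≠ ([], []) ∧ (∀ t ∈ σ.1, Ok c t) ∧ (∀ t ∈ σ.2, Ok c t)) (m : ℕ)
    (hm : ∀ σ ∈ F, ∀ σ' ∈ F, stw σ + stw σ' < m) :
    ∑ σ ∈ F, cnt (fun s => Q (.node c (σ.1 ++ s :: σ.2)) ∧ Ok c s) (m - stw σ)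
      ≤ cnt (fun t => Q t ∧ Ok (!c) t) m := by
  classical
  let X : Set (F × AT n) := {p | (Q (.node c (p.1.1.1 ++ p.2 :: p.1.1.2)) ∧ Ok c p.2) ∧ size p.2 = m - stw p.1.1}
  let i : X → AT n := fun p => .node c (p.1.1.1.1 ++ p.1.2 :: p.1.1.1.2)
  have hi : Function.Injective i := by
    rintro ⟨⟨⟨σ, hσ⟩, s⟩, hp⟩ ⟨⟨⟨σ', hσ'⟩, s'⟩, hp'⟩ h
    simp only [i, AT.node.injEq, true_and] at h
    have hp2 : size s = m - stw σ := hp.2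
    have h3 := hm σ hσ σ' hσ'
    obtain ⟨h1, h2, h3⟩ := split_unique h (by simp only [stw] at h3 hp2; omega)
    have : σ = σ' := Prod.ext h1 h3
    subst this; subst h2; rfl
  have hle := ENNReal.tsum_comp_le_tsum_of_injective hi (fun t => if (Q t ∧ Ok (!c) t) ∧ size t = m then (1:ℝ≥0∞) else 0)
  have hcc : cnt (fun t => Q t ∧ Ok (!c) t) m = ∑' t : AT n, (if (Q t ∧ Ok (!c) t) ∧ size t = m then (1:ℝ≥0∞) else 0) := by
    rw [cnt]; congr 1; ext t; congr
  rw [hcc]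
  refine le_trans (le_of_eq ?_) hle
  have e1 : ∀ x : X, (if (Q (i x) ∧ Ok (!c) (i x)) ∧ size (i x) = m then (1:ℝ≥0∞) else 0) = 1 := by
    rintro ⟨⟨⟨σ, hσ⟩, s⟩, hp⟩
    rw [if_pos]
    have h3 := hm σ hσ σ hσ
    have h4 := hF σ hσ
    have h5 : size s = m - stw σ := hp.2
    refine ⟨⟨hp.1.1, ?_⟩, ?_⟩
    · simp only [i]
      rw [ok_node_iff]
      refine ⟨by simp, ?_, ?_⟩
      · have : σ.1 ≠ [] ∨ σ.2 ≠ [] := by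
          by_contra hh; push Not at hh; exact h4.1 (Prod.ext hh.1 hh.2)
        have := this.imp List.length_pos_iff.2 List.length_pos_iff.2
        simp; omega
      · intro t ht
        rcases List.mem_append.1 ht with h | h
        · exact h4.2.1 t h
        · rcases List.mem_cons.1 h with rfl | h
          · exact hp.1.2
          · exact h4.2.2 t h
    · simp only [i, size, sizeList_append, sizeList]
      simp only [stw] at h3 h5 ⊢; omega
  simp only [e1]
  rw [tsum_subtype X (fun _ => (1:ℝ≥0∞)), ENNReal.tsum_prod', tsum_fintype, ← Finset.sum_coe_sort]
  refine Finset.sum_congr rfl (fun σ _ => ?_)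
  rw [cnt]
  congr 1
  ext b
  rw [Set.indicator_apply]
  congr 1

/-- asymptotic lower bound on density -/
def lb {n : ℕ} (c : Bool) (Q : AT n → Prop) (x : ℝ) : Prop :=
  ∀ x' < x, ∀ᶠ m in atTop, x' * av n m ≤ rc c Q m

theorem lb_zero {n : ℕ} (c : Bool) (Q : AT n → Prop) : lb c Q 0 := by
  intro x' hx'
  refine Eventually.of_forall (fun m => ?_)
  have := av_nonneg n m
  have := rc_nonneg c Q m
  nlinarith

theorem lb_one {n : ℕ} (c : Bool) (Q : AT n → Prop) (h : ∀ t, Ok c t → Q t) : lb c Q 1 := by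
  intro x' hx'
  refine Eventually.of_forall (fun m => ?_)
  have h1 := av_nonneg n m
  have h2 := rc_add c Q m
  have h3 : rc c (fun t => ¬ Q t) m = 0 := by
    have : cnt (fun t : AT n => ¬ Q t ∧ Ok c t) m = 0 := by
      classical
      rw [cnt, ENNReal.tsum_eq_zero]
      intro t; rw [if_neg]; rintro ⟨h3, _⟩; exact h3.1 (h t h3.2)
    rw [rc, this]; rfl
  nlinarith

theorem av_shift (n : ℕ) (hn : 1 ≤ n) (k : ℕ) :
    Tendsto (fun m => av n (m - k) / av n m) atTop (nhds (rho n ^ k)) := by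
  have h1 : Tendsto (fun m => av n m / av n (m + 1)) atTop (nhds (rho n)) := by
    have := (av_ratio n hn).inv₀ (lam_pos n hn).ne'
    simpa [rho] using this
  have h2 : Tendsto (fun m => av n m / av n (m + k)) atTop (nhds (rho n ^ k)) := by
    induction k with
    | zero =>
      simp only [add_zero, pow_zero]
      refine tendsto_const_nhds.congr' ?_
      filter_upwards [eventually_ge_atTop 3] with m hm
      rw [div_self (av_pos n m hn hm).ne']
    | succ k ih =>
      rw [pow_succ]
      refine (ih.mul ((tendsto_add_atTop_iff_nat k).2 h1)).congr' ?_
      filter_upwards [eventually_ge_atTop 3] with m hm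
      have := av_pos n (m+k) hn (by omega)
      have := av_pos n (m+(k+1)) hn (by omega)
      rw [show m + k + 1 = m + (k+1) from rfl]
      field_simp
  rw [← tendsto_add_atTop_iff_nat k]
  simpa using h2

theorem lb_step {n : ℕ} (hn : 1 ≤ n) (c : Bool) (Q : AT n → Prop) (F : Finset (List (AT n) × List (AT n)))
    (hF : ∀ σ ∈ F, σ ≠ ([], []) ∧ (∀ t ∈ σ.1, Ok c t) ∧ (∀ t ∈ σ.2, Ok c t))
    (hF1 : ∑ σ ∈ F, rho n ^ stw σ ≤ 1)
    (x : List (AT n) × List (AT n) → ℝ)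
    (hx : ∀ σ ∈ F, lb c (fun s => Q (.node c (σ.1 ++ s :: σ.2))) (x σ)) :
    lb (!c) Q (∑ σ ∈ F, rho n ^ stw σ * x σ) := by
  intro x' hx'
  set ε := (∑ σ ∈ F, rho n ^ stw σ * x σ - x') / 2 with hε
  have hε0 : 0 < ε := by rw [hε]; linarith
  have hρ := (rho_pos n hn).le
  have h1 : Tendsto (fun m => ∑ σ ∈ F, (av n (m - stw σ) / av n m) * (x σ - ε)) atTop
      (nhds (∑ σ ∈ F, rho n ^ stw σ * (x σ - ε))) :=
    tendsto_finsetSum _ (fun σ _ => (av_shift n hn _).mul_const _)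
  have h2 : x' < ∑ σ ∈ F, rho n ^ stw σ * (x σ - ε) := by
    have : ∑ σ ∈ F, rho n ^ stw σ * (x σ - ε) = ∑ σ ∈ F, rho n ^ stw σ * x σ - (∑ σ ∈ F, rho n ^ stw σ) * ε := by
      rw [Finset.sum_mul, ← Finset.sum_sub_distrib]
      refine Finset.sum_congr rfl (fun σ _ => by ring)
    rw [this]
    nlinarith
  have h3 := h1.eventually_const_lt h2
  have h4 : ∀ᶠ m in atTop, ∀ σ ∈ F, (x σ - ε) * av n (m - stw σ) ≤ rc c (fun s => Q (.node c (σ.1 ++ s :: σ.2))) (m - stw σ) := by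
    rw [eventually_all_finset]
    intro σ hσ
    exact (tendsto_sub_atTop_nat (stw σ)).eventually (hx σ hσ (x σ - ε) (by linarith))
  have h5 : ∀ᶠ m in atTop, ∀ σ ∈ F, ∀ σ' ∈ F, stw σ + stw σ' < m := by
    rw [eventually_all_finset]; intro σ hσ
    rw [eventually_all_finset]; intro σ' hσ'
    exact eventually_gt_atTop _
  filter_upwards [h3, h4, h5, eventually_ge_atTop 3] with m m3 m4 m5 m6
  have hp := av_pos n m hn m6
  have h6 : ∑ σ ∈ F, rc c (fun s => Q (.node c (σ.1 ++ s :: σ.2))) (m - stw σ) ≤ rc (!c) Q m := by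
    have := step_count c Q F hF m m5
    have h7 := ENNReal.toReal_mono (cnt_fin (!c) Q m) this
    rw [ENNReal.toReal_sum (fun σ _ => cnt_fin c _ _)] at h7
    exact h7
  refine le_trans ?_ h6
  calc x' * av n m ≤ (∑ σ ∈ F, (av n (m - stw σ) / av n m) * (x σ - ε)) * av n m := by gcongr
    _ = ∑ σ ∈ F, (x σ - ε) * av n (m - stw σ) := by
        rw [Finset.sum_mul]; refine Finset.sum_congr rfl (fun σ _ => ?_)
        field_simp
    _ ≤ _ := Finset.sum_le_sum m4

/-- similarity of trees -/
inductive Rel {n : ℕ} : AT n → AT n → Prop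
  | base (d : Bool) (l1 l2 : List (AT n)) :
      (∃ t ∈ l1, eval t = fun _ => !d) → (∃ t ∈ l2, eval t = fun _ => !d) → Rel (.node d l1) (.node d l2)
  | ctx (d : Bool) (l r : List (AT n)) (s s' : AT n) : Rel s s' →
      Rel (.node d (l ++ s :: r)) (.node d (l ++ s' :: r))

def Inv {n : ℕ} (Q : AT n → Prop) : Prop := ∀ t t', WF t → WF t' → Rel t t' → (Q t ↔ Q t')

/-- a decisive sibling -/
def dec0 {n : ℕ} (i : Fin n) (c : Bool) : AT n :=
  .node (!c) [.node c [.leaf i true, .leaf i false], .node c [.leaf i true, .leaf i false]]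

theorem dec0_ok {n : ℕ} (i : Fin n) (c : Bool) : Ok c (dec0 i c) := by
  simp [dec0, ok_node_iff, ok_leaf]

theorem dec0_eval {n : ℕ} (i : Fin n) (c : Bool) : eval (dec0 i c) = fun _ => !c := by
  funext x
  cases c <;> simp [dec0, eval, evalList]

theorem dec0_size {n : ℕ} (i : Fin n) (c : Bool) : size (dec0 i c) = 7 := by
  simp [dec0, size, sizeList]

def Gap (n : ℕ) (γ : ℝ) : Prop := ∀ c, ∀ Q : AT n → Prop, Inv Q →
  ∃ x y, lb c Q x ∧ lb c (fun t => ¬ Q t) y ∧ 1 - γ ≤ x + y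

open Classical in
theorem steps_exist (n : ℕ) (hn : 1 ≤ n) (c : Bool) (σ0 : List (AT n) × List (AT n))
    (h0 : σ0 ≠ ([], []) ∧ (∀ t ∈ σ0.1, Ok c t) ∧ (∀ t ∈ σ0.2, Ok c t)) (ε : ℝ) (hε : 0 < ε) :
    ∃ F : Finset (List (AT n) × List (AT n)), σ0 ∈ F ∧
      (∀ σ ∈ F, σ ≠ ([], []) ∧ (∀ t ∈ σ.1, Ok c t) ∧ (∀ t ∈ σ.2, Ok c t)) ∧
      ∑ σ ∈ F, rho n ^ stw σ ≤ 1 ∧ 1 - ε ≤ ∑ σ ∈ F, rho n ^ stw σ := by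
  set z := ENNReal.ofReal (rho n) with hz
  have hzr : z.toReal = rho n := ENNReal.toReal_ofReal (rho_pos n hn).le
  let G : List (AT n) × List (AT n) → Prop := fun σ => σ ≠ ([], []) ∧ (∀ t ∈ σ.1, Ok c t) ∧ (∀ t ∈ σ.2, Ok c t)
  let f : List (AT n) × List (AT n) → ℝ≥0∞ := fun σ => if G σ then z ^ stw σ else 0
  have hsum : ∑' σ, f σ = 1 := by
    have h1 := step_sum n hn c
    have h2 : ∀ p : List (AT n) × List (AT n), (z * (pw (okw c (fun t => z ^ size t)) p.1 * pw (okw c (fun t => z ^ size t)) p.2))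
        = f p + (if p = ([], []) then z else 0) := by
      intro p
      rw [pw_okw, pw_okw, pw_pow_size, pw_pow_size]
      simp only [f, G]
      by_cases h3 : p = ([], [])
      · simp [h3, sizeList]
      · by_cases h4 : ∀ t ∈ p.1, Ok c t
        · by_cases h5 : ∀ t ∈ p.2, Ok c t
          · rw [if_pos h4, if_pos h5, if_pos ⟨h3, h4, h5⟩, if_neg h3, stw, pow_add, pow_add]; ring
          · have g : ¬ (p ≠ ([], []) ∧ (∀ t ∈ p.1, Ok c t) ∧ (∀ t ∈ p.2, Ok c t)) := fun h => h5 h.2.2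
            rw [if_neg h5, if_neg g, if_neg h3]; simp
        · have g : ¬ (p ≠ ([], []) ∧ (∀ t ∈ p.1, Ok c t) ∧ (∀ t ∈ p.2, Ok c t)) := fun h => h4 h.2.1
          rw [if_neg h4, if_neg g, if_neg h3]; simp
    rw [← hz] at h1
    simp_rw [h2] at h1
    rw [ENNReal.tsum_add, tsum_ite_eq] at h1
    exact (ENNReal.add_left_inj ENNReal.ofReal_ne_top).1 h1
  have hlt : ENNReal.ofReal (1 - ε) < ∑' σ, f σ := by
    rw [hsum, ← ENNReal.ofReal_one, ENNReal.ofReal_lt_ofReal_iff one_pos]; linarith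
  rw [ENNReal.tsum_eq_iSup_sum] at hlt
  obtain ⟨s, hs⟩ := lt_iSup_iff.1 hlt
  refine ⟨(insert σ0 s).filter G, ?_, ?_, ?_, ?_⟩
  · simp only [Finset.mem_filter, Finset.mem_insert, true_or, true_and]; exact h0
  · intro σ hσ; exact (Finset.mem_filter.1 hσ).2
  all_goals
    have e : ENNReal.ofReal (∑ σ ∈ (insert σ0 s).filter G, rho n ^ stw σ) = ∑ σ ∈ insert σ0 s, f σ := by
      rw [ENNReal.ofReal_sum_of_nonneg (fun σ _ => pow_nonneg (rho_pos n hn).le _), Finset.sum_filter]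
      refine Finset.sum_congr rfl (fun σ _ => ?_)
      simp only [f, ENNReal.ofReal_pow (rho_pos n hn).le, hz]
      rfl
    have hnn : 0 ≤ ∑ σ ∈ (insert σ0 s).filter G, rho n ^ stw σ := Finset.sum_nonneg (fun σ _ => pow_nonneg (rho_pos n hn).le _)
  · have h5 : ∑ σ ∈ insert σ0 s, f σ ≤ 1 := hsum ▸ ENNReal.sum_le_tsum _
    rw [← e, ← ENNReal.ofReal_one, ENNReal.ofReal_le_ofReal_iff one_pos.le] at h5
    exact h5
  · have h5 : ENNReal.ofReal (1 - ε) ≤ ∑ σ ∈ insert σ0 s, f σ :=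
      hs.le.trans (Finset.sum_le_sum_of_subset (Finset.subset_insert _ _))
    rw [← e, ENNReal.ofReal_le_ofReal_iff hnn] at h5
    exact h5

theorem gap_step (n : ℕ) (hn : 1 ≤ n) (γ : ℝ) (hγ : 0 ≤ γ) (_ : γ ≤ 1) (h : Gap n γ) (ε : ℝ) (hε : 0 < ε) :
    Gap n (γ * (1 - rho n ^ 8) + ε) := by
  classical
  intro c' Q hQ
  obtain ⟨c, rfl⟩ : ∃ c, c' = !c := ⟨!c', by simp⟩
  let i : Fin n := ⟨0, hn⟩
  let σ0 : List (AT n) × List (AT n) := ([dec0 i c], [])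
  have hσ0w : stw σ0 = 8 := by simp [σ0, stw, sizeList, dec0_size]
  have h0 : σ0 ≠ ([], []) ∧ (∀ t ∈ σ0.1, Ok c t) ∧ (∀ t ∈ σ0.2, Ok c t) := by
    simp [σ0, dec0_ok]
  obtain ⟨F, hF0, hF, hF1, hF2⟩ := steps_exist n hn c σ0 h0 ε hε
  have hnode : ∀ σ ∈ F, ∀ s, Ok c s → WF (.node c (σ.1 ++ s :: σ.2)) := by
    intro σ hσ s hs
    obtain ⟨g1, g2, g3⟩ := hF σ hσ
    rw [wf_node_iff']
    refine ⟨?_, ?_⟩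
    · have : σ.1 ≠ [] ∨ σ.2 ≠ [] := by
          by_contra hh; push Not at hh; exact g1 (Prod.ext hh.1 hh.2)
      have := this.imp List.length_pos_iff.2 List.length_pos_iff.2
      simp; omega
    · intro t ht
      rcases List.mem_append.1 ht with h | h
      · exact g2 t h
      · rcases List.mem_cons.1 h with rfl | h
        · exact hs
        · exact g3 t h
  have key : ∀ σ, ∃ x y, σ ∈ F → (lb c (fun s => Q (.node c (σ.1 ++ s :: σ.2))) x ∧ lb c (fun s => ¬ Q (.node c (σ.1 ++ s :: σ.2))) y ∧
      1 - γ ≤ x + y ∧ (σ = σ0 → 1 ≤ x + y)) := by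
    intro σ
    by_cases hσ : σ ∈ F
    swap
    · exact ⟨0, 0, fun h => absurd h hσ⟩
    by_cases he : σ = σ0
    · have hall : ∀ s s', Ok c s → Ok c s' → (Q (.node c (σ.1 ++ s :: σ.2)) ↔ Q (.node c (σ.1 ++ s' :: σ.2))) := by
        intro s s' hs hs'
        refine hQ _ _ (hnode σ hσ s hs) (hnode σ hσ s' hs') (Rel.base _ _ _ ?_ ?_)
        · exact ⟨dec0 i c, by simp [he, σ0], dec0_eval i c⟩
        · exact ⟨dec0 i c, by simp [he, σ0], dec0_eval i c⟩
      by_cases hq : Q (.node c (σ.1 ++ (.leaf i true) :: σ.2))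
      · refine ⟨1, 0, fun _ => ⟨lb_one c _ (fun t ht => (hall _ _ (ok_leaf c i true) ht).1 hq), lb_zero c _, by linarith, by simp⟩⟩
      · refine ⟨0, 1, fun _ => ⟨lb_zero c _, lb_one c _ (fun t ht hh => hq ((hall _ _ (ok_leaf c i true) ht).2 hh)), by linarith, by simp⟩⟩
    · let Q' : AT n → Prop := fun s => Ok c s ∧ Q (.node c (σ.1 ++ s :: σ.2))
      have hrel : ∀ s s' : AT n, Rel s s' → rootConn s = rootConn s' := by
        intro s s' h; cases h <;> rfl
      have hQ' : Inv Q' := by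
        intro t t' ht ht' hr
        have hiff : Ok c t ↔ Ok c t' := by simp [Ok, ht, ht', hrel _ _ hr]
        by_cases hok : Ok c t
        · have := hQ _ _ (hnode σ hσ t hok) (hnode σ hσ t' (hiff.1 hok)) (Rel.ctx c σ.1 σ.2 t t' hr)
          simp only [Q']; rw [hiff, this]
        · simp only [Q']; rw [← hiff]; simp [hok]
      obtain ⟨x, y, hx, hy, hxy⟩ := h c Q' hQ'
      refine ⟨x, y, fun _ => ⟨?_, ?_, hxy, fun h => absurd h he⟩⟩
      · intro x' hx'
        filter_upwards [hx x' hx'] with m hm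
        have : rc c Q' m = rc c (fun s => Q (.node c (σ.1 ++ s :: σ.2))) m := by
          rw [rc, rc]; congr 2; ext t; simp only [Q']; tauto
        rw [← this]; exact hm
      · intro x' hx'
        filter_upwards [hy x' hx'] with m hm
        have : rc c (fun t => ¬ Q' t) m = rc c (fun s => ¬ Q (.node c (σ.1 ++ s :: σ.2))) m := by
          rw [rc, rc]; congr 2; ext t; simp only [Q']; tauto
        rw [← this]; exact hm
  choose x y hxy using key
  refine ⟨_, _, lb_step hn c Q F hF hF1 x (fun σ hσ => (hxy σ hσ).1), lb_step hn c (fun t => ¬ Q t) F hF hF1 y (fun σ hσ => (hxy σ hσ).2.1), ?_⟩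
  rw [← Finset.sum_add_distrib]
  have hlow : ∑ σ ∈ F, (rho n ^ stw σ * (1 - γ) + if σ = σ0 then rho n ^ 8 * γ else 0) ≤ ∑ σ ∈ F, (rho n ^ stw σ * x σ + rho n ^ stw σ * y σ) := by
    refine Finset.sum_le_sum (fun σ hσ => ?_)
    have hp : 0 ≤ rho n ^ stw σ := pow_nonneg (rho_pos n hn).le _
    obtain ⟨_, _, g3, g4⟩ := hxy σ hσ
    split_ifs with he
    · have := g4 he
      rw [← hσ0w, ← he]
      nlinarith
    · nlinarith
  refine le_trans ?_ hlow
  rw [Finset.sum_add_distrib, ← Finset.sum_mul, Finset.sum_ite_eq' F σ0, if_pos hF0]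
  nlinarith

theorem gap_all (n : ℕ) (hn : 1 ≤ n) (γ : ℝ) (hγ : 0 < γ) : Gap n γ := by
  have hp : 0 < rho n ^ 8 := pow_pos (rho_pos n hn) 8
  have hp1 : rho n ^ 8 ≤ 1 := by
    refine pow_le_one₀ (rho_pos n hn).le ?_
    have := rho_le n hn; have : (1:ℝ) ≤ n := by exact_mod_cast hn
    have := rho_pos n hn
    nlinarith
  have h : ∀ k : ℕ, Gap n ((1 - rho n ^ 8 / 2) ^ k) := by
    intro k
    induction k with
    | zero =>
      intro c Q _
      exact ⟨0, 0, lb_zero _ _, lb_zero _ _, by simp⟩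
    | succ k ih =>
      have := gap_step n hn _ (pow_nonneg (by linarith) _) (pow_le_one₀ (by linarith) (by linarith)) ih ((1 - rho n ^ 8 / 2) ^ k * (rho n ^ 8 / 2))
        (mul_pos (pow_pos (by linarith) _) (by linarith))
      rw [pow_succ]
      convert this using 1
      ring
  obtain ⟨k, hk⟩ := exists_pow_lt_of_lt_one hγ (show 1 - rho n ^ 8 / 2 < 1 by linarith)
  intro c Q hQ
  obtain ⟨x, y, h1, h2, h3⟩ := h k c Q hQ
  exact ⟨x, y, h1, h2, by linarith⟩

theorem rc_conv (n : ℕ) (hn : 1 ≤ n) (c : Bool) (Q : AT n → Prop) (hQ : Inv Q) :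
    ∃ μ, Tendsto (fun m => rc c Q m / av n m) atTop (nhds μ) := by
  refine cauchySeq_tendsto_of_complete ?_
  rw [Metric.cauchySeq_iff']
  intro ε hε
  obtain ⟨x, y, hx, hy, hxy⟩ := gap_all n hn (ε/4) (by linarith) c Q hQ
  obtain ⟨N, hN⟩ := eventually_atTop.1 ((hx (x - ε/4) (by linarith)).and ((hy (y - ε/4) (by linarith)).and (eventually_ge_atTop 3)))
  have key : ∀ m ≥ N, x - ε/4 ≤ rc c Q m / av n m ∧ rc c Q m / av n m ≤ 1 - y + ε/4 := by
    intro m hm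
    obtain ⟨h1, h2, h3⟩ := hN m hm
    have hp := av_pos n m hn h3
    have := rc_add c Q m
    rw [le_div_iff₀ hp, div_le_iff₀ hp]
    constructor
    · exact h1
    · linarith
  refine ⟨N, fun m hm => ?_⟩
  have h1 := key m hm
  have h2 := key N le_rfl
  rw [Real.dist_eq, abs_lt]
  constructor <;> linarith

end S19

namespace S19
open AT Filter
open scoped ENNReal

theorem cnt_card {n : ℕ} (Q : AT n → Prop) (m : ℕ) (h : cnt Q m ≠ ⊤) :
    (Nat.card {t : AT n // Q t ∧ size t = m} : ℝ) = (cnt Q m).toReal := by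
  classical
  have e : cnt Q m = ({t : AT n | Q t ∧ size t = m}.encard : ℝ≥0∞) := by
    rw [← ENNReal.tsum_set_one, tsum_subtype {t : AT n | Q t ∧ size t = m} (fun _ => (1:ℝ≥0∞)), cnt]
    congr 1; ext t; rw [Set.indicator_apply]; congr 1
  rw [e] at h ⊢
  have hf : {t : AT n | Q t ∧ size t = m}.encard ≠ ⊤ := by
    intro h'; rw [h'] at h; simp at h
  have := (Set.encard_ne_top_iff.1 hf).cast_ncard_eq
  rw [← this, show Nat.card {t : AT n // Q t ∧ size t = m} = Set.ncard {t : AT n | Q t ∧ size t = m} from rfl]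
  simp

theorem ok_or {n : ℕ} (t : AT n) (m : ℕ) (hm : 2 ≤ m) (hs : size t = m) :
    (WF t ↔ (Ok true t ∨ Ok false t)) ∧ ¬ (Ok true t ∧ Ok false t) := by
  cases t with
  | leaf i b => simp [size] at hs; omega
  | node c l =>
    simp only [Ok, rootConn]
    cases c <;> simp

theorem countIn_eq {n : ℕ} (𝒯 : Set (AT n)) (m : ℕ) (hm : 2 ≤ m) :
    (countIn n 𝒯 m : ℝ) = rc true (fun t => t ∈ 𝒯) m + rc false (fun t => t ∈ 𝒯) m := by
  classical
  have e : cnt (fun t => t ∈ 𝒯 ∧ WF t) m = cnt (fun t => t ∈ 𝒯 ∧ Ok true t) m + cnt (fun t => t ∈ 𝒯 ∧ Ok false t) m := by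
    rw [cnt, cnt, cnt, ← ENNReal.tsum_add]
    congr 1; ext t
    by_cases hs : size t = m
    · obtain ⟨h1, h2⟩ := ok_or t m hm hs
      by_cases h3 : t ∈ 𝒯 <;> by_cases h4 : Ok true t <;> by_cases h5 : Ok false t <;> simp_all
    · simp [hs]
  have hfin : cnt (fun t => t ∈ 𝒯 ∧ WF t) m ≠ ⊤ := by
    rw [e]; exact ENNReal.add_ne_top.2 ⟨cnt_fin _ _ _, cnt_fin _ _ _⟩
  rw [rc, rc, ← ENNReal.toReal_add (cnt_fin _ _ _) (cnt_fin _ _ _), ← e, ← cnt_card _ _ hfin, countIn]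
  simp only [and_assoc]

theorem A_eq (n m : ℕ) (hm : 2 ≤ m) : (A n m : ℝ) = 2 * av n m := by
  have h : ∀ c, rc c (fun t : AT n => t ∈ (Set.univ : Set (AT n))) m = av n m := by
    intro c
    rw [rc]
    simp only [Set.mem_univ, true_and]
    rw [show (fun t : AT n => Ok c t) = Ok c from rfl, cnt_ok, ENNReal.toReal_ofReal (av_nonneg n m)]
  rw [A, countIn_eq _ _ hm, h, h]; ring

theorem lim_exists (n : ℕ) (hn : 1 ≤ n) (𝒯 : Set (AT n)) (h : Inv (fun t => t ∈ 𝒯)) : ∃ μ, HasLimRatio n 𝒯 μ := by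
  obtain ⟨a, ha⟩ := rc_conv n hn true _ h
  obtain ⟨b, hb⟩ := rc_conv n hn false _ h
  refine ⟨(a + b) / 2, ((ha.add hb).div_const 2).congr' ?_⟩
  filter_upwards [eventually_ge_atTop 2] with m hm
  rw [ratio, countIn_eq _ _ hm, A_eq _ _ hm]
  rw [← add_div, div_div, mul_comm]

end S19

namespace S19
open AT Filter
open scoped ENNReal

open Classical in
theorem sum_by_size {n : ℕ} (c : Bool) (Q : AT n → Prop) (F : ℕ → ℝ≥0∞) :
    ∑' t : AT n, okw c (fun t => if Q t then F (size t) else 0) t = ∑' m, ENNReal.ofReal (rc c Q m) * F m := by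
  have : ∀ t : AT n, okw c (fun t => if Q t then F (size t) else 0) t =
      ∑' m, (if (Q t ∧ Ok c t) ∧ size t = m then 1 else 0) * F m := by
    intro t
    rw [tsum_eq_single (size t)]
    · unfold okw
      by_cases h1 : Ok c t <;> by_cases h2 : Q t <;> simp [h1, h2]
    · intro m hm
      rw [if_neg (fun h => hm h.2.symm), zero_mul]
  simp_rw [this]
  rw [ENNReal.tsum_comm]
  refine tsum_congr (fun m => ?_)
  rw [ENNReal.tsum_mul_right, rc, ENNReal.ofReal_toReal (cnt_fin _ _ _)]
  congr 1
  rw [cnt]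
  congr 1; ext t; congr 1

structure Wt (n : ℕ) (ω : AT n → ℝ≥0∞) : Prop where
  leaf : ∀ i b, ω (.leaf i b) ≤ ENNReal.ofReal (1 / (2 * n))
  node : ∀ c l, ω (.node c l) ≤ ENNReal.ofReal (1 / (2 * n)) * pw ω l
  tot : ∀ c, ∑' t, okw c ω t ≤ ENNReal.ofReal (1 - 1 / (2 * (1 + qq n)))
  int : ∀ c, ∑' t, okw c (fun t => if isLeafB t then 0 else ω t) t ≤ ENNReal.ofReal (2 / qq n)

/-- truncated size-biased total -/
noncomputable def DD (n K : ℕ) : ℝ := ∑' m, av n m * rho n ^ m * (min m K : ℕ)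
noncomputable def PP (n N : ℕ) : ℝ := ∑ m ∈ Finset.range N, av n m * rho n ^ m * m

theorem rc_true {n : ℕ} (c : Bool) (m : ℕ) : rc c (fun _ : AT n => True) m = av n m := by
  have := rc_add c (fun _ : AT n => True) m
  have h : rc c (fun _ : AT n => ¬ True) m = 0 := by
    rw [rc]; simp [cnt]
  linarith

theorem av_sum (n : ℕ) (hn : 1 ≤ n) : HasSum (fun m => av n m * rho n ^ m) (uu n) := by
  have h1 := sum_by_size true (fun _ : AT n => True) (fun m => ENNReal.ofReal (rho n) ^ m)
  simp only [if_true] at h1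
  rw [← UU, UU_eq n hn] at h1
  simp only [rc_true] at h1
  have hρ := (rho_pos n hn).le
  have h2 : ∀ m, ENNReal.ofReal (av n m) * ENNReal.ofReal (rho n) ^ m = ENNReal.ofReal (av n m * rho n ^ m) := by
    intro m; rw [ENNReal.ofReal_mul (av_nonneg n m), ENNReal.ofReal_pow hρ]
  simp_rw [h2] at h1
  have hnn : ∀ m, 0 ≤ av n m * rho n ^ m := fun m => mul_nonneg (av_nonneg n m) (pow_nonneg hρ m)
  have hs : Summable (fun m => av n m * rho n ^ m) := by
    have := ENNReal.summable_toReal (f := fun m => ENNReal.ofReal (av n m * rho n ^ m)) (by rw [← h1]; exact ENNReal.ofReal_ne_top)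
    simpa [ENNReal.toReal_ofReal (hnn _)] using this
  have h3 := ENNReal.ofReal_tsum_of_nonneg hnn hs
  rw [← h1, ENNReal.ofReal_eq_ofReal_iff (tsum_nonneg hnn) (uu_pos n hn).le] at h3
  exact h3 ▸ hs.hasSum

theorem DD_summable (n : ℕ) (hn : 1 ≤ n) (K : ℕ) : Summable (fun m => av n m * rho n ^ m * (min m K : ℕ)) := by
  refine Summable.of_nonneg_of_le (fun m => ?_) (fun m => ?_) ((av_sum n hn).summable.mul_right (K:ℝ))
  · exact mul_nonneg (mul_nonneg (av_nonneg n m) (pow_nonneg (rho_pos n hn).le m)) (by positivity)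
  · refine mul_le_mul_of_nonneg_left ?_ (mul_nonneg (av_nonneg n m) (pow_nonneg (rho_pos n hn).le m))
    exact_mod_cast min_le_right _ _

theorem PP_le_DD (n : ℕ) (hn : 1 ≤ n) (K : ℕ) : PP n K ≤ DD n K := by
  have h := (DD_summable n hn K).sum_le_tsum (Finset.range K) (fun m _ => mul_nonneg (mul_nonneg (av_nonneg n m) (pow_nonneg (rho_pos n hn).le m)) (by positivity))
  refine le_trans (le_of_eq ?_) h
  refine Finset.sum_congr rfl (fun m hm => ?_)
  rw [min_eq_left (Finset.mem_range.1 hm).le]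

theorem PP_tendsto (n : ℕ) (hn : 1 ≤ n) : Tendsto (PP n) atTop atTop := by
  have hρ := (rho_pos n hn).le
  have hnn : ∀ m : ℕ, 0 ≤ av n m * rho n ^ m * m := fun m => mul_nonneg (mul_nonneg (av_nonneg n m) (pow_nonneg hρ m)) (by positivity)
  refine (not_summable_iff_tendsto_nat_atTop_of_nonneg hnn).1 ?_
  intro hs
  have h1 := sum_by_size true (fun _ : AT n => True) (fun m => m * ENNReal.ofReal (rho n) ^ m)
  simp only [if_true] at h1
  rw [mean_top n hn] at h1
  simp only [rc_true] at h1
  have h2 : ∀ m : ℕ, ENNReal.ofReal (av n m) * (m * ENNReal.ofReal (rho n) ^ m) = ENNReal.ofReal (av n m * rho n ^ m * m) := by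
    intro m; rw [ENNReal.ofReal_mul (mul_nonneg (av_nonneg n m) (pow_nonneg hρ m)), ENNReal.ofReal_mul (av_nonneg n m), ENNReal.ofReal_pow hρ]
    simp; ring
  simp_rw [h2] at h1
  rw [← ENNReal.ofReal_tsum_of_nonneg hnn hs] at h1
  exact ENNReal.ofReal_ne_top h1.symm

theorem DD_tendsto (n : ℕ) (hn : 1 ≤ n) : Tendsto (DD n) atTop atTop :=
  tendsto_atTop_mono (PP_le_DD n hn) (PP_tendsto n hn)

noncomputable def eta (n K : ℕ) : ℝ := (1 - uu n) / (2 * DD n K)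
noncomputable def gK (n K m : ℕ) : ℝ := 1 + eta n K * (min m K : ℕ)
noncomputable def om (n K : ℕ) (t : AT n) : ℝ≥0∞ := ENNReal.ofReal (rho n ^ size t * gK n K (size t))

theorem eta_tendsto (n : ℕ) (hn : 1 ≤ n) : Tendsto (eta n) atTop (nhds 0) :=
  tendsto_const_nhds.div_atTop ((DD_tendsto n hn).const_mul_atTop two_pos)

theorem rho_qq (n : ℕ) (hn : 1 ≤ n) : rho n * (2 * n) = qq n / (qq n + 2) := by
  have := qq_gt n hn
  rw [rho, lam_eq, ← qq_sq]; field_simp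

theorem om_wt (n : ℕ) (hn : 1 ≤ n) : ∀ᶠ K in atTop, Wt n (om n K) := by
  have hq := qq_gt n hn
  have hρ := rho_pos n hn
  have hn' : (1:ℝ) ≤ n := by exact_mod_cast hn
  filter_upwards [(eta_tendsto n hn).eventually_lt_const (show (0:ℝ) < 2 / qq n by positivity), (DD_tendsto n hn).eventually_gt_atTop 0, eventually_ge_atTop 1] with K hK hD hK1
  have hη : 0 ≤ eta n K := by
    have := uu_lt n hn
    unfold eta; exact div_nonneg (by linarith) (by linarith)
  have hg : ∀ m, 0 ≤ gK n K m := fun m => by unfold gK; positivity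
  have hsub : ∀ a b, gK n K (a + b) ≤ gK n K a * gK n K b := by
    intro a b
    unfold gK
    have h1 : ((min (a+b) K : ℕ) : ℝ) ≤ (min a K : ℕ) + (min b K : ℕ) := by exact_mod_cast (by omega)
    have h2 : (0:ℝ) ≤ (min a K : ℕ) := by positivity
    have h3 : (0:ℝ) ≤ (min b K : ℕ) := by positivity
    have h4 := mul_le_mul_of_nonneg_left h1 hη
    have h5 : 0 ≤ (eta n K * (min a K : ℕ)) * (eta n K * (min b K : ℕ)) := by positivity
    nlinarith
  have h1 : rho n * gK n K 1 ≤ 1 / (2 * n) := by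
    rw [le_div_iff₀ (by positivity)]
    have : gK n K 1 = 1 + eta n K := by unfold gK; simp [min_eq_left hK1]
    rw [this, mul_assoc, mul_comm (1 + eta n K), ← mul_assoc, rho_qq n hn, div_mul_eq_mul_div, div_le_one (by linarith)]
    rw [lt_div_iff₀ (by linarith)] at hK
    nlinarith
  have hleaf : ∀ i b, om n K (.leaf i b) = ENNReal.ofReal (rho n * gK n K 1) := by
    intro i b; simp [om, size]
  have htot : ∀ c, ∑' t, okw c (om n K) t = ENNReal.ofReal (1 - 1 / (2 * (1 + qq n))) := by
    intro c
    have h := sum_by_size c (fun _ : AT n => True) (fun m => ENNReal.ofReal (rho n ^ m * gK n K m))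
    simp only [if_true] at h
    have e : (okw c (om n K)) = okw c (fun t => ENNReal.ofReal (rho n ^ size t * gK n K (size t))) := rfl
    rw [e, h]
    simp only [rc_true]
    have h2 : ∀ m, ENNReal.ofReal (av n m) * ENNReal.ofReal (rho n ^ m * gK n K m) = ENNReal.ofReal (av n m * rho n ^ m + eta n K * (av n m * rho n ^ m * (min m K : ℕ))) := by
      intro m
      rw [← ENNReal.ofReal_mul (av_nonneg n m)]; congr 1; unfold gK; ring
    simp_rw [h2]
    have hs := (av_sum n hn).add ((DD_summable n hn K).hasSum.mul_left (eta n K))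
    rw [← ENNReal.ofReal_tsum_of_nonneg _ hs.summable, hs.tsum_eq]
    · congr 1
      rw [show (∑' m, av n m * rho n ^ m * (min m K : ℕ)) = DD n K from rfl, eta]
      have := one_sub_uu n hn
      field_simp
      field_simp at this
      linarith
    · intro m
      have := av_nonneg n m
      positivity
  refine ⟨?_, ?_, ?_, ?_⟩
  · intro i b
    rw [hleaf]; exact ENNReal.ofReal_le_ofReal h1
  · intro c l
    have hl : ∀ l : List (AT n), ENNReal.ofReal (rho n ^ (sizeList l + 1) * gK n K (sizeList l + 1)) ≤ ENNReal.ofReal (1 / (2 * n)) * pw (om n K) l := by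
      intro l
      induction l with
      | nil => simp only [sizeList, zero_add, pow_one, pw_nil, mul_one]; exact ENNReal.ofReal_le_ofReal h1
      | cons a l ih =>
        rw [pw_cons, mul_left_comm]
        refine le_trans ?_ (mul_le_mul_right ih _)
        rw [om, ← ENNReal.ofReal_mul (mul_nonneg (pow_nonneg hρ.le _) (hg _))]
        refine ENNReal.ofReal_le_ofReal ?_
        rw [sizeList, add_assoc, pow_add]
        have := mul_le_mul_of_nonneg_left (hsub (size a) (sizeList l + 1)) (show 0 ≤ rho n ^ size a * rho n ^ (sizeList l + 1) by positivity)
        linarith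
    have := hl l
    rw [om, size, add_comm 1]; exact this
  · intro c; exact (htot c).le
  · intro c
    have h := htot c
    rw [tsum_okw] at h
    rw [tsum_okw]
    simp only [isLeafB, hleaf, if_true, Finset.sum_const] at h ⊢
    simp only [Finset.card_univ, Fintype.card_prod, Fintype.card_fin, Fintype.card_bool] at h ⊢
    simp only [nsmul_eq_mul, mul_zero, zero_add, Bool.false_eq_true, if_false] at h ⊢
    have h3 : ENNReal.ofReal (qq n / (qq n + 2)) ≤ ((n * 2 : ℕ) : ℝ≥0∞) * ENNReal.ofReal (rho n * gK n K 1) := by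
      rw [← ENNReal.ofReal_natCast, ← ENNReal.ofReal_mul (by positivity)]
      refine ENNReal.ofReal_le_ofReal ?_
      rw [← rho_qq n hn]
      have : 1 ≤ gK n K 1 := by unfold gK; nlinarith [show (0:ℝ) ≤ (min 1 K : ℕ) by positivity]
      push_cast
      nlinarith [mul_pos hρ (show (0:ℝ) < n by linarith)]
    have h4 := add_le_add_left h3 (∑' (l : List (AT n)), if 2 ≤ l.length then (open Classical in if ∀ t ∈ l, Ok (!c) t then om n K (.node (!c) l) else 0) else 0)
    rw [h] at h4
    have h5 := ENNReal.le_sub_of_add_le_left ENNReal.ofReal_ne_top h4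
    refine h5.trans ?_
    rw [← ENNReal.ofReal_sub _ (by positivity)]
    refine ENNReal.ofReal_le_ofReal ?_
    have : 1 - qq n / (qq n + 2) = 2 / (qq n + 2) := by field_simp; ring
    have h6 : 0 ≤ 1 / (2 * (1 + qq n)) := by positivity
    have h7 : 2 / (qq n + 2) ≤ 2 / qq n := by gcongr; linarith
    linarith

open Classical in
theorem transfer (n : ℕ) (hn : 1 ≤ n) (c : Bool) (Q : AT n → Prop) (μ : ℝ)
    (hμ : Tendsto (fun m => rc c Q m / av n m) atTop (nhds μ)) (m0 : ℕ) (B : ℝ) (hB0 : 0 ≤ B)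
    (hB : ∀ ω, Wt n ω → ∑' t, okw c (fun t => if Q t ∧ m0 ≤ size t then ω t else 0) t ≤ ENNReal.ofReal B) :
    μ ≤ 2 * B * (1 + qq n) := by
  have hρ := (rho_pos n hn).le
  have hq := qq_gt n hn
  have hu := uu_lt n hn
  have hμ0 : 0 ≤ μ := ge_of_tendsto' hμ (fun m => div_nonneg (rc_nonneg _ _ _) (av_nonneg _ _))
  refine le_of_forall_lt_imp_le_of_dense (fun μ' hμ' => ?_)
  by_cases hneg : μ' < 0
  · nlinarith
  push Not at hneg
  obtain ⟨M, hM⟩ := eventually_atTop.1 ((hμ.eventually_const_lt hμ').and ((eventually_ge_atTop 3).and (eventually_ge_atTop m0)))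
  have key : ∀ᶠ K in atTop, μ' * ((1 - uu n) / 2) - μ' * PP n M * eta n K ≤ B := by
    filter_upwards [om_wt n hn, (DD_tendsto n hn).eventually_gt_atTop 0] with K hK hD
    have h1 := hB _ hK
    have hη : 0 ≤ eta n K := by unfold eta; exact div_nonneg (by linarith) (by linarith)
    have e : (fun t : AT n => if Q t ∧ m0 ≤ size t then om n K t else 0) = fun t => if Q t then (if m0 ≤ size t then ENNReal.ofReal (rho n ^ size t * gK n K (size t)) else 0) else 0 := by
      ext t; rw [om]; split_ifs <;> simp_all
    rw [e, sum_by_size c Q (fun m => if m0 ≤ m then ENNReal.ofReal (rho n ^ m * gK n K m) else 0)] at h1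
    have hterm : ∀ m, ENNReal.ofReal (μ' * eta n K * (av n m * rho n ^ m * (min m K : ℕ)))  ≤
       ENNReal.ofReal (rc c Q m) * (if m0 ≤ m then ENNReal.ofReal (rho n ^ m * gK n K m) else 0) +
        (if m ∈ Finset.range M then ENNReal.ofReal (μ' * eta n K * (av n m * rho n ^ m * m)) else 0) := by
      intro m
      have ha := av_nonneg n m
      by_cases hm : m < M
      · rw [if_pos (Finset.mem_range.2 hm)]
        refine le_trans (ENNReal.ofReal_le_ofReal ?_) le_add_self
        have : ((min m K : ℕ) : ℝ) ≤ m := by exact_mod_cast min_le_left _ _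
        gcongr
      · obtain ⟨g1, g2, g3⟩ := hM m (by omega)
        rw [if_pos g3, if_neg (by simpa using hm), add_zero, ← ENNReal.ofReal_mul (rc_nonneg _ _ _)]
        refine ENNReal.ofReal_le_ofReal ?_
        rw [lt_div_iff₀ (av_pos n m hn g2)] at g1
        calc μ' * eta n K * (av n m * rho n ^ m * (min m K : ℕ)) = (μ' * av n m) * (rho n ^ m * (eta n K * (min m K : ℕ))) := by ring
          _ ≤ rc c Q m * (rho n ^ m * (eta n K * (min m K : ℕ))) := by gcongr
          _ ≤ _ := by
            have := rc_nonneg c Q m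
            unfold gK; gcongr; linarith
    have h2 := ENNReal.tsum_le_tsum hterm
    rw [ENNReal.tsum_add] at h2
    rw [← ENNReal.ofReal_tsum_of_nonneg (fun m => by have := av_nonneg n m; positivity) ((DD_summable n hn K).mul_left _), tsum_mul_left] at h2
    have h3 : ∑' m, (if m ∈ Finset.range M then ENNReal.ofReal (μ' * eta n K * (av n m * rho n ^ m * m)) else 0) = ENNReal.ofReal (μ' * eta n K * PP n M) := by
      rw [tsum_eq_sum (s := Finset.range M) (fun m hm => if_neg hm), PP, Finset.mul_sum, ENNReal.ofReal_sum_of_nonneg]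
      · exact Finset.sum_congr rfl (fun m hm => if_pos hm)
      · intro m _; have := av_nonneg n m; positivity
    rw [h3] at h2
    have hP : 0 ≤ PP n M := Finset.sum_nonneg (fun m _ => by have := av_nonneg n m; positivity)
    have h4 := h2.trans (add_le_add_left h1 _)
    rw [← ENNReal.ofReal_add hB0 (by positivity), ENNReal.ofReal_le_ofReal_iff (by positivity)] at h4
    have h5 : eta n K * DD n K = (1 - uu n) / 2 := by unfold eta; field_simp
    rw [show (∑' m, av n m * rho n ^ m * (min m K : ℕ)) = DD n K from rfl] at h4
    nlinarith
  have hlim : Tendsto (fun K => μ' * ((1 - uu n) / 2) - μ' * PP n M * eta n K) atTop (nhds (μ' * ((1 - uu n) / 2) - μ' * PP n M * 0)) :=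
    tendsto_const_nhds.sub ((eta_tendsto n hn).const_mul _)
  have := le_of_tendsto hlim key
  rw [one_sub_uu n hn] at this
  field_simp at this
  linarith

end S19

namespace S19
open AT Filter
open scoped ENNReal

/-- `t` becomes constant after substituting by `θ` -/
def Cst {n : ℕ} (θ : (Fin n → Bool) → (Fin n → Bool)) (t : AT n) : Prop := ∃ b, ∀ x, eval t (θ x) = b

open Classical in
mutual
/-- skeleton of a tree -/
noncomputable def sk {n : ℕ} (θ : (Fin n → Bool) → (Fin n → Bool)) : AT n → List (AT n)
  | .leaf i b => if Cst θ (.leaf i b) then [] else [.leaf i b]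
  | .node c l => if Cst θ (.node c l) then [] else [.node c (skL θ l)]
noncomputable def skL {n : ℕ} (θ : (Fin n → Bool) → (Fin n → Bool)) : List (AT n) → List (AT n)
  | [] => []
  | t :: l => sk θ t ++ skL θ l
end

open Classical in
mutual
/-- subtrees removed when passing to the skeleton -/
noncomputable def hg {n : ℕ} (θ : (Fin n → Bool) → (Fin n → Bool)) : Bool → AT n → List (Bool × AT n)
  | c, .leaf i b => if Cst θ (.leaf i b) then [(c, .leaf i b)] else []
  | c, .node d l => if Cst θ (.node d l) then [(c, .node d l)] else hgL θ d l
noncomputable def hgL {n : ℕ} (θ : (Fin n → Bool) → (Fin n → Bool)) : Bool → List (AT n) → List (Bool × AT n)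
  | _, [] => []
  | c, t :: l => hg θ c t ++ hgL θ c l
end

section
variable {n : ℕ} (θ : (Fin n → Bool) → (Fin n → Bool))

theorem sk_cst {t : AT n} (h : Cst θ t) : sk θ t = [] := by
  cases t <;> rw [sk, if_pos h]

theorem hg_cst (c : Bool) {t : AT n} (h : Cst θ t) : hg θ c t = [(c, t)] := by
  cases t <;> rw [hg, if_pos h]

theorem sk_leaf {i : Fin n} {b : Bool} (h : ¬ Cst θ (.leaf i b)) : sk θ (.leaf i b) = [.leaf i b] := by
  rw [sk, if_neg h]
theorem sk_node {c : Bool} {l : List (AT n)} (h : ¬ Cst θ (.node c l)) : sk θ (.node c l) = [.node c (skL θ l)] := by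
  rw [sk, if_neg h]
theorem hg_leaf (c : Bool) {i : Fin n} {b : Bool} (h : ¬ Cst θ (.leaf i b)) : hg θ c (.leaf i b) = [] := by
  rw [hg, if_neg h]
theorem hg_node (c : Bool) {d : Bool} {l : List (AT n)} (h : ¬ Cst θ (.node d l)) : hg θ c (.node d l) = hgL θ d l := by
  rw [hg, if_neg h]

theorem mem_skL {s : AT n} {l : List (AT n)} : s ∈ skL θ l ↔ ∃ t ∈ l, s ∈ sk θ t := by
  induction l with
  | nil => simp [skL]
  | cons a l ih => simp [skL, ih]

theorem mem_hgL {p : Bool × AT n} {c : Bool} {l : List (AT n)} : p ∈ hgL θ c l ↔ ∃ t ∈ l, p ∈ hg θ c t := by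
  induction l with
  | nil => simp [hgL]
  | cons a l ih => simp [hgL, ih]

/-- number of remaining nodes -/
noncomputable def mm (t : AT n) : ℕ := sizeList (sk θ t)

theorem mm_cst {t : AT n} (h : Cst θ t) : mm θ t = 0 := by rw [mm, sk_cst θ h, sizeList]
theorem mm_pos {t : AT n} (h : ¬ Cst θ t) : 1 ≤ mm θ t := by
  cases t with
  | leaf i b => rw [mm, sk_leaf θ h]; simp [sizeList, size]
  | node c l => rw [mm, sk_node θ h]; simp [sizeList, size]

def hsz (l : List (Bool × AT n)) : ℕ := (l.map (fun p => size p.2)).sum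

theorem size_split (t : AT n) : ∀ c, size t = mm θ t + hsz (hg θ c t) := by
  induction t using induct with
  | h1 i b =>
    intro c
    by_cases h : Cst θ (.leaf i b)
    · rw [mm_cst θ h, hg_cst θ c h]; simp [hsz]
    · rw [mm, sk_leaf θ h, hg_leaf θ c h]; simp [hsz, sizeList]
  | h2 d l ih =>
    intro c
    by_cases h : Cst θ (.node d l)
    · rw [mm_cst θ h, hg_cst θ c h]; simp [hsz]
    · rw [mm, sk_node θ h, hg_node θ c h]
      have : ∀ l : List (AT n), (∀ t ∈ l, ∀ c, size t = mm θ t + hsz (hg θ c t)) → sizeList l = sizeList (skL θ l) + hsz (hgL θ d l) := by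
        intro l
        induction l with
        | nil => simp [sizeList, skL, hgL, hsz]
        | cons a l ih2 =>
          intro hl
          have h1 := hl a (by simp) d
          have h2 := ih2 (fun t ht => hl t (by simp [ht]))
          simp only [sizeList, skL, hgL, hsz, List.map_append, List.sum_append, sizeList_append, mm] at *
          omega
      rw [sizeList, sizeList, size, size, this l ih]; omega

/-- stratified trees with unary nodes allowed -/
inductive WF1 {n : ℕ} : AT n → Prop
  | leaf (i : Fin n) (b : Bool) : WF1 (.leaf i b)
  | node (c : Bool) (l : List (AT n)) : l ≠ [] → (∀ t ∈ l, WF1 t) → (∀ t ∈ l, rootConn t ≠ some c) → WF1 (.node c l)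

theorem child_val {d : Bool} {l : List (AT n)} (h : ¬ Cst θ (.node d l)) {e : AT n} (he : e ∈ l)
    (hc : Cst θ e) : ∀ x, eval e (θ x) = d := by
  obtain ⟨b, hb⟩ := hc
  by_cases hbd : b = d
  · rw [← hbd]; exact hb
  · exfalso; apply h
    refine ⟨!d, fun x => ?_⟩
    rw [eval_node_not_iff]
    exact ⟨e, he, by rw [hb]; revert hbd; cases b <;> cases d <;> simp⟩

theorem sk_spec (hθ : ∀ i, (∀ x, θ x i = x i) ∨ ∃ b, ∀ x, θ x i = b) (t : AT n) :
    WF t → ¬ Cst θ t → ∃ t', sk θ t = [t'] ∧ WF1 t' ∧ rootConn t' = rootConn t ∧ ∀ x, eval t' x = eval t (θ x) := by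
  induction t using induct with
  | h1 i b =>
    intro _ h
    refine ⟨_, sk_leaf θ h, WF1.leaf i b, rfl, fun x => ?_⟩
    rcases hθ i with h1 | ⟨b', h1⟩
    · simp [eval, h1]
    · exact absurd ⟨if b then b' else !b', fun x => by simp [eval, h1]⟩ h
  | h2 d l ih =>
    intro hw h
    obtain ⟨hlen, hok⟩ := (wf_node_iff' d l).1 hw
    refine ⟨_, sk_node θ h, WF1.node d _ ?_ ?_ ?_, rfl, fun x => ?_⟩
    · intro hnil
      apply h
      refine ⟨d, fun x => ?_⟩
      rw [eval_node_iff]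
      intro t ht
      by_cases hc : Cst θ t
      · exact child_val θ h ht hc x
      · obtain ⟨t', h1, _⟩ := ih t ht (hok t ht).1 hc
        have : t' ∈ skL θ l := (mem_skL θ).2 ⟨t, ht, by simp [h1]⟩
        rw [hnil] at this; simp at this
    · intro s hs
      obtain ⟨t, ht, hst⟩ := (mem_skL θ).1 hs
      by_cases hc : Cst θ t
      · rw [sk_cst θ hc] at hst; simp at hst
      · obtain ⟨t', h1, h2, _⟩ := ih t ht (hok t ht).1 hc
        rw [h1] at hst; simp at hst; rw [hst]; exact h2
    · intro s hs
      obtain ⟨t, ht, hst⟩ := (mem_skL θ).1 hs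
      by_cases hc : Cst θ t
      · rw [sk_cst θ hc] at hst; simp at hst
      · obtain ⟨t', h1, h2, h3, _⟩ := ih t ht (hok t ht).1 hc
        rw [h1] at hst; simp at hst; rw [hst, h3]; exact (hok t ht).2
    · refine eval_node_congr d _ _ _ _ ?_
      constructor
      · intro hh t ht
        by_cases hc : Cst θ t
        · exact child_val θ h ht hc x
        · obtain ⟨t', h1, _, _, h4⟩ := ih t ht (hok t ht).1 hc
          rw [← h4]; exact hh t' ((mem_skL θ).2 ⟨t, ht, by simp [h1]⟩)
      · intro hh s hs
        obtain ⟨t, ht, hst⟩ := (mem_skL θ).1 hs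
        by_cases hc : Cst θ t
        · rw [sk_cst θ hc] at hst; simp at hst
        · obtain ⟨t', h1, h2, h3, h4⟩ := ih t ht (hok t ht).1 hc
          rw [h1] at hst; simp at hst; rw [hst, h4]; exact hh t ht

theorem flatten (t : AT n) : WF1 t → ∃ r, WF r ∧ eval r = eval t ∧ size r ≤ size t ∧ (WF t ∨ size r < size t) := by
  induction t using induct with
  | h1 i b => intro _; exact ⟨_, WF.leaf i b, rfl, le_rfl, Or.inl (WF.leaf i b)⟩
  | h2 c l ih =>
    intro hw
    cases hw with
    | node _ _ hne h1 h2 =>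
    by_cases hlen : 2 ≤ l.length
    · have key : ∀ l : List (AT n), (∀ t ∈ l, ∃ r, WF r ∧ eval r = eval t ∧ size r ≤ size t ∧ (WF t ∨ size r < size t)) →
          ∃ l2, (∀ t ∈ l2, Ok c t) ∧ l.length ≤ l2.length ∧ (∀ x, (∀ t ∈ l2, eval t x = c) ↔ ∀ t ∈ l, eval t x = c) ∧
            sizeList l2 ≤ sizeList l ∧ ((∀ t ∈ l, WF t) ∨ sizeList l2 < sizeList l) := by
        intro l
        induction l with
        | nil => intro _; exact ⟨[], by simp⟩
        | cons a l ihl =>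
          intro hl
          obtain ⟨l2, g1, g2, g3, g4, g5⟩ := ihl (fun t ht => hl t (by simp [ht]))
          obtain ⟨r, r1, r2, r3, r4⟩ := hl a (by simp)
          have : ∃ p : List (AT n), (∀ t ∈ p, Ok c t) ∧ 1 ≤ p.length ∧ (∀ x, (∀ t ∈ p, eval t x = c) ↔ eval a x = c) ∧ sizeList p ≤ size r := by
            by_cases hr : rootConn r = some c
            · cases r with
              | leaf => simp [rootConn] at hr
              | node d q =>
                simp [rootConn] at hr
                subst hr
                obtain ⟨w1, w2⟩ := (wf_node_iff' _ _).1 r1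
                refine ⟨q, w2, by omega, fun x => ?_, by simp [size]⟩
                rw [← r2, eval_node_iff]
            · exact ⟨[r], by simpa using ⟨r1, hr⟩, by simp, by simp [r2], by simp [sizeList]⟩
          obtain ⟨p, p1, p2, p3, p4⟩ := this
          refine ⟨p ++ l2, ?_, ?_, ?_, ?_, ?_⟩
          · intro t ht
            rcases List.mem_append.1 ht with h | h
            · exact p1 t h
            · exact g1 t h
          · simp; omega
          · intro x
            simp only [List.mem_append, List.mem_cons, or_imp, forall_and, p3, g3, forall_eq]
          · simp only [sizeList_append, sizeList]; omega
          · simp only [sizeList_append, sizeList]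
            rcases r4 with r4 | r4
            · rcases g5 with g5 | g5
              · left; simpa using ⟨r4, g5⟩
              · right; omega
            · right; omega
      obtain ⟨l2, g1, g2, g3, g4, g5⟩ := key l (fun t ht => ih t ht (h1 t ht))
      refine ⟨.node c l2, (wf_node_iff' _ _).2 ⟨by omega, g1⟩, ?_, ?_, ?_⟩
      · funext x; exact eval_node_congr c _ _ _ _ (g3 x)
      · simp only [size]; omega
      · rcases g5 with g5 | g5
        · left; exact (wf_node_iff _ _).2 ⟨hlen, fun t ht => ⟨g5 t ht, h2 t ht⟩⟩
        · right; simp only [size]; omega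
    · match l, hne, hlen, ih, h1 with
      | [s], _, _, ih, h1 =>
        obtain ⟨r, r1, r2, r3, _⟩ := ih s (by simp) (h1 s (by simp))
        refine ⟨r, r1, ?_, ?_, ?_⟩
        · rw [r2]; funext x; cases c <;> simp [eval, evalList]
        · simp [size, sizeList]; omega
        · right; simp [size, sizeList]; omega
      | a :: b :: l, _, hlen, _, _ => simp at hlen

theorem hg_val (t : AT n) : ∀ c, ¬ Cst θ t → ∀ p ∈ hg θ c t, ∀ x, eval p.2 (θ x) = p.1 := by
  induction t using induct with
  | h1 i b => intro c h p hp; rw [hg_leaf θ c h] at hp; simp at hp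
  | h2 d l ih =>
    intro c h p hp
    rw [hg_node θ c h, mem_hgL] at hp
    obtain ⟨t, ht, hp⟩ := hp
    by_cases hc : Cst θ t
    · rw [hg_cst θ d hc] at hp; simp at hp; subst hp; exact child_val θ h ht hc
    · exact ih t ht d hc p hp

theorem hg_ok (t : AT n) : ∀ c, Ok c t → ∀ p ∈ hg θ c t, Ok p.1 p.2 := by
  induction t using induct with
  | h1 i b =>
    intro c h p hp
    rw [hg] at hp
    split_ifs at hp
    · simp at hp; subst hp; exact h
    · simp at hp
  | h2 d l ih =>
    intro c h p hp
    by_cases hc : Cst θ (.node d l)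
    · rw [hg_cst θ c hc] at hp; simp at hp; subst hp; exact h
    · rw [hg_node θ c hc, mem_hgL] at hp
      obtain ⟨t, ht, hp⟩ := hp
      exact ih t ht d (((ok_node_iff _ _ _).1 h).2.2 t ht) p hp

theorem compare_le (θ' : (Fin n → Bool) → (Fin n → Bool)) (t : AT n) :
    ∀ c, (∀ p ∈ hg θ c t, Cst θ' p.2) → mm θ' t ≤ mm θ t := by
  induction t using induct with
  | h1 i b =>
    intro c h
    by_cases h1 : Cst θ (.leaf i b)
    · rw [hg_cst θ c h1] at h
      rw [mm_cst θ' (h (c, .leaf i b) (by simp))]; exact Nat.zero_le _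
    · have h2 := mm_pos θ h1
      rw [mm, sk]
      split_ifs <;> simp [sizeList, size, h2]
  | h2 d l ih =>
    intro c h
    by_cases h0 : Cst θ' (.node d l)
    · rw [mm_cst θ' h0]; exact Nat.zero_le _
    by_cases h1 : Cst θ (.node d l)
    · rw [hg_cst θ c h1] at h
      exact absurd (h (c, .node d l) (by simp)) h0
    · rw [hg_node θ c h1] at h
      rw [mm, mm, sk_node θ h1, sk_node θ' h0]
      have : ∀ l : List (AT n), (∀ t ∈ l, ∀ c, (∀ p ∈ hg θ c t, Cst θ' p.2) → mm θ' t ≤ mm θ t) → (∀ p ∈ hgL θ d l, Cst θ' p.2) →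
          sizeList (skL θ' l) ≤ sizeList (skL θ l) := by
        intro l
        induction l with
        | nil => intro _ _; simp [skL]
        | cons a l ihl =>
          intro g1 g2
          simp only [skL, sizeList_append, hgL] at g2 ⊢
          have := g1 a (by simp) d (fun p hp => g2 p (by simp [hp]))
          have := ihl (fun t ht => g1 t (by simp [ht])) (fun p hp => g2 p (by simp [hp]))
          simp only [mm] at *; omega
      have := this l ih h
      simp only [sizeList, size]; omega

theorem compare_lt (θ' : (Fin n → Bool) → (Fin n → Bool)) (t : AT n) :
    ∀ c, ¬ Cst θ t → (∀ p ∈ hg θ c t, Cst θ' p.2) → (∃ p ∈ hg θ c t, ∀ x, eval p.2 (θ' x) = !p.1) → mm θ' t < mm θ t := by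
  induction t using induct with
  | h1 i b => intro c h _ ⟨p, hp, _⟩; rw [hg_leaf θ c h] at hp; simp at hp
  | h2 d l ih =>
    intro c h1 h ⟨p, hp, hv⟩
    by_cases h0 : Cst θ' (.node d l)
    · rw [mm_cst θ' h0]; exact mm_pos θ h1
    rw [hg_node θ c h1] at h hp
    rw [mm, mm, sk_node θ h1, sk_node θ' h0]
    obtain ⟨s, hs, hp⟩ := (mem_hgL θ).1 hp
    have hlt : mm θ' s < mm θ s := by
      by_cases hc : Cst θ s
      · exfalso; apply h0
        rw [hg_cst θ d hc] at hp; simp at hp; subst hp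
        exact ⟨!d, fun x => (eval_node_not_iff _ _ _).2 ⟨s, hs, hv x⟩⟩
      · exact ih s hs d hc (fun q hq => h q ((mem_hgL θ).2 ⟨s, hs, hq⟩)) ⟨p, hp, hv⟩
    have : ∀ l : List (AT n), s ∈ l → (∀ p ∈ hgL θ d l, Cst θ' p.2) →
          sizeList (skL θ' l) < sizeList (skL θ l) := by
      have hle : ∀ l : List (AT n), (∀ p ∈ hgL θ d l, Cst θ' p.2) →
          sizeList (skL θ' l) ≤ sizeList (skL θ l) := by
        intro l
        induction l with
        | nil => intro _; simp [skL]
        | cons a l ihl =>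
          intro g2
          simp only [skL, sizeList_append, hgL] at g2 ⊢
          have := compare_le θ θ' a d (fun p hp => g2 p (by simp [hp]))
          have := ihl (fun p hp => g2 p (by simp [hp]))
          simp only [mm] at *; omega
      intro l
      induction l with
      | nil => simp
      | cons a l ihl =>
        intro g1 g2
        simp only [skL, sizeList_append, hgL] at g2 ⊢
        rcases List.mem_cons.1 g1 with rfl | g1
        · have := hle l (fun p hp => g2 p (by simp [hp]))
          simp only [mm] at *; omega
        · have := compare_le θ θ' a d (fun p hp => g2 p (by simp [hp]))
          have := ihl g1 (fun p hp => g2 p (by simp [hp]))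
          simp only [mm] at *; omega
    have := this l hs h
    simp only [sizeList, size]; omega

/-- lower bound through the skeleton -/
theorem mm_lower (hθ : ∀ i, (∀ x, θ x i = x i) ∨ ∃ b, ∀ x, θ x i = b) (f : (Fin n → Bool) → Bool)
    (hf : ∀ x, f (θ x) = f x) (hf1 : ∀ b, f ≠ fun _ => b) (L : ℕ) (hL : ∀ r : AT n, WF r → eval r = f → L ≤ size r) (t : AT n) (hw : WF t) (ht : eval t = f) :
    ¬ Cst θ t ∧ L ≤ mm θ t ∧ (mm θ t = L → ∃ t', sk θ t = [t'] ∧ WF t' ∧ eval t' = f ∧ size t' = L) := by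
  have hc : ¬ Cst θ t := by
    rintro ⟨b, hb⟩
    apply hf1 b; funext x; rw [← hf, ← ht]; exact hb x
  obtain ⟨t', h1, h2, _, h4⟩ := sk_spec θ hθ t hw hc
  have he : eval t' = f := by funext x; rw [h4, ht, hf]
  have hm : mm θ t = size t' := by rw [mm, h1]; simp [sizeList]
  obtain ⟨r, r1, r2, r3, r4⟩ := flatten t' h2
  have := hL r r1 (r2.trans he)
  refine ⟨hc, by omega, fun hmL => ⟨t', h1, ?_, he, by omega⟩⟩
  rcases r4 with r4 | r4
  · exact r4
  · omega

end
end S19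

namespace S19
open AT Filter
open scoped ENNReal

/-- `t` is obtained from `t'` by inserting neutral constant subtrees -/
inductive Emb {n : ℕ} : AT n → AT n → Prop
  | leaf (i : Fin n) (b : Bool) : Emb (.leaf i b) (.leaf i b)
  | nil (c : Bool) : Emb (.node c []) (.node c [])
  | keep (c : Bool) (t' t : AT n) (l' l : List (AT n)) : Emb t' t → Emb (.node c l') (.node c l) →
      Emb (.node c (t' :: l')) (.node c (t :: l))
  | skip (c : Bool) (e : AT n) (l' l : List (AT n)) : Ok c e → (eval e = fun _ => c) →
      Emb (.node c l') (.node c l) → Emb (.node c l') (.node c (e :: l))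

section
variable {n : ℕ}

theorem emb_eval {t' t : AT n} (h : Emb t' t) : eval t' = eval t := by
  induction h with
  | leaf => rfl
  | nil => rfl
  | keep c t' t l' l _ _ ih1 ih2 =>
    funext x
    have := congrFun ih2 x
    simp only [eval] at this
    simp only [eval, evalList, ih1, this]
  | skip c e l' l _ he _ ih =>
    funext x
    have := congrFun ih x
    simp only [eval] at this
    simp only [eval, evalList, he, this]
    cases c <;> simp

theorem emb_root {t' t : AT n} (h : Emb t' t) : rootConn t' = rootConn t := by
  cases h <;> rfl

theorem emb_refl (t : AT n) : Emb t t := by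
  induction t using induct with
  | h1 i b => exact Emb.leaf i b
  | h2 c l ih =>
    induction l with
    | nil => exact Emb.nil c
    | cons a l ihl => exact Emb.keep c a a l l (ih a (by simp)) (ihl (fun t ht => ih t (by simp [ht])))

theorem emb_append {c : Bool} {l2' l2 : List (AT n)} (h2 : Emb (.node c l2') (.node c l2)) (l1 : List (AT n)) :
    ∀ l1', Emb (.node c l1') (.node c l1) → Emb (.node c (l1' ++ l2')) (.node c (l1 ++ l2)) := by
  induction l1 with
  | nil => intro l1' h; cases h; exact h2
  | cons a l1 ih =>
    intro l1' h
    cases h with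
    | keep _ t' t l' l g1 g2 => exact Emb.keep c _ _ _ _ g1 (ih _ g2)
    | skip _ e l' l g1 g2 g3 => exact Emb.skip c _ _ _ g1 g2 (ih _ g3)

theorem emb_split {c : Bool} {l2 : List (AT n)} (l1 : List (AT n)) :
    ∀ l', Emb (.node c l') (.node c (l1 ++ l2)) →
      ∃ l1' l2', l' = l1' ++ l2' ∧ Emb (.node c l1') (.node c l1) ∧ Emb (.node c l2') (.node c l2) := by
  induction l1 with
  | nil => intro l' h; exact ⟨[], l', rfl, Emb.nil c, h⟩
  | cons a l1 ih =>
    intro l' h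
    cases h with
    | keep _ t' t l' l g1 g2 =>
      obtain ⟨p, q, rfl, h1, h2⟩ := ih _ g2
      exact ⟨t' :: p, q, rfl, Emb.keep c _ _ _ _ g1 h1, h2⟩
    | skip _ e l' l g1 g2 g3 =>
      obtain ⟨p, q, rfl, h1, h2⟩ := ih _ g3
      exact ⟨p, q, rfl, Emb.skip c _ _ _ g1 g2 h1, h2⟩

theorem emb_node {c : Bool} {l : List (AT n)} {t' : AT n} (h : Emb t' (.node c l)) : ∃ l', t' = .node c l' := by
  cases h <;> exact ⟨_, rfl⟩

theorem te_root {t t2 : AT n} (h : TautExp t t2) : rootConn t2 = rootConn t := by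
  cases h <;> rfl

theorem te_eval {t t2 : AT n} (h : TautExp t t2) : eval t2 = eval t := by
  induction h with
  | here c l1 l2 e _ _ he =>
    funext x
    refine eval_node_congr c _ _ _ _ ?_
    simp only [List.mem_append, List.mem_cons, or_imp, forall_and, forall_eq, he]
    simp
  | child c l1 l2 t t' _ ih =>
    funext x
    refine eval_node_congr c _ _ _ _ ?_
    simp only [List.mem_append, List.mem_cons, or_imp, forall_and, forall_eq, ih]

theorem te_wf {t t2 : AT n} (h : TautExp t t2) : WF t → WF t2 := by
  induction h with
  | here c l1 l2 e h1 h2 he =>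
    intro hw
    rw [wf_node_iff'] at hw ⊢
    simp only [List.mem_append, List.mem_cons, or_imp, forall_and, forall_eq, List.length_append, List.length_cons] at hw ⊢
    exact ⟨by omega, hw.2.1, ⟨h1, h2⟩, hw.2.2⟩
  | child c l1 l2 t t' h ih =>
    intro hw
    rw [wf_node_iff'] at hw ⊢
    simp only [List.mem_append, List.mem_cons, or_imp, forall_and, forall_eq, List.length_append, List.length_cons] at hw ⊢
    exact ⟨by omega, hw.2.1, ⟨ih hw.2.2.1.1, by rw [te_root h]; exact hw.2.2.1.2⟩, hw.2.2.2⟩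

theorem te_size {t t2 : AT n} (h : TautExp t t2) : size t < size t2 := by
  induction h with
  | here c l1 l2 e _ _ he =>
    have := size_pos e
    simp only [size, sizeList_append, sizeList]; omega
  | child c l1 l2 t t' _ ih => simp only [size, sizeList_append, sizeList]; omega

theorem emb_te {t t2 : AT n} (h : TautExp t t2) : WF t → ∀ t', Emb t' t → Emb t' t2 := by
  induction h with
  | here c l1 l2 e h1 h2 he =>
    intro _ t' ht
    obtain ⟨l', rfl⟩ := emb_node ht
    obtain ⟨p, q, rfl, g1, g2⟩ := emb_split _ _ ht
    exact emb_append (Emb.skip c e _ _ ⟨h1, h2⟩ he g2) _ _ g1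
  | child c l1 l2 t t2 h ih =>
    intro hw t' ht
    obtain ⟨l', rfl⟩ := emb_node ht
    obtain ⟨p, q, rfl, g1, g2⟩ := emb_split _ _ ht
    have hok : Ok c t := ((wf_node_iff' _ _).1 hw).2 t (by simp)
    refine emb_append ?_ _ _ g1
    cases g2 with
    | keep _ s' _ m' _ k1 k2 => exact Emb.keep c _ _ _ _ (ih hok.1 _ k1) k2
    | skip _ _ m' _ k1 k2 k3 =>
      refine Emb.skip c _ _ _ ⟨te_wf h hok.1, by rw [te_root h]; exact hok.2⟩ (by rw [te_eval h]; exact k2) k3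

theorem emb_len {t' t : AT n} (h : Emb t' t) : (WF t' → WF t) ∧
    ∀ c l' l, t' = .node c l' → t = .node c l → (∀ s ∈ l', Ok c s) → l'.length ≤ l.length ∧ ∀ s ∈ l, Ok c s := by
  have main : ∀ c l' l, t' = .node c l' → t = .node c l → (∀ s ∈ l', Ok c s) → l'.length ≤ l.length ∧ ∀ s ∈ l, Ok c s := by
    induction h with
    | leaf => intro c l' l h; cases h
    | nil => 
      intro c l' l h1 h2; cases h1; cases h2; simp
    | keep c t' t l' l g1 g2 ih1 ih2 =>
      intro c0 m' m h1 h2 hok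
      cases h1; cases h2
      obtain ⟨k1, k2⟩ := ih2 _ _ _ rfl rfl (fun s hs => hok s (by simp [hs]))
      refine ⟨by simpa using k1, ?_⟩
      have h3 := hok t' (by simp)
      intro s hs
      rcases List.mem_cons.1 hs with rfl | hs
      · refine ⟨?_, by rw [← emb_root g1]; exact h3.2⟩
        cases s with
        | leaf i b => exact WF.leaf i b
        | node d q =>
          obtain ⟨q', rfl⟩ := emb_node g1
          obtain ⟨w1, w2⟩ := (wf_node_iff' _ _).1 h3.1
          obtain ⟨w3, w4⟩ := ih1 _ _ _ rfl rfl w2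
          exact (wf_node_iff' _ _).2 ⟨by omega, w4⟩
      · exact k2 s hs
    | skip c e l' l g1 g2 g3 ih =>
      intro c0 m' m h1 h2 hok
      cases h1; cases h2
      obtain ⟨k1, k2⟩ := ih _ _ _ rfl rfl hok
      refine ⟨by simp; omega, ?_⟩
      intro s hs
      rcases List.mem_cons.1 hs with rfl | hs
      · exact g1
      · exact k2 s hs
  refine ⟨fun hw => ?_, main⟩
  cases t with
  | leaf i b => exact WF.leaf i b
  | node d q =>
    obtain ⟨q', rfl⟩ := emb_node h
    obtain ⟨w1, w2⟩ := (wf_node_iff' _ _).1 hw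
    obtain ⟨w3, w4⟩ := main _ _ _ rfl rfl w2
    exact (wf_node_iff' _ _).2 ⟨by omega, w4⟩

theorem te_cons {c : Bool} {m l : List (AT n)} (a : AT n) (h : TautExp (.node c m) (.node c l)) :
    TautExp (.node c (a :: m)) (.node c (a :: l)) := by
  generalize h1 : AT.node c m = s at h
  generalize h2 : AT.node c l = s2 at h
  cases h with
  | here d l1 l2 e g1 g2 g3 => cases h1; cases h2; exact TautExp.here c (a :: l1) l2 e g1 g2 g3
  | child d l1 l2 t t' g => cases h1; cases h2; exact TautExp.child c (a :: l1) l2 t t' g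

theorem emb_pred {t' t : AT n} (h : Emb t' t) : t = t' ∨ ∃ t1, TautExp t1 t ∧ Emb t' t1 := by
  induction h with
  | leaf => left; rfl
  | nil => left; rfl
  | keep c t' t l' l g1 g2 ih1 ih2 =>
    rcases ih1 with rfl | ⟨t1, h1, h2⟩
    · rcases ih2 with h | ⟨s, h1, h2⟩
      · cases h; left; rfl
      · right
        have : ∃ m, s = .node c m := by
          have := te_root h1
          cases s with
          | leaf => simp [rootConn] at this
          | node d m => simp [rootConn] at this; subst this; exact ⟨m, rfl⟩
        obtain ⟨m, rfl⟩ := this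
        exact ⟨_, te_cons t h1, Emb.keep c _ _ _ _ g1 h2⟩
    · right; exact ⟨_, TautExp.child c [] l t1 t h1, Emb.keep c _ _ _ _ h2 g2⟩
  | skip c e l' l g1 g2 g3 _ =>
    right; exact ⟨_, TautExp.here c [] l e g1.1 g1.2 g2, g3⟩

/-- no constant proper subtree -/
inductive NC {n : ℕ} : AT n → Prop
  | leaf (i : Fin n) (b : Bool) : NC (.leaf i b)
  | node (c : Bool) (l : List (AT n)) : (∀ t ∈ l, NC t) → (∀ t ∈ l, ∀ b, eval t ≠ fun _ => b) → NC (.node c l)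

theorem nc_node {c : Bool} {l : List (AT n)} (h : NC (.node c l)) : ∀ t ∈ l, NC t ∧ ∀ b, eval t ≠ fun _ => b := by
  cases h with
  | node _ _ h1 h2 => exact fun t ht => ⟨h1 t ht, h2 t ht⟩

theorem emb_te_rev {t t2 : AT n} (h : TautExp t t2) : WF t → ∀ t', NC t' → Emb t' t2 → Emb t' t := by
  induction h with
  | here c l1 l2 e h1 h2 he =>
    intro _ t' hn ht
    obtain ⟨l', rfl⟩ := emb_node ht
    obtain ⟨p, q, rfl, g1, g2⟩ := emb_split _ _ ht
    refine emb_append ?_ _ _ g1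
    cases g2 with
    | keep _ s' _ m' _ k1 k2 =>
      exact absurd ((emb_eval k1).trans he) ((nc_node hn s' (by simp)).2 c)
    | skip _ _ m' _ k1 k2 k3 => exact k3
  | child c l1 l2 t t2 h ih =>
    intro hw t' hn ht
    obtain ⟨l', rfl⟩ := emb_node ht
    obtain ⟨p, q, rfl, g1, g2⟩ := emb_split _ _ ht
    have hok : Ok c t := ((wf_node_iff' _ _).1 hw).2 t (by simp)
    refine emb_append ?_ _ _ g1
    cases g2 with
    | keep _ s' _ m' _ k1 k2 => exact Emb.keep c _ _ _ _ (ih hok.1 _ (nc_node hn s' (by simp)).1 k1) k2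
    | skip _ _ m' _ k1 k2 k3 =>
      refine Emb.skip c _ _ _ hok (by rw [← te_eval h]; exact k2) k3

theorem rel_eval {t t2 : AT n} (h : Rel t t2) : eval t = eval t2 := by
  induction h with
  | base d l1 l2 h1 h2 =>
    funext x
    obtain ⟨s, hs, he⟩ := h1
    obtain ⟨s', hs', he'⟩ := h2
    rw [(eval_node_not_iff d l1 x).2 ⟨s, hs, by rw [he]⟩, (eval_node_not_iff d l2 x).2 ⟨s', hs', by rw [he']⟩]
  | ctx d l r s s' _ ih =>
    funext x
    refine eval_node_congr d _ _ _ _ ?_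
    simp only [List.mem_append, List.mem_cons, or_imp, forall_and, forall_eq, ih]

theorem rel_root {t t2 : AT n} (h : Rel t t2) : rootConn t = rootConn t2 := by cases h <;> rfl

theorem rel_symm {t t2 : AT n} (h : Rel t t2) : Rel t2 t := by
  induction h with
  | base d l1 l2 h1 h2 => exact Rel.base d l2 l1 h2 h1
  | ctx d l r s s' _ ih => exact Rel.ctx d l r s' s ih

theorem emb_rel {t t2 : AT n} (h : Rel t t2) : WF t2 → ∀ t', NC t' → (∀ b, eval t' ≠ fun _ => b) → Emb t' t → Emb t' t2 := by
  induction h with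
  | base d l1 l2 h1 h2 =>
    intro _ t' _ hc ht
    exfalso
    refine hc (!d) ?_
    rw [emb_eval ht]
    funext x
    obtain ⟨s, hs, he⟩ := h1
    exact (eval_node_not_iff d l1 x).2 ⟨s, hs, by rw [he]⟩
  | ctx d l r s s2 h ih =>
    intro hw t' hn _ ht
    obtain ⟨l', rfl⟩ := emb_node ht
    obtain ⟨p, q, rfl, g1, g2⟩ := emb_split _ _ ht
    have hok : Ok d s2 := ((wf_node_iff' _ _).1 hw).2 s2 (by simp)
    refine emb_append ?_ _ _ g1
    cases g2 with
    | keep _ s' _ m' _ k1 k2 =>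
      have := nc_node hn s' (by simp)
      exact Emb.keep d _ _ _ _ (ih hok.1 _ this.1 this.2 k1) k2
    | skip _ _ m' _ k1 k2 k3 =>
      refine Emb.skip d _ _ _ hok (by rw [← rel_eval h]; exact k2) k3

theorem not_cst_id {t : AT n} : ¬ Cst id t ↔ ∀ b, eval t ≠ fun _ => b := by
  simp only [Cst, id, not_exists]
  constructor
  · intro h b hb; exact h b (fun x => by rw [hb])
  · intro h b hb; exact h b (funext hb)

theorem hg_nil_nc (t : AT n) : ∀ c, ¬ Cst id t → hg id c t = [] → NC t := by
  induction t using induct with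
  | h1 i b => intro _ _ _; exact NC.leaf i b
  | h2 d l ih =>
    intro c h1 h2
    rw [hg_node id c h1] at h2
    have h3 : ∀ t ∈ l, hg id d t = [] := by
      intro t ht
      by_contra hne
      obtain ⟨p, hp⟩ := List.exists_mem_of_ne_nil _ hne
      have : p ∈ hgL id d l := (mem_hgL id).2 ⟨t, ht, hp⟩
      rw [h2] at this; simp at this
    have h4 : ∀ t ∈ l, ¬ Cst id t := by
      intro t ht hc
      have := h3 t ht
      rw [hg_cst id d hc] at this; simp at this
    exact NC.node d l (fun t ht => ih t ht d (h4 t ht) (h3 t ht)) (fun t ht => not_cst_id.1 (h4 t ht))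

theorem min_nc (f : (Fin n → Bool) → Bool) (hf : ∀ b, f ≠ fun _ => b) (t : AT n) (ht : t ∈ Mset n f) : NC t := by
  obtain ⟨h1, h2, h3⟩ := ht
  obtain ⟨g1, g2, _⟩ := mm_lower id (fun i => Or.inl (fun x => rfl)) f (fun x => rfl) hf (size t) h3 t h1 h2
  refine hg_nil_nc t true g1 ?_
  have := size_split id t true
  have h0 : hsz (hg id true t) = 0 := by omega
  by_contra hne
  obtain ⟨p, hp⟩ := List.exists_mem_of_ne_nil _ hne
  have : size p.2 ≤ hsz (hg id true t) := List.single_le_sum (by simp) _ (List.mem_map.2 ⟨p, hp, rfl⟩)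
  have := size_pos p.2
  omega

/-- trees reducing to a minimal tree -/
def EmbM (f : (Fin n → Bool) → Bool) (t : AT n) : Prop := ∃ t' ∈ Mset n f, Emb t' t

theorem ek_char (f : (Fin n → Bool) → Bool) (hf : ∀ b, f ≠ fun _ => b) (t : AT n) :
    t ∈ (⋃ k, Ek (Ifam n f) k) ↔ WF t ∧ eval t = f ∧ ¬ EmbM f t := by
  rw [Set.mem_iUnion]
  constructor
  · rintro ⟨k, hk⟩
    induction k generalizing t with
    | zero =>
      obtain ⟨h1, h2, h3, h4⟩ := hk
      refine ⟨h1, h2, ?_⟩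
      rintro ⟨t', ht', he⟩
      rcases emb_pred he with rfl | ⟨t1, g1, g2⟩
      · exact h4 ht'
      · exact h3 ⟨t1, (emb_len g2).1 ht'.1, by rw [← emb_eval g2]; exact ht'.2.1, te_size g1, g1⟩
    | succ k ih =>
      obtain ⟨t1, h1, h2⟩ := hk
      obtain ⟨g1, g2, g3⟩ := ih t1 h1
      refine ⟨te_wf h2 g1, by rw [te_eval h2, g2], ?_⟩
      rintro ⟨t', ht', he⟩
      exact g3 ⟨t', ht', emb_te_rev h2 g1 t' (min_nc f hf t' ht') he⟩
  · rintro ⟨h1, h2, h3⟩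
    induction hs : size t using Nat.strong_induction_on generalizing t with
    | _ N ih =>
      by_cases hi : t ∈ Ifam n f
      · exact ⟨0, hi⟩
      · have hM : t ∉ Mset n f := fun h => h3 ⟨t, h, emb_refl t⟩
        have : ∃ t₀ : AT n, WF t₀ ∧ eval t₀ = f ∧ size t₀ < size t ∧ TautExp t₀ t := by
          by_contra hne; exact hi ⟨h1, h2, hne, hM⟩
        obtain ⟨t0, g1, g2, g3, g4⟩ := this
        obtain ⟨k, hk⟩ := ih (size t0) (by omega) t0 g1 g2 (fun ⟨t', ht', he⟩ => h3 ⟨t', ht', emb_te g4 g1 t' he⟩) rfl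
        exact ⟨k + 1, t0, hk, g4⟩

theorem ek_inv (f : (Fin n → Bool) → Bool) (hf : ∀ b, f ≠ fun _ => b) : Inv (fun t => t ∈ (⋃ k, Ek (Ifam n f) k)) := by
  intro t t2 hw hw2 hr
  simp only [ek_char f hf, hw, hw2, true_and, rel_eval hr]
  have key : ∀ s s2, WF s2 → Rel s s2 → EmbM f s → EmbM f s2 := by
    rintro s s2 hw hr ⟨t', ht', he⟩
    exact ⟨t', ht', emb_rel hr hw t' (min_nc f hf t' ht') (by rw [ht'.2.1]; exact hf) he⟩
  have : EmbM f t ↔ EmbM f t2 := ⟨key _ _ hw2 hr, key _ _ hw (rel_symm hr)⟩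
  rw [this]

theorem emb_sk (θ : (Fin n → Bool) → (Fin n → Bool)) (t : AT n) : ∀ c, ¬ Cst θ t →
    (∀ p ∈ hg θ c t, Ok p.1 p.2 ∧ eval p.2 = fun _ => p.1) → ∀ t', sk θ t = [t'] → Emb t' t := by
  induction t using induct with
  | h1 i b =>
    intro c h _ t' ht'
    rw [sk_leaf θ h] at ht'
    simp at ht'; subst ht'; exact Emb.leaf i b
  | h2 d l ih =>
    intro c h hp t' ht'
    rw [sk_node θ h] at ht'
    simp at ht'; subst ht'
    rw [hg_node θ c h] at hp
    clear h
    induction l with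
    | nil => rw [skL]; exact Emb.nil d
    | cons a l ihl =>
      rw [skL]
      rw [hgL] at hp
      have h2 := ihl (fun t ht => ih t (by simp [ht])) (fun p hh => hp p (by simp [hh]))
      by_cases hc : Cst θ a
      · rw [sk_cst θ hc]
        have := hp (d, a) (by rw [hg_cst θ d hc]; simp)
        exact Emb.skip d a _ _ this.1 this.2 h2
      · have : ∃ a', sk θ a = [a'] := by
          cases a with
          | leaf => exact ⟨_, sk_leaf θ hc⟩
          | node => exact ⟨_, sk_node θ hc⟩
        obtain ⟨a', ha'⟩ := this
        rw [ha']
        exact Emb.keep d a' a _ _ (ih a (by simp) d hc (fun p hh => hp p (by simp [hh])) a' ha') h2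

end
end S19

namespace S19
open AT Filter
open scoped ENNReal

mutual
/-- renaming of variables -/
def ren {n m : ℕ} (g : Fin n → Fin m) : AT n → AT m
  | .leaf i b => .leaf (g i) b
  | .node c l => .node c (renL g l)
def renL {n m : ℕ} (g : Fin n → Fin m) : List (AT n) → List (AT m)
  | [] => []
  | t :: l => ren g t :: renL g l
end

theorem renL_eq {n m : ℕ} (g : Fin n → Fin m) (l : List (AT n)) : renL g l = l.map (ren g) := by
  induction l with
  | nil => rw [renL]; rfl
  | cons a l ih => rw [renL, ih]; rfl

theorem ren_spec {n m : ℕ} (g : Fin n → Fin m) (t : AT n) :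
    size (ren g t) = size t ∧ rootConn (ren g t) = rootConn t ∧ (WF t → WF (ren g t)) ∧
    ∀ x, eval (ren g t) x = eval t (fun i => x (g i)) := by
  induction t using induct with
  | h1 i b =>
    refine ⟨by simp [ren, size], by simp [ren, rootConn], fun _ => by rw [ren]; exact WF.leaf _ _, fun x => by simp [ren, eval]⟩
  | h2 c l ih =>
    refine ⟨?_, by simp [ren, rootConn], ?_, ?_⟩
    · rw [ren, renL_eq, size, size, sizeList_eq, sizeList_eq, List.map_map]
      congr 2
      exact List.map_congr_left (fun t ht => (ih t ht).1)
    · intro h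
      rw [wf_node_iff] at h
      rw [ren, renL_eq, wf_node_iff]
      obtain ⟨h1, h2⟩ := h
      refine ⟨by simpa using h1, ?_⟩
      simp only [List.mem_map, forall_exists_index, and_imp, forall_apply_eq_imp_iff₂]
      exact fun t ht => ⟨(ih t ht).2.2.1 (h2 t ht).1, by rw [(ih t ht).2.1]; exact (h2 t ht).2⟩
    · intro x
      rw [ren, renL_eq]
      have : eval (.node c (l.map (ren g))) x = c ↔ eval (.node c l) (fun i => x (g i)) = c := by
        rw [eval_node_iff, eval_node_iff]
        simp only [List.mem_map, forall_exists_index, and_imp, forall_apply_eq_imp_iff₂]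
        exact forall₂_congr (fun t ht => by rw [(ih t ht).2.2.2])
      revert this
      cases eval (.node c (l.map (ren g))) x <;> cases eval (.node c l) (fun i => x (g i)) <;> cases c <;> simp

section
variable {n₀ n : ℕ}

theorem lcomp_le (h1 : 1 ≤ n₀) (h : n₀ ≤ n) (f : (Fin n₀ → Bool) → Bool) (hL : 3 ≤ Lcomp n₀ f)
    (r : AT n) (hr : WF r) (he : eval r = extend h f) : Lcomp n₀ f ≤ size r := by
  classical
  unfold Lcomp at hL ⊢
  split_ifs at hL ⊢ with g1 g2
  · omega
  · omega
  · let g : Fin n → Fin n₀ := fun i => if hi : i.val < n₀ then ⟨i.val, hi⟩ else ⟨0, h1⟩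
    obtain ⟨a1, _, a3, a4⟩ := ren_spec g r
    refine Nat.sInf_le ⟨ren g r, a3 hr, a1, ?_⟩
    funext x
    rw [a4, he, extend]
    congr 1
    funext j
    simp [g]

theorem nonconst (h1 : 1 ≤ n₀) (h : n₀ ≤ n) (f : (Fin n₀ → Bool) → Bool) (hL : 3 ≤ Lcomp n₀ f) (b : Bool) :
    extend h f ≠ fun _ => b := by
  classical
  intro hb
  have hf : f = fun _ => b := by
    funext x
    have := congrFun hb (fun i => if hi : i.val < n₀ then x ⟨i.val, hi⟩ else true)
    simpa [extend] using this
  unfold Lcomp at hL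
  rw [if_pos] at hL
  · omega
  · cases b
    · exact Or.inr hf
    · exact Or.inl hf

/-- substitution of the inessential variables -/
def th (n₀ : ℕ) (β : Fin n → Bool) (x : Fin n → Bool) (i : Fin n) : Bool := if i.val < n₀ then x i else β i

theorem th_spec (β : Fin n → Bool) (i : Fin n) : (∀ x, th n₀ β x i = x i) ∨ ∃ b, ∀ x, th n₀ β x i = b := by
  by_cases hi : i.val < n₀
  · left; intro x; simp [th, hi]
  · right; exact ⟨β i, fun x => by simp [th, hi]⟩

theorem th_extend (h : n₀ ≤ n) (f : (Fin n₀ → Bool) → Bool) (β x : Fin n → Bool) :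
    extend h f (th n₀ β x) = extend h f x := by
  simp [extend, th]

abbrev th1 (n₀ n : ℕ) : (Fin n → Bool) → (Fin n → Bool) := th n₀ (fun _ => true)

theorem leaf_th (β x : Fin n → Bool) (i : Fin n) (b : Bool) (hi : ¬ i.val < n₀) :
    eval (.leaf i b) (th n₀ β x) = if b then β i else !β i := by simp [eval, th, hi]

theorem leaf_cst_iff (β : Fin n → Bool) (i : Fin n) (b : Bool) : Cst (th n₀ β) (.leaf i b) ↔ ¬ i.val < n₀ := by
  constructor
  · rintro ⟨c, hc⟩ hi
    have h1 := hc (fun _ => true)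
    have h2 := hc (fun _ => false)
    simp [eval, th, hi] at h1 h2
    rw [h1] at h2
    cases c <;> simp at h2
  · intro hi; exact ⟨_, fun x => leaf_th β x i b hi⟩

theorem leaf_val (i : Fin n) (b d : Bool) (h : ∀ x, eval (.leaf i b) (th1 n₀ n x) = d) : ¬ i.val < n₀ ∧ b = d := by
  have hi := (leaf_cst_iff (n₀ := n₀) (fun _ => true) i b).1 ⟨d, h⟩
  refine ⟨hi, ?_⟩
  have := h (fun _ => true)
  rw [leaf_th _ _ _ _ hi] at this
  cases b <;> simpa using this

/-- exceptional removed subtrees -/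
def BadA (n₀ : ℕ) (l : List (AT n)) : Prop := ∃ i b, AT.leaf i b ∈ l ∧ i.val < n₀
def BadB (n₀ : ℕ) (c : Bool) (l : List (AT n)) : Prop := ∃ d l', AT.node d l' ∈ l ∧
  ∀ i b, AT.leaf i b ∈ l' → i.val < n₀ ∨ b = c ∨ ∃ b', AT.leaf i b' ∈ l
def BadC (n₀ : ℕ) (c : Bool) (l : List (AT n)) : Prop := ∃ i₀ : Fin n, ∀ i b, AT.leaf i b ∈ l → i.val < n₀ ∨ b = !c ∨ i = i₀
def Bad (n₀ : ℕ) (c : Bool) (t : AT n) : Prop :=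
  isLeafB t = false ∧ (BadA n₀ (rootChildren t) ∨ BadB n₀ c (rootChildren t) ∨ BadC n₀ c (rootChildren t))

theorem struct_bad (f : (Fin n → Bool) → Bool) (hf : ∀ β x, f (th n₀ β x) = f x) (hf1 : ∀ b, f ≠ fun _ => b)
    (L : ℕ) (hL : ∀ r : AT n, WF r → eval r = f → L ≤ size r) (t : AT n) (hw : WF t) (ht : eval t = f)
    (hne : ¬ EmbM f t) (c : Bool) (hok : Ok c t) (hm : mm (th1 n₀ n) t = L) (p : Bool × AT n)
    (hp : p ∈ hg (th1 n₀ n) c t) (hpl : isLeafB p.2 = false)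
    (hq : ∀ q ∈ hg (th1 n₀ n) c t, q = p ∨ isLeafB q.2 = true) : Bad n₀ p.1 p.2 := by
  by_contra hbad
  obtain ⟨h1, _, h3⟩ := mm_lower (th1 n₀ n) (th_spec _) f (hf _) hf1 L hL t hw ht
  obtain ⟨t', s1, s2, s3, s4⟩ := h3 hm
  have hM : t' ∈ Mset n f := ⟨s2, s3, fun r hr1 hr2 => by rw [s4]; exact hL r hr1 hr2⟩
  have hcontra : ∀ β, (∀ q ∈ hg (th1 n₀ n) c t, Cst (th n₀ β) q.2) → ¬ ∃ q ∈ hg (th1 n₀ n) c t, ∀ x, eval q.2 (th n₀ β x) = !q.1 := by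
    intro β g1 g2
    have := compare_lt (th1 n₀ n) (th n₀ β) t c h1 g1 g2
    have := (mm_lower (th n₀ β) (th_spec _) f (hf _) hf1 L hL t hw ht).2.1
    omega
  have hval := hg_val (th1 n₀ n) t c h1
  have hokp := hg_ok (th1 n₀ n) t c hok
  obtain ⟨pc, pe⟩ := p
  cases pe with
  | leaf i b => simp [isLeafB] at hpl
  | node d l =>
  have hpo := hokp _ hp
  simp only at hpo hpl hbad
  obtain ⟨rfl, hlen, hch⟩ := (ok_node_iff _ _ _).1 hpo
  have hbad' : ¬ (BadA n₀ l ∨ BadB n₀ pc l ∨ BadC n₀ pc l) := fun h => hbad ⟨hpl, h⟩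
  push Not at hbad'
  obtain ⟨nA, nB, nC⟩ := hbad'
  by_cases hleaf : ∃ q ∈ hg (th1 n₀ n) c t, isLeafB q.2 = true
  · obtain ⟨⟨qc, qe⟩, hq1, hq2⟩ := hleaf
    cases qe with
    | node => simp [isLeafB] at hq2
    | leaf y b =>
    obtain ⟨v1, v2⟩ := leaf_val y b qc (hval _ hq1)
    subst v2
    have hk : ∃ i b, AT.leaf i b ∈ l ∧ ¬ i.val < n₀ ∧ b ≠ !pc ∧ i ≠ y := by
      by_contra hk
      refine nC ⟨y, fun i b hib => ?_⟩
      by_contra hcon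
      push Not at hcon
      exact hk ⟨i, b, hib, by omega, hcon.2.1, hcon.2.2⟩
    obtain ⟨i, b', hi1, hi2, hi3, hi4⟩ := hk
    have hb' : b' = pc := by revert hi3; cases b' <;> cases pc <;> simp
    refine hcontra (fun j => decide (j ≠ y)) (fun q hq' => ?_) ⟨_, hq1, fun x => ?_⟩
    · rcases hq q hq' with rfl | hl
      · refine ⟨pc, fun x => ?_⟩
        have := (eval_node_not_iff (!pc) l (th n₀ (fun j => decide (j ≠ y)) x)).2 ⟨_, hi1, ?_⟩
        · simpa using this
        · rw [leaf_th _ _ _ _ hi2]; subst hb'; simp [hi4]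
      · obtain ⟨qc, qe⟩ := q
        cases qe with
        | node => simp [isLeafB] at hl
        | leaf j b2 =>
          have := (leaf_val j b2 qc (hval _ hq')).1
          exact (leaf_cst_iff _ _ _).2 this
    · simp only
      rw [leaf_th _ _ _ _ v1]; simp
  · have hall : ∀ q ∈ hg (th1 n₀ n) c t, q = (pc, .node (!pc) l) := by
      intro q hq'
      rcases hq q hq' with h | h
      · exact h
      · exact absurd ⟨q, hq', h⟩ hleaf
    by_cases hgen : eval (.node (!pc) l) = fun _ => pc
    · apply hne
      refine ⟨t', hM, emb_sk (th1 n₀ n) t c h1 (fun q hq' => ?_) t' s1⟩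
      rw [hall q hq']; exact ⟨hpo, hgen⟩
    · have : ∃ x, eval (.node (!pc) l) x = !pc := by
        by_contra hcon
        push Not at hcon
        apply hgen
        funext x
        have := hcon x
        revert this
        cases eval (.node (!pc) l) x <;> cases pc <;> simp
      obtain ⟨x, hx⟩ := this
      rw [eval_node_iff] at hx
      classical
      let β : Fin n → Bool := fun i => if ∃ b', AT.leaf i b' ∈ l then x i else true
      have hconst : ∀ x', eval (.node (!pc) l) (th n₀ β x') = !pc := by
        intro x'
        rw [eval_node_iff]
        intro s hs
        have hxs := hx s hs
        cases s with
        | leaf i b =>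
          have hi : ¬ i.val < n₀ := fun hi => nA ⟨i, b, hs, hi⟩
          rw [leaf_th _ _ _ _ hi]
          simp only [eval] at hxs
          have : β i = x i := by simp only [β]; rw [if_pos ⟨b, hs⟩]
          rw [this]; exact hxs
        | node d l' =>
          obtain ⟨hd, _, _⟩ := (ok_node_iff _ _ _).1 (hch _ hs)
          simp at hd; subst hd
          rw [eval_node_not_iff]
          have : ∃ i b, AT.leaf i b ∈ l' ∧ ¬ i.val < n₀ ∧ b ≠ d ∧ ¬ ∃ b', AT.leaf i b' ∈ l := by
            by_contra hcon
            refine nB ⟨d, l', hs, fun i b hib => ?_⟩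
            by_contra hc2
            push Not at hc2
            exact hcon ⟨i, b, hib, by omega, hc2.2.1, by push Not; exact hc2.2.2⟩
          obtain ⟨i, b, e1, e2, e3, e4⟩ := this
          refine ⟨_, e1, ?_⟩
          rw [leaf_th _ _ _ _ e2]
          have : β i = true := by simp only [β]; rw [if_neg e4]
          rw [this]
          revert e3; cases b <;> cases d <;> simp
      refine hcontra β (fun q hq' => ?_) ⟨_, hp, hconst⟩
      rw [hall q hq']; exact ⟨_, hconst⟩

end
end S19

namespace S19
open AT Filter
open scoped ENNReal

theorem mark2 {α : Type*} (f : List α → ℝ≥0∞) (g : α → ℝ≥0∞) (k : List α → α → List α → ℝ≥0∞) (M : ℝ≥0∞)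
    (hf : ∀ l : List α, f l ≠ 0 → ∃ l1 a l2, l = l1 ++ a :: l2 ∧ f l ≤ pw g l1 * (k l1 a l2 * pw g l2))
    (hk : ∀ l1 l2, ∑' a, k l1 a l2 ≤ M) :
    ∑' l, f l ≤ (1 - ∑' a, g a)⁻¹ * (M * (1 - ∑' a, g a)⁻¹) := by
  refine (tsum_pw_mark f _ hf).trans ?_
  calc ∑' l1, ∑' a, ∑' l2, pw g l1 * (k l1 a l2 * pw g l2)
      = ∑' l1, pw g l1 * ∑' l2, (∑' a, k l1 a l2) * pw g l2 := by
        congr 1; ext l1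
        rw [ENNReal.tsum_comm, ← ENNReal.tsum_mul_left]
        congr 1; ext l2
        rw [ENNReal.tsum_mul_left, ENNReal.tsum_mul_right]
    _ ≤ ∑' l1, pw g l1 * ∑' l2, M * pw g l2 := by
        refine ENNReal.tsum_le_tsum (fun l1 => mul_le_mul' le_rfl (ENNReal.tsum_le_tsum (fun l2 => mul_le_mul' (hk _ _) le_rfl)))
    _ = _ := by
        simp only [ENNReal.tsum_mul_left, ENNReal.tsum_mul_right, tsum_pw]

open Classical in
/-- restrict leaves to a set of literals -/
noncomputable def rs {n : ℕ} (S : Fin n → Bool → Prop) (ω : AT n → ℝ≥0∞) (t : AT n) : ℝ≥0∞ :=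
  if (∀ i b, t = .leaf i b → S i b) then ω t else 0

section
variable {n : ℕ}

open Classical in
theorem leaf_mass (S : Fin n → Bool → Prop) (ω : AT n → ℝ≥0∞) (hω : Wt n ω) (c : Bool) (k : ℝ)
    (hk : ((Finset.univ.filter (fun p : Fin n × Bool => S p.1 p.2)).card : ℝ) ≤ k) :
    ∑' t, okw c (fun t => if ∃ i b, t = .leaf i b ∧ S i b then ω t else 0) t ≤ ENNReal.ofReal (k / (2 * n)) := by
  rw [tsum_okw]
  have h2 : (∑' l : List (AT n), if 2 ≤ l.length then (if ∀ t ∈ l, Ok (!c) t then (if ∃ i b, AT.node (!c) l = .leaf i b ∧ S i b then ω (.node (!c) l) else 0) else 0) else 0) = 0 := by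
    simp
  rw [h2, add_zero]
  calc _ ≤ ∑ p : Fin n × Bool, if S p.1 p.2 then ENNReal.ofReal (1 / (2 * n)) else 0 := by
        refine Finset.sum_le_sum (fun p _ => ?_)
        by_cases h : S p.1 p.2
        · rw [if_pos h]; split_ifs
          · exact hω.leaf _ _
          · simp
        · rw [if_neg h, if_neg]
          rintro ⟨i, b, h1, h2⟩
          simp only [AT.leaf.injEq] at h1
          exact h (by rw [h1.1, h1.2]; exact h2)
    _ = ((Finset.univ.filter (fun p : Fin n × Bool => S p.1 p.2)).card : ℝ≥0∞) * ENNReal.ofReal (1 / (2 * n)) := by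
        rw [← Finset.sum_filter]; simp
    _ ≤ _ := by
        rw [← ENNReal.ofReal_natCast, ← ENNReal.ofReal_mul (by positivity)]
        apply ENNReal.ofReal_le_ofReal
        rw [div_eq_mul_one_div k]
        gcongr

theorem rs_mass (S : Fin n → Bool → Prop) (ω : AT n → ℝ≥0∞) (hω : Wt n ω) (c : Bool) (k : ℝ) (hk0 : 0 ≤ k)
    (hk : ∀ F : Finset (Fin n × Bool), (∀ p ∈ F, S p.1 p.2) → (F.card : ℝ) ≤ k) :
    ∑' t, okw c (rs S ω) t ≤ ENNReal.ofReal (k / (2 * n) + 2 / qq n) := by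
  classical
  rw [ENNReal.ofReal_add (by positivity) (div_nonneg (by norm_num) (qq_nonneg n))]
  refine le_trans ?_ (add_le_add (leaf_mass S ω hω c k (hk _ (by simp))) (hω.int c))
  rw [← ENNReal.tsum_add]
  refine ENNReal.tsum_le_tsum (fun t => ?_)
  unfold okw
  by_cases h1 : Ok c t
  · rw [if_pos h1, if_pos h1, if_pos h1, rs]
    by_cases h2 : ∀ i b, t = .leaf i b → S i b
    · rw [if_pos h2]
      cases t with
      | node => simp [isLeafB]
      | leaf i b =>
        have : ∃ i' b', AT.leaf i b = .leaf i' b' ∧ S i' b' := ⟨i, b, rfl, h2 i b rfl⟩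
        beta_reduce
        rw [if_pos this]; simp
    · rw [if_neg h2]; simp
  · rw [if_neg h1]; simp

theorem list_mass (c : Bool) (w : AT n → ℝ≥0∞) (u : ℝ) (h0 : 0 ≤ u) (hu : u < 1)
    (h : ∑' t, okw c w t ≤ ENNReal.ofReal u) : ∑' l, pw (okw c w) l ≤ ENNReal.ofReal (1 - u)⁻¹ := by
  rw [tsum_pw]; exact ofReal_one_sub_inv _ u h0 hu h

theorem pw_rs (S : Fin n → Bool → Prop) (ω : AT n → ℝ≥0∞) (c : Bool) (l : List (AT n))
    (h : ∀ i b, AT.leaf i b ∈ l → S i b) : pw (okw c ω) l = pw (okw c (rs S ω)) l := by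
  apply le_antisymm <;> apply pw_mono <;> intro a ha <;> unfold okw <;> split_ifs <;> try exact le_rfl
  · rw [rs, if_pos]; rintro i b rfl; exact h i b ha
  · rw [rs]; split_ifs <;> simp

/-- the literal count -/
theorem lit_count (n₀ : ℕ) (c : Bool) (I : Finset (Fin n)) (F : Finset (Fin n × Bool))
    (h : ∀ p ∈ F, p.1.val < n₀ ∨ p.2 = c ∨ p.1 ∈ I) : (F.card : ℝ) ≤ n + n₀ + I.card := by
  classical
  have hsub : F ⊆ (Finset.univ.image (fun i : Fin n => (i, c))) ∪ ((Finset.univ.filter (fun i : Fin n => i.val < n₀)).image (fun i => (i, !c)))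
      ∪ I.image (fun i => (i, !c)) := by
    rintro ⟨i, b⟩ hp
    have := h _ hp
    simp only [Finset.mem_union, Finset.mem_image, Finset.mem_univ, true_and, Finset.mem_filter, Prod.mk.injEq] at *
    by_cases hb : b = c
    · left; left; exact ⟨i, rfl, hb.symm⟩
    · have hb' : (!c) = b := by revert hb; cases b <;> cases c <;> simp
      rcases this with h | h | h
      · left; right; exact ⟨i, h, rfl, hb'⟩
      · exact absurd h hb
      · right; exact ⟨i, h, rfl, hb'⟩
  have h1 := Finset.card_le_card hsub
  have h2 := Finset.card_union_le ((Finset.univ.image (fun i : Fin n => (i, c))) ∪ ((Finset.univ.filter (fun i : Fin n => i.val < n₀)).image (fun i => (i, !c)))) (I.image (fun i => (i, !c)))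
  have h3 := Finset.card_union_le (Finset.univ.image (fun i : Fin n => (i, c))) ((Finset.univ.filter (fun i : Fin n => i.val < n₀)).image (fun i => (i, !c)))
  have h4 : (Finset.univ.image (fun i : Fin n => (i, c))).card ≤ n := Finset.card_image_le.trans (by simp)
  have h5 : ((Finset.univ.filter (fun i : Fin n => i.val < n₀)).image (fun i => (i, !c))).card ≤ n₀ := by
    refine Finset.card_image_le.trans ?_
    rw [← Finset.card_image_of_injective _ Fin.val_injective]
    refine (Finset.card_le_card (t := Finset.range n₀) ?_).trans (by simp)
    intro j hj
    simp only [Finset.mem_image, Finset.mem_filter, Finset.mem_univ, true_and] at hj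
    obtain ⟨i, hi, rfl⟩ := hj
    simpa using hi
  have h6 : (I.image (fun i => (i, !c))).card ≤ I.card := Finset.card_image_le
  have : F.card ≤ n + n₀ + I.card := by omega
  exact_mod_cast this

end
end S19

namespace S19
open AT Filter
open scoped ENNReal

section
variable {n : ℕ}

theorem qq_big (hn : 2048 ≤ n) : 64 ≤ qq n := by
  have h1 := qq_sq n
  have h2 := qq_nonneg n
  have : (2048:ℝ) ≤ n := by exact_mod_cast hn
  nlinarith

theorem rs34 (n₀ : ℕ) (hn : 16 * n₀ + 2048 ≤ n) (S : Fin n → Bool → Prop) (ω : AT n → ℝ≥0∞) (hω : Wt n ω) (c d : Bool)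
    (I : Finset (Fin n)) (hI : 4 * I.card ≤ n) (hS : ∀ i b, S i b → i.val < n₀ ∨ b = d ∨ i ∈ I) :
    ∑' t, okw c (rs S ω) t ≤ ENNReal.ofReal (3 / 4) := by
  have hq : 64 ≤ qq n := qq_big (by omega)
  have hn' : 16 * (n₀:ℝ) + 2048 ≤ n := by exact_mod_cast hn
  have hI' : 4 * (I.card:ℝ) ≤ n := by exact_mod_cast hI
  have h0 : (0:ℝ) ≤ n₀ := by positivity
  refine (rs_mass S ω hω c (n + n₀ + I.card) (by positivity) (fun F hF => lit_count n₀ d I F (fun p hp => hS _ _ (hF p hp)))).trans ?_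
  apply ENNReal.ofReal_le_ofReal
  have h1 : 2 / qq n ≤ 1 / 32 := by rw [div_le_div_iff₀ (by linarith) (by norm_num)]; linarith
  have h2 : ((n:ℝ) + n₀ + I.card) / (2 * n) ≤ 11 / 16 := by
    rw [div_le_div_iff₀ (by linarith) (by norm_num)]; linarith
  linarith

theorem l4 (c : Bool) (w : AT n → ℝ≥0∞) (h : ∑' t, okw c w t ≤ ENNReal.ofReal (3 / 4)) :
    (1 - ∑' t, okw c w t)⁻¹ ≤ ENNReal.ofReal 4 := by
  refine (ofReal_one_sub_inv _ (3 / 4) (by norm_num) (by norm_num) h).trans ?_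
  apply ENNReal.ofReal_le_ofReal; norm_num

theorem T_le (hn : 1 ≤ n) (ω : AT n → ℝ≥0∞) (hω : Wt n ω) (c : Bool) :
    (1 - ∑' t, okw c ω t)⁻¹ ≤ ENNReal.ofReal (2 * (1 + qq n)) := by
  have hq := qq_gt n hn
  have h1 : 1 / (2 * (1 + qq n)) ≤ 1 := by rw [div_le_one (by linarith)]; linarith
  have h2 : 0 < 1 / (2 * (1 + qq n)) := by positivity
  refine (ofReal_one_sub_inv _ _ (by linarith) (by linarith) (hω.tot c)).trans ?_
  apply ENNReal.ofReal_le_ofReal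
  simp

theorem TMT (hn : 1 ≤ n) (ω : AT n → ℝ≥0∞) (hω : Wt n ω) (c : Bool) (M : ℝ) (hM : 0 ≤ M) :
    (1 - ∑' t, okw c ω t)⁻¹ * (ENNReal.ofReal M * (1 - ∑' t, okw c ω t)⁻¹) ≤ ENNReal.ofReal (32 * n * M) := by
  have hT := T_le hn ω hω c
  have hq := qq_gt n hn
  refine (mul_le_mul' hT (mul_le_mul' le_rfl hT)).trans ?_
  rw [← ENNReal.ofReal_mul hM, ← ENNReal.ofReal_mul (by linarith)]
  apply ENNReal.ofReal_le_ofReal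
  have h2 := qq_sq n
  have : 2 * (1 + qq n) * (2 * (1 + qq n)) ≤ 32 * n := by nlinarith
  nlinarith

open Classical in
theorem sumA (n₀ : ℕ) (hn : 1 ≤ n) (ω : AT n → ℝ≥0∞) (hω : Wt n ω) (c : Bool) :
    ∑' l, (if BadA n₀ l then pw (okw c ω) l else 0) ≤ ENNReal.ofReal (32 * n₀) := by
  have hn' : (1:ℝ) ≤ n := by exact_mod_cast hn
  have hcard : ((Finset.univ.filter (fun p : Fin n × Bool => p.1.val < n₀)).card : ℝ) ≤ 2 * n₀ := by
    have h0 := Finset.card_le_card (s := Finset.univ.filter (fun p : Fin n × Bool => p.1.val < n₀))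
      (t := (Finset.univ.filter (fun i : Fin n => i.val < n₀)) ×ˢ Finset.univ) (by intro p; simp)
    have h1 : (Finset.univ.filter (fun i : Fin n => i.val < n₀)).card ≤ n₀ := by
      rw [← Finset.card_image_of_injective _ Fin.val_injective]
      refine (Finset.card_le_card (t := Finset.range n₀) ?_).trans (by simp)
      intro j hj
      simp only [Finset.mem_image, Finset.mem_filter, Finset.mem_univ, true_and] at hj
      obtain ⟨i, hi, rfl⟩ := hj
      simpa using hi
    rw [Finset.card_product] at h0
    simp at h0
    have : (Finset.univ.filter (fun p : Fin n × Bool => p.1.val < n₀)).card ≤ 2 * n₀ := by omega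
    exact_mod_cast this
  obtain ⟨S, hSd⟩ : ∃ S : Fin n → Bool → Prop, S = fun i _ => i.val < n₀ := ⟨_, rfl⟩
  have hm := leaf_mass S ω hω c (2 * n₀) (by subst hSd; convert hcard)
  have := mark2 (fun l => if BadA n₀ l then pw (okw c ω) l else 0) (okw c ω)
    (fun _ a _ => okw c (fun t => if ∃ i b, t = .leaf i b ∧ S i b then ω t else 0) a) _ (fun l hl => ?_) (fun _ _ => hm)
  · refine this.trans ((TMT hn ω hω c _ (by positivity)).trans ?_)
    apply ENNReal.ofReal_le_ofReal
    rw [show 32 * (n:ℝ) * (2 * n₀ / (2 * n)) = 32 * n₀ by field_simp]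
  · have hA : BadA n₀ l := by by_contra h; simp [h] at hl
    obtain ⟨i, b, h1, h2⟩ := hA
    obtain ⟨l1, l2, rfl⟩ := List.append_of_mem h1
    refine ⟨l1, _, l2, rfl, ?_⟩
    split_ifs
    · rw [pw_append, pw_cons]
      refine mul_le_mul' le_rfl (mul_le_mul' ?_ le_rfl)
      unfold okw
      beta_reduce
      have h4 : ∃ i' b', AT.leaf i b = .leaf i' b' ∧ S i' b' := ⟨i, b, rfl, by rw [hSd]; exact h2⟩
      rw [if_pos h4]
    · simp

theorem sumB1 (hn : 1 ≤ n) (ω : AT n → ℝ≥0∞) (hω : Wt n ω) (c : Bool) :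
    ∑' l, (if n / 4 + 1 ≤ l.length then pw (okw c ω) l else 0) ≤ ENNReal.ofReal 128 := by
  have hn' : (1:ℝ) ≤ n := by exact_mod_cast hn
  rw [tsum_pw_len_ge, ENNReal.tsum_geometric]
  refine (mul_le_mul' (pow_le_pow_left' (hω.tot c) _) (T_le hn ω hω c)).trans ?_
  have hq := qq_gt n hn
  have h2 := qq_sq n
  set q := qq n
  set τ := 1 / (2 * (1 + q)) with hτ
  have hτ0 : 0 < τ := by positivity
  have hτ1 : τ ≤ 1 := by rw [hτ, div_le_one (by linarith)]; linarith
  rw [← ENNReal.ofReal_pow (by linarith), ← ENNReal.ofReal_mul (by positivity)]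
  apply ENNReal.ofReal_le_ofReal
  have hK : (n:ℝ) / 4 ≤ ((n / 4 + 1 : ℕ) : ℝ) := by
    have : n ≤ 4 * (n / 4 + 1) := by omega
    have : (n:ℝ) ≤ 4 * ((n / 4 + 1 : ℕ) : ℝ) := by exact_mod_cast this
    linarith
  set K := n / 4 + 1
  have hb : 1 + K * τ ≤ (1 + τ) ^ K := one_add_mul_le_pow (by linarith) K
  have hp : (1 - τ) ^ K * (1 + τ) ^ K ≤ 1 := by
    rw [← mul_pow]; apply pow_le_one₀ <;> nlinarith
  have hx : 0 ≤ (1 - τ) ^ K := by apply pow_nonneg; linarith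
  set X := (1 - τ) ^ K
  have h3 : X * (n / 4 * τ) ≤ 1 := by
    have : n / 4 * τ ≤ (1 + τ) ^ K := by nlinarith
    nlinarith
  have h4 : τ * (2 * (1 + q)) = 1 := by rw [hτ]; field_simp
  have h5 : X * (n / 4) ≤ 2 * (1 + q) := by
    calc X * (n / 4) = X * (n / 4 * τ) * (2 * (1 + q)) := by linear_combination (-(X * (n / 4))) * h4
      _ ≤ 1 * (2 * (1 + q)) := by gcongr
      _ = _ := one_mul _
  have h6 : 2 * (1 + q) * (2 * (1 + q)) ≤ 32 * n := by nlinarith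
  have h7 : X * (2 * (1 + q)) * n ≤ 128 * n := by nlinarith
  exact le_of_mul_le_mul_right h7 (by linarith)

/-- the variables of the leaves in a list -/
def leafVars (l : List (AT n)) : Finset (Fin n) :=
  (l.filterMap (fun t => match t with | .leaf i _ => some i | .node _ _ => none)).toFinset

theorem mem_leafVars {l : List (AT n)} {i : Fin n} : i ∈ leafVars l ↔ ∃ b, AT.leaf i b ∈ l := by
  simp only [leafVars, List.mem_toFinset, List.mem_filterMap]
  constructor
  · rintro ⟨t, ht, h⟩
    cases t with
    | leaf j b => simp at h; subst h; exact ⟨b, ht⟩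
    | node => simp at h
  · rintro ⟨b, h⟩; exact ⟨_, h, rfl⟩

theorem card_leafVars (l : List (AT n)) : (leafVars l).card ≤ l.length :=
  (List.toFinset_card_le _).trans (List.length_filterMap_le _ _)

open Classical in
theorem sumB2 (n₀ : ℕ) (hn : 16 * n₀ + 2048 ≤ n) (ω : AT n → ℝ≥0∞) (hω : Wt n ω) (c : Bool) :
    ∑' l, (if BadB n₀ c l ∧ l.length ≤ n / 4 then pw (okw (!c) ω) l else 0) ≤ ENNReal.ofReal 64 := by
  have hn' : (1:ℝ) ≤ n := by exact_mod_cast (by omega : 1 ≤ n)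
  let S : List (AT n) → Fin n → Bool → Prop := fun L i b => i.val < n₀ ∨ b = c ∨ i ∈ leafVars L
  have := mark2 (fun l => if BadB n₀ c l ∧ l.length ≤ n / 4 then pw (okw (!c) ω) l else 0) (okw (!c) ω)
    (fun l1 a l2 => if (l1 ++ l2).length ≤ n / 4 then okw (!c) (fun t => if isLeafB t = false ∧ ∀ i b, AT.leaf i b ∈ rootChildren t → S (l1 ++ l2) i b then ω t else 0) a else 0)
    (ENNReal.ofReal (1 / (2 * n)) * ENNReal.ofReal 4) (fun l hl => ?_) (fun l1 l2 => ?_)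
  · rw [← ENNReal.ofReal_mul (by positivity)] at this
    refine this.trans ((TMT (by omega) ω hω _ _ (by positivity)).trans ?_)
    apply ENNReal.ofReal_le_ofReal
    apply le_of_eq; field_simp; norm_num
  · have hA : BadB n₀ c l ∧ l.length ≤ n / 4 := by by_contra h; simp [h] at hl
    have hA2 := hA
    obtain ⟨⟨d, l', h1, h2⟩, hlen⟩ := hA
    obtain ⟨l1, l2, rfl⟩ := List.append_of_mem h1
    refine ⟨l1, _, l2, rfl, ?_⟩
    have hlen2 : (l1 ++ l2).length ≤ n / 4 := by simp at hlen ⊢; omega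
    have hS : ∀ i b, AT.leaf i b ∈ l' → S (l1 ++ l2) i b := by
      intro i b hib
      rcases h2 i b hib with h | h | ⟨b', h⟩
      · exact Or.inl h
      · exact Or.inr (Or.inl h)
      · refine Or.inr (Or.inr (mem_leafVars.2 ⟨b', ?_⟩))
        simpa using h
    beta_reduce
    rw [if_pos hA2, if_pos hlen2, pw_append, pw_cons]
    refine mul_le_mul' le_rfl (mul_le_mul' ?_ le_rfl)
    unfold okw
    beta_reduce
    have h4 : isLeafB (AT.node d l') = false ∧ ∀ i b, AT.leaf i b ∈ rootChildren (AT.node d l') → S (l1 ++ l2) i b := ⟨rfl, hS⟩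
    rw [if_pos h4]
  · by_cases hlen : (l1 ++ l2).length ≤ n / 4
    · simp only [hlen, if_true]
      rw [tsum_okw]
      have h0 : ∀ p : Fin n × Bool, (if isLeafB (AT.leaf p.1 p.2) = false ∧ ∀ i b, AT.leaf i b ∈ rootChildren (AT.leaf p.1 p.2) → S (l1 ++ l2) i b then ω (.leaf p.1 p.2) else 0) = 0 := by
        intro p; rw [if_neg]; simp [isLeafB]
      simp only [h0, Finset.sum_const_zero, zero_add]
      have h34 := rs34 n₀ hn (S (l1 ++ l2)) ω hω (!!c) c (leafVars (l1 ++ l2)) (by have := card_leafVars (l1 ++ l2); omega) (fun i b h => h)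
      refine le_trans ?_ (mul_le_mul' le_rfl (l4 _ _ h34))
      rw [← tsum_pw, ← ENNReal.tsum_mul_left]
      refine ENNReal.tsum_le_tsum (fun l' => ?_)
      split_ifs with g1 g2 g3
      · refine (hω.node _ _).trans (mul_le_mul' le_rfl ?_)
        have g4 : ∀ i b, AT.leaf i b ∈ l' → S (l1 ++ l2) i b := g3.2
        rw [← pw_rs _ _ _ _ g4, pw_okw, if_pos g2]
      all_goals simp
    · simp only [hlen, if_false, tsum_zero]; exact bot_le

open Classical in
theorem sumC1 (n₀ : ℕ) (hn : 16 * n₀ + 2048 ≤ n) (ω : AT n → ℝ≥0∞) (hω : Wt n ω) (c : Bool) :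
    ∑' l, (if (∀ i b, AT.leaf i b ∈ l → i.val < n₀ ∨ b = !c) then pw (okw (!c) ω) l else 0) ≤ ENNReal.ofReal 4 := by
  have h34 := rs34 n₀ hn (fun i b => i.val < n₀ ∨ b = !c) ω hω (!c) (!c) ∅ (by simp) (fun i b h => by tauto)
  refine le_trans ?_ (l4 _ _ h34)
  rw [← tsum_pw]
  refine ENNReal.tsum_le_tsum (fun l' => ?_)
  split_ifs with g1
  · rw [← pw_rs _ _ _ _ g1]
  · simp

open Classical in
theorem sumC2 (n₀ : ℕ) (hn : 16 * n₀ + 2048 ≤ n) (ω : AT n → ℝ≥0∞) (hω : Wt n ω) (c : Bool) (i₀ : Fin n) :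
    ∑' l, (if (AT.leaf i₀ c ∈ l ∧ ∀ i b, AT.leaf i b ∈ l → i.val < n₀ ∨ b = !c ∨ i = i₀) then pw (okw (!c) ω) l else 0) ≤ ENNReal.ofReal (8 / n) := by
  have hn' : (1:ℝ) ≤ n := by exact_mod_cast (by omega : 1 ≤ n)
  let S : Fin n → Bool → Prop := fun i b => i.val < n₀ ∨ b = !c ∨ i = i₀
  have h34 := rs34 n₀ hn S ω hω (!c) (!c) {i₀} (by simp; omega) (fun i b h => by simpa [S] using h)
  have := mark2 (fun l => if (AT.leaf i₀ c ∈ l ∧ ∀ i b, AT.leaf i b ∈ l → i.val < n₀ ∨ b = !c ∨ i = i₀) then pw (okw (!c) ω) l else 0) (okw (!c) (rs S ω))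
    (fun l1 a l2 => if a = AT.leaf i₀ c then ENNReal.ofReal (1 / (2 * n)) else 0)
    (ENNReal.ofReal (1 / (2 * n))) (fun l hl => ?_) (fun l1 l2 => ?_)
  · refine this.trans ((mul_le_mul' (l4 _ _ h34) (mul_le_mul' le_rfl (l4 _ _ h34))).trans ?_)
    rw [← ENNReal.ofReal_mul (by positivity), ← ENNReal.ofReal_mul (by positivity)]
    apply ENNReal.ofReal_le_ofReal
    apply le_of_eq; field_simp; norm_num
  · have hA : (AT.leaf i₀ c ∈ l ∧ ∀ i b, AT.leaf i b ∈ l → i.val < n₀ ∨ b = !c ∨ i = i₀) := by by_contra h; exact hl (if_neg h)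
    have h1 := hA.1
    obtain ⟨l1, l2, rfl⟩ := List.append_of_mem h1
    refine ⟨l1, _, l2, rfl, ?_⟩
    rw [if_pos hA, if_pos rfl, pw_append, pw_cons]
    refine mul_le_mul' ?_ (mul_le_mul' ?_ ?_)
    · rw [← pw_rs S ω _ l1 (fun i b h => hA.2 i b (by simp [h]))]
    · unfold okw; split_ifs
      · exact hω.leaf _ _
      · simp
    · rw [← pw_rs S ω _ l2 (fun i b h => hA.2 i b (by simp [h]))]
  · rw [tsum_ite_eq]

open Classical in
theorem sumBad (n₀ : ℕ) (hn : 16 * n₀ + 2048 ≤ n) (ω : AT n → ℝ≥0∞) (hω : Wt n ω) (c : Bool) :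
    ∑' t, okw c (fun t => if Bad n₀ c t then ω t else 0) t ≤ ENNReal.ofReal ((16 * n₀ + 104) / n) := by
  have hn' : (1:ℝ) ≤ n := by exact_mod_cast (by omega : 1 ≤ n)
  rw [tsum_okw]
  have h0 : ∀ p : Fin n × Bool, (if Bad n₀ c (AT.leaf p.1 p.2) then ω (.leaf p.1 p.2) else 0) = 0 := by
    intro p; rw [if_neg]; simp [Bad, isLeafB]
  simp only [h0, Finset.sum_const_zero, zero_add]
  have hC2 : ∑' l, (∑ i₀ : Fin n, if (AT.leaf i₀ c ∈ l ∧ ∀ i b, AT.leaf i b ∈ l → i.val < n₀ ∨ b = !c ∨ i = i₀) then pw (okw (!c) ω) l else 0) ≤ ENNReal.ofReal 8 := by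
    rw [Summable.tsum_finsetSum (fun _ _ => ENNReal.summable)]
    refine (Finset.sum_le_sum (fun i₀ _ => sumC2 n₀ hn ω hω c i₀)).trans ?_
    simp only [Finset.sum_const, Finset.card_univ, Fintype.card_fin, nsmul_eq_mul]
    rw [← ENNReal.ofReal_natCast, ← ENNReal.ofReal_mul (by positivity)]
    apply ENNReal.ofReal_le_ofReal
    apply le_of_eq; field_simp
  have hsum := add_le_add (add_le_add (add_le_add (add_le_add (sumA n₀ (by omega) ω hω (!c)) (sumB1 (by omega) ω hω (!c))) (sumB2 n₀ hn ω hω c)) (sumC1 n₀ hn ω hω c)) hC2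
  simp only [← ENNReal.tsum_add] at hsum
  rw [← ENNReal.ofReal_add (by positivity) (by positivity), ← ENNReal.ofReal_add (by positivity) (by positivity), ← ENNReal.ofReal_add (by positivity) (by positivity), ← ENNReal.ofReal_add (by positivity) (by positivity)] at hsum
  have hfin := mul_le_mul' (le_refl (ENNReal.ofReal (1 / (2 * n)))) hsum
  rw [← ENNReal.ofReal_mul (by positivity), ← ENNReal.tsum_mul_left] at hfin
  refine (ENNReal.tsum_le_tsum (fun l => ?_)).trans (hfin.trans (ENNReal.ofReal_le_ofReal ?_))
  · by_cases g123 : 2 ≤ l.length ∧ (∀ t ∈ l, Ok (!c) t) ∧ Bad n₀ c (.node (!c) l)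
    · obtain ⟨g1, g2, g3⟩ := g123
      rw [if_pos g1, if_pos g2, if_pos g3]
      refine (hω.node _ _).trans (mul_le_mul' le_rfl ?_)
      have e : pw ω l = pw (okw (!c) ω) l := by rw [pw_okw, if_pos g2]
      rw [e]
      obtain ⟨_, hA | hB | hC⟩ := g3
      · simp only [rootChildren] at hA
        rw [if_pos hA]
        rw [add_assoc, add_assoc, add_assoc]; exact le_self_add
      · simp only [rootChildren] at hB
        by_cases hlen : n / 4 + 1 ≤ l.length
        · rw [if_pos hlen]
          refine le_trans ?_ (le_add_right (le_add_right (le_add_right le_rfl)))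
          exact le_add_self
        · rw [if_pos (⟨hB, by omega⟩ : BadB n₀ c l ∧ l.length ≤ n / 4)]
          refine le_trans ?_ (le_add_right (le_add_right le_rfl))
          exact le_add_self
      · simp only [rootChildren] at hC
        obtain ⟨i₀, hi₀⟩ := hC
        by_cases hm : AT.leaf i₀ c ∈ l
        · refine le_trans ?_ le_add_self
          refine le_trans ?_ (Finset.single_le_sum (fun _ _ => zero_le) (Finset.mem_univ i₀))
          rw [if_pos ⟨hm, hi₀⟩]
        · have : ∀ i b, AT.leaf i b ∈ l → i.val < n₀ ∨ b = !c := by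
            intro i b hib
            rcases hi₀ i b hib with h | h | h
            · exact Or.inl h
            · exact Or.inr h
            · subst h
              right
              have : b ≠ c := by rintro rfl; exact hm hib
              revert this; cases b <;> cases c <;> simp
          rw [if_pos this]
          refine le_trans ?_ (le_add_right le_rfl)
          exact le_add_self
    · refine le_of_eq_of_le ?_ bot_le
      split_ifs with g1 g2 g3
      · exact absurd ⟨g1, g2, g3⟩ g123
      all_goals rfl
  · rw [div_mul_eq_mul_div, div_le_div_iff₀ (by linarith) (by linarith)]
    nlinarith

end
end S19

namespace S19
open AT Filter
open scoped ENNReal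

section
variable {n : ℕ}

/-- weight of skeleton nodes and removed subtrees -/
noncomputable def ZZ (θ : (Fin n → Bool) → (Fin n → Bool)) (Y : ℝ≥0∞) (v : Bool → AT n → ℝ≥0∞) (c : Bool) (t : AT n) : ℝ≥0∞ :=
  Y ^ mm θ t * pw (fun p : Bool × AT n => v p.1 p.2) (hg θ c t)

theorem ZZ_cst (θ : (Fin n → Bool) → (Fin n → Bool)) (Y : ℝ≥0∞) (v : Bool → AT n → ℝ≥0∞) (c : Bool) (t : AT n)
    (h : Cst θ t) : ZZ θ Y v c t = v c t := by
  rw [ZZ, mm_cst θ h, hg_cst θ c h]; simp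

theorem ZZ_leaf (θ : (Fin n → Bool) → (Fin n → Bool)) (Y : ℝ≥0∞) (v : Bool → AT n → ℝ≥0∞) (c : Bool) (i : Fin n) (b : Bool)
    (h : ¬ Cst θ (.leaf i b)) : ZZ θ Y v c (.leaf i b) = Y := by
  rw [ZZ, mm, sk_leaf θ h, hg_leaf θ c h]; simp [sizeList, size]

theorem ZZ_node (θ : (Fin n → Bool) → (Fin n → Bool)) (Y : ℝ≥0∞) (v : Bool → AT n → ℝ≥0∞) (c d : Bool) (l : List (AT n))
    (h : ¬ Cst θ (.node d l)) : ZZ θ Y v c (.node d l) = Y * pw (ZZ θ Y v d) l := by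
  have : ∀ l : List (AT n), Y ^ sizeList (skL θ l) * pw (fun p : Bool × AT n => v p.1 p.2) (hgL θ d l) = pw (ZZ θ Y v d) l := by
    intro l
    induction l with
    | nil => simp [skL, hgL, sizeList]
    | cons a l ih =>
      rw [pw_cons, ← ih, skL, hgL, sizeList_append, pw_append, ZZ, mm, pow_add]
      ring
  rw [ZZ, mm, sk_node θ h, hg_node θ c h, ← this]
  simp only [sizeList, size, add_zero, pow_add, pow_one]
  ring

noncomputable def del (n₀ : ℕ) : ℝ := 1 / (16 * (16 * n₀ + 106))
noncomputable def del' (n₀ : ℕ) : ℝ := 1 / (8 * (n₀ + 2))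

theorem del_pos (n₀ : ℕ) : 0 < del n₀ := by unfold del; positivity
theorem del'_pos (n₀ : ℕ) : 0 < del' n₀ := by unfold del'; positivity

open Classical in
noncomputable def vv (n₀ : ℕ) (c : Bool) (t : AT n) : ℝ≥0∞ :=
  if isLeafB t then ENNReal.ofReal (9 / 8) else if Bad n₀ c t then ENNReal.ofReal (del n₀ * n) else ENNReal.ofReal (del n₀ * qq n)

open Classical in
theorem H_le (n₀ : ℕ) (hn : 16 * n₀ + 2048 ≤ n) (ω : AT n → ℝ≥0∞) (hω : Wt n ω) (c : Bool) :
    ∑' t, okw c (fun t => if (∀ x, eval t (th1 n₀ n x) = c) then ω t * vv n₀ c t else 0) t ≤ ENNReal.ofReal (5 / 8) := by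
  have hn' : (1:ℝ) ≤ n := by exact_mod_cast (by omega : 1 ≤ n)
  have hδ := del_pos n₀
  have hq := qq_gt n (by omega)
  obtain ⟨S, hSd⟩ : ∃ S : Fin n → Bool → Prop, S = fun _ b => b = c := ⟨_, rfl⟩
  have hcard := lit_count 0 c ∅ (Finset.univ.filter (fun p : Fin n × Bool => S p.1 p.2)) (by subst hSd; intro p hp; simp at hp; simp [hp])
  simp only [Nat.cast_zero, add_zero, Finset.card_empty] at hcard
  have hm := leaf_mass S ω hω c n hcard
  have h1 := mul_le_mul' hm (le_refl (ENNReal.ofReal (9 / 8)))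
  have h2 := mul_le_mul' (sumBad n₀ hn ω hω c) (le_refl (ENNReal.ofReal (del n₀ * n)))
  have h3 := mul_le_mul' (hω.int c) (le_refl (ENNReal.ofReal (del n₀ * qq n)))
  have hs := add_le_add (add_le_add h1 h2) h3
  simp only [← ENNReal.tsum_mul_right] at hs
  simp only [← ENNReal.tsum_add] at hs
  rw [← ENNReal.ofReal_mul (by positivity), ← ENNReal.ofReal_mul (by positivity), ← ENNReal.ofReal_mul (by positivity),
    ← ENNReal.ofReal_add (by positivity) (by positivity), ← ENNReal.ofReal_add (by positivity) (by positivity)] at hs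
  refine (ENNReal.tsum_le_tsum (fun t => ?_)).trans (hs.trans (ENNReal.ofReal_le_ofReal ?_))
  · unfold okw
    by_cases ho : Ok c t
    swap
    · rw [if_neg ho]; exact bot_le
    simp only [if_pos ho]
    by_cases hv : ∀ x, eval t (th1 n₀ n x) = c
    swap
    · rw [if_neg hv]; exact bot_le
    rw [if_pos hv]
    cases t with
    | leaf i b =>
      have hb := (leaf_val i b c hv).2
      have h4 : ∃ i' b', AT.leaf i b = .leaf i' b' ∧ S i' b' := ⟨i, b, rfl, by rw [hSd]; exact hb⟩
      have hl : isLeafB (AT.leaf i b) = true := rfl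
      rw [if_pos h4, vv, if_pos hl, add_assoc]
      exact le_self_add
    | node d l =>
      rw [vv, if_neg (by simp [isLeafB])]
      by_cases hB : Bad n₀ c (.node d l)
      · rw [if_pos hB, if_pos hB]
        exact le_add_right le_add_self
      · rw [if_neg hB, if_neg (by simp [isLeafB] : ¬ isLeafB (AT.node d l) = true)]
        exact le_add_self
  · have e1 : (n:ℝ) / (2 * n) * (9 / 8) = 9 / 16 := by field_simp; norm_num
    have e2 : (16 * (n₀:ℝ) + 104) / n * (del n₀ * n) = (16 * n₀ + 104) * del n₀ := by field_simp
    have e3 : 2 / qq n * (del n₀ * qq n) = 2 * del n₀ := by field_simp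
    rw [e1, e2, e3]
    have : (16 * (n₀:ℝ) + 106) * del n₀ = 1 / 16 := by unfold del; field_simp
    linarith

theorem ess_card (n₀ : ℕ) (F : Finset (Fin n × Bool)) (hF : ∀ p ∈ F, p.1.val < n₀) : (F.card : ℝ) ≤ 2 * n₀ := by
  classical
  have h0 := Finset.card_le_card (s := F)
    (t := (Finset.univ.filter (fun i : Fin n => i.val < n₀)) ×ˢ Finset.univ) (by intro p hp; simpa using hF p hp)
  have h1 : (Finset.univ.filter (fun i : Fin n => i.val < n₀)).card ≤ n₀ := by
    rw [← Finset.card_image_of_injective _ Fin.val_injective]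
    refine (Finset.card_le_card (t := Finset.range n₀) ?_).trans (by simp)
    intro j hj
    simp only [Finset.mem_image, Finset.mem_filter, Finset.mem_univ, true_and] at hj
    obtain ⟨i, hi, rfl⟩ := hj
    simpa using hi
  rw [Finset.card_product] at h0
  simp at h0
  have : F.card ≤ 2 * n₀ := by omega
  exact_mod_cast this

open Classical in
theorem X_le (n₀ : ℕ) (hn : 16 * n₀ + 2048 ≤ n) (ω : AT n → ℝ≥0∞) (hω : Wt n ω) (N : ℕ) : ∀ c,
    ∑' t, okw c (fun t => if size t ≤ N ∧ ¬ Cst (th1 n₀ n) t then ω t * ZZ (th1 n₀ n) (ENNReal.ofReal (del' n₀ * n)) (vv n₀) c t else 0) t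
      ≤ ENNReal.ofReal (1 / 8) := by
  have hn' : (1:ℝ) ≤ n := by exact_mod_cast (by omega : 1 ≤ n)
  have hδ := del'_pos n₀
  induction N with
  | zero =>
    intro c
    refine le_of_eq_of_le ?_ bot_le
    rw [ENNReal.bot_eq_zero, ENNReal.tsum_eq_zero]
    intro t
    unfold okw
    beta_reduce
    have := size_pos t
    rw [if_neg (fun h => by omega : ¬ (size t ≤ 0 ∧ ¬ Cst (th1 n₀ n) t))]; simp
  | succ N ih =>
    intro c
    set Y := ENNReal.ofReal (del' n₀ * n) with hY
    set Z := ZZ (th1 n₀ n) Y (vv n₀) with hZ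
    rw [tsum_okw]
    have hleaf : ∑ p : Fin n × Bool, (if size (AT.leaf p.1 p.2) ≤ N + 1 ∧ ¬ Cst (th1 n₀ n) (AT.leaf p.1 p.2) then ω (AT.leaf p.1 p.2) * Z c (AT.leaf p.1 p.2) else 0)
        ≤ ENNReal.ofReal (2 * n₀) * (ENNReal.ofReal (1 / (2 * n)) * Y) := by
      calc _ ≤ ∑ p : Fin n × Bool, if p.1.val < n₀ then (ENNReal.ofReal (1 / (2 * n)) * Y) else 0 := by
            refine Finset.sum_le_sum (fun p _ => ?_)
            by_cases hc : Cst (th1 n₀ n) (AT.leaf p.1 p.2)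
            · rw [if_neg (fun h => h.2 hc)]; exact bot_le
            · have hi : p.1.val < n₀ := by
                by_contra hi; exact hc ((leaf_cst_iff _ _ _).2 hi)
              rw [if_pos hi]
              split_ifs
              · rw [hZ, ZZ_leaf _ _ _ _ _ _ hc]; exact mul_le_mul' (hω.leaf _ _) le_rfl
              · exact bot_le
        _ = ((Finset.univ.filter (fun p : Fin n × Bool => p.1.val < n₀)).card : ℝ≥0∞) * (ENNReal.ofReal (1 / (2 * n)) * Y) := by
            rw [← Finset.sum_filter]; simp
        _ ≤ _ := by
            refine mul_le_mul' ?_ le_rfl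
            rw [← ENNReal.ofReal_natCast]
            exact ENNReal.ofReal_le_ofReal (ess_card n₀ _ (by simp))
    let G : AT n → ℝ≥0∞ := fun t => (if size t ≤ N ∧ ¬ Cst (th1 n₀ n) t then ω t * Z (!c) t else 0) +
      (if (∀ x, eval t (th1 n₀ n x) = !c) then ω t * vv n₀ (!c) t else 0)
    have hG : ∑' t, okw (!c) G t ≤ ENNReal.ofReal (3 / 4) := by
      have : ENNReal.ofReal (3 / 4) = ENNReal.ofReal (1 / 8) + ENNReal.ofReal (5 / 8) := by
        rw [← ENNReal.ofReal_add (by norm_num) (by norm_num)]; norm_num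
      rw [this]
      refine le_trans (le_of_eq ?_) (add_le_add (ih (!c)) (H_le n₀ hn ω hω (!c)))
      rw [← ENNReal.tsum_add]
      congr 1; ext t
      unfold okw
      split_ifs <;> simp_all [G]
    have hnode : (∑' l : List (AT n), if 2 ≤ l.length then (if ∀ t ∈ l, Ok (!c) t then (if size (AT.node (!c) l) ≤ N + 1 ∧ ¬ Cst (th1 n₀ n) (AT.node (!c) l) then ω (AT.node (!c) l) * Z c (AT.node (!c) l) else 0) else 0) else 0)
        ≤ (ENNReal.ofReal (1 / (2 * n)) * Y) * ENNReal.ofReal 4 := by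
      refine le_trans ?_ (mul_le_mul' le_rfl (l4 _ _ hG))
      rw [← tsum_pw, ← ENNReal.tsum_mul_left]
      refine ENNReal.tsum_le_tsum (fun l => ?_)
      split_ifs with g1 g2 g3
      · rw [hZ, ZZ_node _ _ _ _ _ _ g3.2, ← hZ]
        have : pw ω l * pw (Z (!c)) l ≤ pw (okw (!c) G) l := by
          rw [← pw_mul]
          apply pw_mono
          intro a ha
          rw [okw, if_pos (g2 a ha)]
          by_cases hc : Cst (th1 n₀ n) a
          · have hv := child_val (th1 n₀ n) g3.2 ha hc
            refine le_trans ?_ (le_add_self)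
            rw [if_pos hv, hZ, ZZ_cst _ _ _ _ _ hc]
          · have hs : size a ≤ N := by
              have h1 := size_le_of_mem ha
              have h2 := g3.1
              rw [size] at h2; omega
            refine le_trans ?_ (le_self_add)
            rw [if_pos ⟨hs, hc⟩]
        calc ω (.node (!c) l) * (Y * pw (Z (!c)) l) ≤ (ENNReal.ofReal (1 / (2 * n)) * pw ω l) * (Y * pw (Z (!c)) l) :=
              mul_le_mul' (hω.node _ _) le_rfl
          _ = (ENNReal.ofReal (1 / (2 * n)) * Y) * (pw ω l * pw (Z (!c)) l) := by ring
          _ ≤ _ := mul_le_mul' le_rfl this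
      all_goals exact bot_le
    refine (add_le_add hleaf hnode).trans ?_
    rw [hY, ← ENNReal.ofReal_mul (by positivity), ← ENNReal.ofReal_mul (by positivity), ← ENNReal.ofReal_mul (by positivity),
      ← ENNReal.ofReal_add (by positivity) (by positivity)]
    apply ENNReal.ofReal_le_ofReal
    unfold del'
    apply le_of_eq
    field_simp
    ring

open Classical in
theorem main_ineq (n₀ : ℕ) (hn : 16 * n₀ + 2048 ≤ n) (ω : AT n → ℝ≥0∞) (hω : Wt n ω) (c : Bool) :
    ∑' t, okw c (fun t => if ¬ Cst (th1 n₀ n) t then ω t * ZZ (th1 n₀ n) (ENNReal.ofReal (del' n₀ * n)) (vv n₀) c t else 0) t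
      ≤ ENNReal.ofReal (1 / 8) := by
  apply tsum_le_of_trunc
  intro N
  refine le_trans (le_of_eq ?_) (X_le n₀ hn ω hω N c)
  congr 1; ext t
  unfold okw
  by_cases h1 : size t ≤ N <;> simp [h1]

end
end S19

namespace S19
open AT Filter
open scoped ENNReal

section
variable {n : ℕ}

theorem one_le_pw {α : Type*} (g : α → ℝ≥0∞) (h : ∀ a, 1 ≤ g a) (l : List α) : 1 ≤ pw g l := by
  induction l with
  | nil => simp
  | cons a l ih => rw [pw_cons]; exact one_le_mul (h a) ih

theorem le_pw_of_mem {α : Type*} (g : α → ℝ≥0∞) (h : ∀ a, 1 ≤ g a) (l : List α) (a : α) (ha : a ∈ l) : g a ≤ pw g l := by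
  obtain ⟨l1, l2, rfl⟩ := List.append_of_mem ha
  rw [pw_append, pw_cons]
  calc g a = 1 * (g a * 1) := by simp
    _ ≤ _ := mul_le_mul' (one_le_pw g h _) (mul_le_mul' le_rfl (one_le_pw g h _))

theorem qq_le (hn : 2048 ≤ n) : qq n ≤ n := by
  have h1 := qq_sq n
  have h2 := qq_big hn
  nlinarith

theorem vv_int (n₀ : ℕ) (hn : 2048 ≤ n) (c : Bool) (t : AT n) (ht : isLeafB t = false) :
    ENNReal.ofReal (del n₀ * qq n) ≤ vv n₀ c t := by
  have hq := qq_le hn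
  have hδ := del_pos n₀
  rw [vv, if_neg (by simp [ht])]
  split_ifs
  · exact ENNReal.ofReal_le_ofReal (by nlinarith)
  · exact le_rfl

theorem vv_one (n₀ : ℕ) (hn : 2048 ≤ n) (h1 : 1 ≤ del n₀ * qq n) (c : Bool) (t : AT n) : 1 ≤ vv n₀ c t := by
  cases ht : isLeafB t with
  | false =>
    refine le_trans ?_ (vv_int n₀ hn c t ht)
    simpa using ENNReal.ofReal_le_ofReal h1
  | true =>
    rw [vv, if_pos ht]
    simpa using ENNReal.ofReal_le_ofReal (by norm_num : (1:ℝ) ≤ 9 / 8)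

theorem del_le (n₀ : ℕ) : del n₀ ≤ 1 := by
  unfold del
  rw [div_le_one (by positivity)]
  have : (0:ℝ) ≤ n₀ := by positivity
  linarith

theorem del'_le (n₀ : ℕ) : del' n₀ ≤ 1 := by
  unfold del'
  rw [div_le_one (by positivity)]
  have : (0:ℝ) ≤ n₀ := by positivity
  linarith

theorem leaf_size (t : AT n) (h : isLeafB t = true) : size t = 1 := by
  cases t with
  | leaf i b => simp [size]
  | node d l => simp [isLeafB] at h

theorem hsz_leaf (l : List (Bool × AT n)) (h : ∀ p ∈ l, isLeafB p.2 = true) : hsz l = l.length := by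
  induction l with
  | nil => simp [hsz]
  | cons a l ih =>
    have h1 := ih (fun p hp => h p (by simp [hp]))
    have h2 := leaf_size a.2 (h a (by simp))
    simp only [hsz, List.map_cons, List.sum_cons, List.length_cons] at h1 ⊢
    omega

theorem pw_leaf (n₀ : ℕ) (l : List (Bool × AT n)) (h : ∀ p ∈ l, isLeafB p.2 = true) :
    pw (fun p : Bool × AT n => vv n₀ p.1 p.2) l = ENNReal.ofReal ((9 / 8) ^ l.length) := by
  induction l with
  | nil => simp
  | cons a l ih =>
    rw [pw_cons, ih (fun p hp => h p (by simp [hp])), vv, if_pos (h a (by simp)), ← ENNReal.ofReal_mul (by norm_num),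
      List.length_cons, pow_succ']

theorem pw_lower (n₀ : ℕ) (hn : 2048 ≤ n) (h1 : 1 ≤ del n₀ * qq n) (k : ℕ) (hk : (n:ℝ) ≤ (9 / 8) ^ k)
    (l : List (Bool × AT n)) (hl : k ≤ hsz l)
    (hb : ∀ p ∈ l, isLeafB p.2 = false → (∀ q ∈ l, q = p ∨ isLeafB q.2 = true) → Bad n₀ p.1 p.2) :
    ENNReal.ofReal (del n₀ ^ 2 * n) ≤ pw (fun p : Bool × AT n => vv n₀ p.1 p.2) l := by
  have hδ := del_pos n₀
  have hδ1 := del_le n₀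
  have hn0 : (0:ℝ) ≤ n := by positivity
  have hone : ∀ p : Bool × AT n, 1 ≤ vv n₀ p.1 p.2 := fun p => vv_one n₀ hn h1 _ _
  have hd2 : del n₀ ^ 2 ≤ del n₀ := by nlinarith
  by_cases hall : ∀ p ∈ l, isLeafB p.2 = true
  · rw [pw_leaf n₀ l hall, ← hsz_leaf l hall]
    apply ENNReal.ofReal_le_ofReal
    have : (9 / 8 : ℝ) ^ k ≤ (9 / 8) ^ hsz l := pow_le_pow_right₀ (by norm_num) hl
    nlinarith
  push Not at hall
  obtain ⟨p, hp, hpl⟩ := hall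
  have hpl : isLeafB p.2 = false := by simpa using hpl
  by_cases hq : ∀ q ∈ l, q = p ∨ isLeafB q.2 = true
  · refine le_trans ?_ (le_pw_of_mem (fun p : Bool × AT n => vv n₀ p.1 p.2) hone l p hp)
    rw [vv, if_neg (by simp [hpl]), if_pos (hb p hp hpl hq)]
    exact ENNReal.ofReal_le_ofReal (by nlinarith)
  push Not at hq
  obtain ⟨q, hql, hqp, hq⟩ := hq
  have hq : isLeafB q.2 = false := by simpa using hq
  obtain ⟨l1, l2, rfl⟩ := List.append_of_mem hp
  have hmem : q ∈ l1 ++ l2 := by simp at hql ⊢; tauto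
  have e : pw (fun p : Bool × AT n => vv n₀ p.1 p.2) (l1 ++ p :: l2) = vv n₀ p.1 p.2 * pw (fun p : Bool × AT n => vv n₀ p.1 p.2) (l1 ++ l2) := by
    rw [pw_append, pw_cons, pw_append]; ring
  rw [e]
  refine le_trans ?_ (mul_le_mul' (vv_int n₀ hn _ _ hpl) ((vv_int n₀ hn q.1 q.2 hq).trans (le_pw_of_mem (fun p : Bool × AT n => vv n₀ p.1 p.2) hone _ q hmem)))
  rw [← ENNReal.ofReal_mul (by linarith)]
  apply ENNReal.ofReal_le_ofReal
  have := qq_sq n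
  have e2 : del n₀ * qq n * (del n₀ * qq n) = del n₀ ^ 2 * (2 * n) := by rw [← this]; ring
  rw [e2]
  nlinarith [sq_nonneg (del n₀)]

noncomputable def kap (n₀ L : ℕ) : ℝ := del' n₀ ^ (L + 1) * del n₀ ^ 2

theorem kap_pos (n₀ L : ℕ) : 0 < kap n₀ L := by
  have := del_pos n₀
  have := del'_pos n₀
  unfold kap; positivity

theorem ZZ_lower (n₀ : ℕ) (hn : 2048 ≤ n) (h1 : 1 ≤ del n₀ * qq n) (h2 : 1 ≤ del' n₀ * n)
    (k : ℕ) (hk : (n:ℝ) ≤ (9 / 8) ^ k)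
    (f : (Fin n → Bool) → Bool) (hf : ∀ β x, f (th n₀ β x) = f x) (hf1 : ∀ b, f ≠ fun _ => b)
    (L : ℕ) (hL : ∀ r : AT n, WF r → eval r = f → L ≤ size r) (t : AT n) (hw : WF t) (ht : eval t = f)
    (hne : ¬ EmbM f t) (c : Bool) (hok : Ok c t) (hs : k + L ≤ size t) :
    ENNReal.ofReal (kap n₀ L * n ^ (L + 1)) ≤ ZZ (th1 n₀ n) (ENNReal.ofReal (del' n₀ * n)) (vv n₀) c t := by
  have hδ := del_pos n₀
  have hδ1 := del_le n₀
  have hδ' := del'_pos n₀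
  have hδ'1 := del'_le n₀
  have hn0 : (0:ℝ) ≤ n := by positivity
  have hone : ∀ p : Bool × AT n, 1 ≤ vv n₀ p.1 p.2 := fun p => vv_one n₀ hn h1 _ _
  obtain ⟨_, hm, _⟩ := mm_lower (th1 n₀ n) (th_spec _) f (hf _) hf1 L hL t hw ht
  rw [ZZ, ← ENNReal.ofReal_pow (by linarith)]
  rcases Nat.lt_or_ge L (mm (th1 n₀ n) t) with hlt | hge
  · calc ENNReal.ofReal (kap n₀ L * n ^ (L + 1)) ≤ ENNReal.ofReal ((del' n₀ * n) ^ mm (th1 n₀ n) t) * 1 := by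
          rw [mul_one]
          apply ENNReal.ofReal_le_ofReal
          refine le_trans ?_ (pow_le_pow_right₀ h2 hlt)
          rw [mul_pow, kap]
          have : del n₀ ^ 2 ≤ 1 := pow_le_one₀ hδ.le hδ1
          have h3 : (0:ℝ) ≤ del' n₀ ^ (L + 1) * n ^ (L + 1) := by positivity
          calc _ = del' n₀ ^ (L + 1) * n ^ (L + 1) * del n₀ ^ 2 := by ring
            _ ≤ _ := mul_le_of_le_one_right h3 this
      _ ≤ _ := mul_le_mul' le_rfl (one_le_pw _ hone _)
  · have hmL : mm (th1 n₀ n) t = L := le_antisymm hge hm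
    have hsp := size_split (th1 n₀ n) t c
    have hp := pw_lower n₀ hn h1 k hk (hg (th1 n₀ n) c t) (by omega)
      (fun p hp hpl hq => struct_bad f hf hf1 L hL t hw ht hne c hok hmL p hp hpl hq)
    refine le_trans ?_ (mul_le_mul' le_rfl hp)
    rw [← ENNReal.ofReal_mul (by positivity), hmL]
    apply ENNReal.ofReal_le_ofReal
    rw [kap]
    have h3 : (0:ℝ) ≤ (del' n₀ * n) ^ L * (del n₀ ^ 2 * n) := by positivity
    calc _ = (del' n₀ * n) ^ L * (del n₀ ^ 2 * n) * del' n₀ := by rw [mul_pow]; ring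
      _ ≤ _ := mul_le_of_le_one_right h3 hδ'1

theorem mu_bound (n₀ : ℕ) (hn : 16 * n₀ + 2048 ≤ n) (h1 : 1 ≤ del n₀ * qq n) (h2 : 1 ≤ del' n₀ * n)
    (f : (Fin n → Bool) → Bool) (hf : ∀ β x, f (th n₀ β x) = f x) (hf1 : ∀ b, f ≠ fun _ => b)
    (L : ℕ) (hL : ∀ r : AT n, WF r → eval r = f → L ≤ size r) (c : Bool) (μ : ℝ)
    (hμ : Tendsto (fun m => rc c (fun t => t ∈ (⋃ k, Ek (Ifam n f) k)) m / av n m) atTop (nhds μ)) :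
    μ ≤ 2 * (1 / (8 * (kap n₀ L * n ^ (L + 1)))) * (1 + qq n) := by
  classical
  have hκ := kap_pos n₀ L
  have hn' : (1:ℝ) ≤ n := by exact_mod_cast (by omega : 1 ≤ n)
  obtain ⟨k, hk⟩ := pow_unbounded_of_one_lt (n:ℝ) (by norm_num : (1:ℝ) < 9 / 8)
  have hK : 0 < kap n₀ L * (n:ℝ) ^ (L + 1) := by positivity
  refine transfer n (by omega) c _ μ hμ (k + L) _ (by positivity) (fun ω hω => ?_)
  have hmain := main_ineq n₀ hn ω hω c
  have key : (∑' t, okw c (fun t => if t ∈ (⋃ k, Ek (Ifam n f) k) ∧ k + L ≤ size t then ω t else 0) t) * ENNReal.ofReal (kap n₀ L * n ^ (L + 1))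
      ≤ ENNReal.ofReal (1 / 8) := by
    refine le_trans ?_ hmain
    rw [← ENNReal.tsum_mul_right]
    refine ENNReal.tsum_le_tsum (fun t => ?_)
    by_cases ho : Ok c t
    swap
    · rw [okw, if_neg ho]; simp
    rw [okw, okw, if_pos ho, if_pos ho]
    by_cases hQ : t ∈ (⋃ k, Ek (Ifam n f) k) ∧ k + L ≤ size t
    swap
    · rw [if_neg hQ]; simp
    rw [if_pos hQ]
    obtain ⟨q1, q2, q3⟩ := (ek_char f hf1 t).1 hQ.1
    have hc := (mm_lower (th1 n₀ n) (th_spec _) f (hf _) hf1 L hL t q1 q2).1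
    rw [if_pos hc]
    exact mul_le_mul' le_rfl (ZZ_lower n₀ (by omega) h1 h2 k hk.le f hf hf1 L hL t q1 q2 q3 c ho hQ.2)
  have h8 : ENNReal.ofReal (1 / (8 * (kap n₀ L * n ^ (L + 1)))) = ENNReal.ofReal (1 / 8) / ENNReal.ofReal (kap n₀ L * n ^ (L + 1)) := by
    rw [← ENNReal.ofReal_div_of_pos hK]; congr 1; field_simp
  rw [h8, ENNReal.le_div_iff_mul_le (Or.inl (by simpa using hK)) (Or.inl ENNReal.ofReal_ne_top)]
  convert key

theorem mu_exists (n₀ : ℕ) (hn₀ : 1 ≤ n₀) (f : (Fin n₀ → Bool) → Bool)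
    (hf : 3 ≤ Lcomp n₀ f) (n : ℕ) : ∃ μ : ℝ, (∀ h : n₀ ≤ n,
        HasLimRatio n (⋃ k : ℕ, Ek (Ifam n (extend h f)) k) μ) ∧ 0 ≤ μ ∧
      (16 * n₀ + 2048 ≤ n → 1 ≤ del n₀ * qq n → 1 ≤ del' n₀ * n →
        μ ≤ 2 * (1 / (8 * (kap n₀ (Lcomp n₀ f) * n ^ (Lcomp n₀ f + 1)))) * (1 + qq n)) := by
  by_cases h : n₀ ≤ n
  swap
  · exact ⟨0, fun h' => absurd h' h, le_rfl, fun h' => by omega⟩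
  have hn : 1 ≤ n := by omega
  have hi := ek_inv (extend h f) (nonconst hn₀ h f hf)
  obtain ⟨a, ha⟩ := rc_conv n hn true _ hi
  obtain ⟨b, hb⟩ := rc_conv n hn false _ hi
  have hA : HasLimRatio n (⋃ k : ℕ, Ek (Ifam n (extend h f)) k) ((a + b) / 2) := by
    refine ((ha.add hb).div_const 2).congr' ?_
    filter_upwards [eventually_ge_atTop 2] with m hm
    rw [ratio, countIn_eq _ _ hm, A_eq _ _ hm]
    rw [← add_div, div_div, mul_comm]
  refine ⟨(a + b) / 2, fun _ => hA, ?_, fun g0 g1 g2 => ?_⟩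
  · have ha0 : 0 ≤ a := ge_of_tendsto' ha (fun m => div_nonneg (rc_nonneg _ _ _) (av_nonneg _ _))
    have hb0 : 0 ≤ b := ge_of_tendsto' hb (fun m => div_nonneg (rc_nonneg _ _ _) (av_nonneg _ _))
    linarith
  · have h3 := mu_bound n₀ g0 g1 g2 (extend h f) (th_extend h f) (nonconst hn₀ h f hf) (Lcomp n₀ f) (lcomp_le hn₀ h f hf) true a ha
    have h4 := mu_bound n₀ g0 g1 g2 (extend h f) (th_extend h f) (nonconst hn₀ h f hf) (Lcomp n₀ f) (lcomp_le hn₀ h f hf) false b hb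
    linarith

theorem qq_tendsto : Tendsto (fun n : ℕ => qq n) atTop atTop := by
  rw [tendsto_atTop]
  intro b
  filter_upwards [eventually_ge_atTop (Nat.ceil (b ^ 2))] with n hn
  have h1 : b ^ 2 ≤ n := (Nat.le_ceil _).trans (by exact_mod_cast hn)
  have h2 := qq_sq n
  have h3 := qq_nonneg n
  have h4 : (0:ℝ) ≤ n := by positivity
  exact (le_abs_self b).trans (abs_le_of_sq_le_sq (by linarith : b ^ 2 ≤ qq n ^ 2) h3)

theorem final (n₀ : ℕ) (hn₀ : 1 ≤ n₀) (f : (Fin n₀ → Bool) → Bool)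
    (hf : 3 ≤ Lcomp n₀ f) :
    ∃ μ : ℕ → ℝ,
      (∀ n : ℕ, ∀ h : n₀ ≤ n,
        HasLimRatio n (⋃ k : ℕ, Ek (Ifam n (extend h f)) k) (μ n)) ∧
      Tendsto (fun n : ℕ => (n : ℝ) ^ (Lcomp n₀ f) * μ n) atTop (nhds 0) := by
  choose μ h1 h2 h3 using mu_exists n₀ hn₀ f hf
  refine ⟨μ, h1, ?_⟩
  set L := Lcomp n₀ f
  have hκ := kap_pos n₀ L
  have hlim : Tendsto (fun n : ℕ => (1 / kap n₀ L) * (1 / qq n)) atTop (nhds 0) := by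
    have := (tendsto_inv_atTop_zero.comp qq_tendsto).const_mul (1 / kap n₀ L)
    simpa using this
  refine squeeze_zero' (Eventually.of_forall fun n => mul_nonneg (by positivity) (h2 n)) ?_ hlim
  filter_upwards [eventually_ge_atTop (16 * n₀ + 2048),
    (qq_tendsto.const_mul_atTop (del_pos n₀)).eventually_ge_atTop 1,
    (tendsto_natCast_atTop_atTop.const_mul_atTop (del'_pos n₀)).eventually_ge_atTop 1] with n g1 g2 g3
  have hb := h3 n g1 g2 g3
  have hq := qq_big (n := n) (by omega)
  have hs := qq_sq n
  have hn : (0:ℝ) < n := by exact_mod_cast (by omega : 0 < n)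
  refine (mul_le_mul_of_nonneg_left hb (by positivity)).trans ?_
  have hn2 : (n:ℝ) = qq n ^ 2 / 2 := by linarith
  have e : (n:ℝ) ^ L * (2 * (1 / (8 * (kap n₀ L * n ^ (L + 1)))) * (1 + qq n)) = (1 / kap n₀ L) * ((1 + qq n) / (4 * n)) := by
    rw [pow_succ]; field_simp; norm_num
  rw [e]
  refine mul_le_mul_of_nonneg_left ?_ (by positivity)
  rw [div_le_div_iff₀ (by positivity) (by linarith)]
  nlinarith

end
end S19

open Filter in
/-- For a fixed Boolean function `f` of `n₀` variables with tree size complexity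
`L(f) ≥ 3`, identified with its extension to `n ≥ n₀` variables,
`μ_n(E^*(I_f)) = o(n^{−L(f)})` as `n → ∞`, i.e. `n^{L(f)}·μ_n(E^*(I_f)) → 0`. -/
theorem statement19 (n₀ : ℕ) (hn₀ : 1 ≤ n₀) (f : (Fin n₀ → Bool) → Bool)
    (hf : 3 ≤ Lcomp n₀ f) :
    ∃ μ : ℕ → ℝ,
      (∀ n : ℕ, ∀ h : n₀ ≤ n,
        HasLimRatio n (⋃ k : ℕ, Ek (Ifam n (extend h f)) k) (μ n)) ∧
      Tendsto (fun n : ℕ => (n : ℝ) ^ (Lcomp n₀ f) * μ n) atTop (nhds 0) := S19.final n₀ hn₀ f hf
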